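/- The optimizer sets ℛ_τ^(2+α) converge to ℛ_τ^(2) in Hausdorff distance as α → 0⁺: for every ε > 0 there exists α₀ ∈ (0,1] such that for all α ∈ (0, α₀] and every R ∈ ℛ_τ^(2+α), there exists E ∈ ℛ_τ^(2) with d_H(R, E) ≤ ε. -/

import Mathlib

open MeasureTheory Set Filter ENNReal

noncomputable section

/-- The closed square `[-1,1]²` in `ℝ × ℝ`. -/
def Isq : Set (ℝ × ℝ) := Set.Icc (-1, -1) (1, 1)

/-- The open square `(-1,1)²` in `ℝ × ℝ`. -/
def Osq : Set (ℝ × ℝ) := Set.Ioo (-1, -1) (1, 1)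

/-- `τ` is a norm on `ℝ²`. -/
def IsNorm2 (τ : ℝ × ℝ → ℝ) : Prop :=
  (∀ x, τ x = 0 ↔ x = 0) ∧ (∀ (c : ℝ) (x), τ (c • x) = |c| * τ x) ∧
    ∀ x y, τ (x + y) ≤ τ x + τ y

/-- The Euclidean norm on `ℝ × ℝ`. -/
def eNorm2 (v : ℝ × ℝ) : ℝ := Real.sqrt (v.1 ^ 2 + v.2 ^ 2)

/-- The dual norm `τ*` of a norm `τ` on `ℝ²`. -/
def dualNorm (τ : ℝ × ℝ → ℝ) (w : ℝ × ℝ) : ℝ :=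
  sSup {x | ∃ v : ℝ × ℝ, τ v ≤ 1 ∧ x = v.1 * w.1 + v.2 * w.2}

/-- The divergence of a vector field on `ℝ²`. -/
def div2 (f : ℝ × ℝ → ℝ × ℝ) (x : ℝ × ℝ) : ℝ :=
  (fderiv ℝ f x (1, 0)).1 + (fderiv ℝ f x (0, 1)).2

/-- The perimeter `per(∂E)` of a set `E ⊆ ℝ²`, as the supremum of `∫_E div f`
over smooth compactly supported vector fields with `|f|₂ ≤ 1`. -/
def per (E : Set (ℝ × ℝ)) : ℝ≥0∞ :=
  ⨆ f ∈ {f : ℝ × ℝ → ℝ × ℝ |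
      ContDiff ℝ (⊤ : ℕ∞) f ∧ HasCompactSupport f ∧ ∀ x, eNorm2 (f x) ≤ 1},
    ENNReal.ofReal (∫ x in E, div2 f x)

/-- The restricted surface energy `I_τ(∂E)`: the supremum of `∫_E div f` over smooth
vector fields compactly supported in the open square with `τ*(f) ≤ 1`. -/
def surfE (τ : ℝ × ℝ → ℝ) (E : Set (ℝ × ℝ)) : ℝ≥0∞ :=
  ⨆ f ∈ {f : ℝ × ℝ → ℝ × ℝ |
      ContDiff ℝ (⊤ : ℕ∞) f ∧ HasCompactSupport f ∧ tsupport f ⊆ Osq ∧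
        ∀ x, dualNorm τ (f x) ≤ 1},
    ENNReal.ofReal (∫ x in E, div2 f x)

/-- `E ∈ 𝒞`: `E` is a subset of `[-1,1]²` of finite perimeter. -/
def MemC (E : Set (ℝ × ℝ)) : Prop := E ⊆ Isq ∧ per E ≠ ⊤

open Classical in
/-- The conductance `I_τ(∂E)/Leb(E)` of `E`, with the convention `0/0 = ∞`. -/
def conduct (τ : ℝ × ℝ → ℝ) (E : Set (ℝ × ℝ)) : ℝ≥0∞ :=
  if volume E = 0 then ⊤ else surfE τ E / volume E

/-- The optimal conductance `ψ_τ^(a)` over sets of finite perimeter in the square. -/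
def psi (τ : ℝ × ℝ → ℝ) (a : ℝ) : ℝ≥0∞ :=
  ⨅ E ∈ {E : Set (ℝ × ℝ) | MemC E ∧ volume E ≤ ENNReal.ofReal a}, conduct τ E

/-- The set of optimizers `𝒞_τ^(a)`. -/
def Copt (τ : ℝ × ℝ → ℝ) (a : ℝ) : Set (Set (ℝ × ℝ)) :=
  {E | MemC E ∧ volume E ≤ ENNReal.ofReal a ∧ conduct τ E = psi τ a}

/-- A set of finite perimeter is decomposable if it can be split into two parts of positive
measure whose perimeters add up to the perimeter of the whole. -/
def Decomposable (E : Set (ℝ × ℝ)) : Prop :=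
  ∃ A B : Set (ℝ × ℝ), E = A ∪ B ∧ Disjoint A B ∧ 0 < volume A ∧ 0 < volume B ∧
    per E = per A + per B

/-- The length of the curve `γ` measured with the gauge `β`: the supremum, over partitions
`0 = t₀ ≤ t₁ ≤ ⋯ ≤ t_n = 1`, of `∑ β(γ(t_j) - γ(t_{j-1}))`. -/
def varLength (β : ℝ × ℝ → ℝ) (γ : ℝ → ℝ × ℝ) : ℝ≥0∞ :=
  ⨆ (n : ℕ) (t : Fin (n + 1) → ℝ)
    (_ : Monotone t ∧ t 0 = 0 ∧ t (Fin.last n) = 1),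
    ENNReal.ofReal (∑ i : Fin n, β (γ (t i.succ) - γ (t i.castSucc)))

/-- `C` is a rectifiable Jordan curve: the image of a continuous injective map of the unit
circle (equivalently, a continuous `1`-periodic map injective on `[0,1)`) of finite length. -/
def IsRectJordanCurve (C : Set (ℝ × ℝ)) : Prop :=
  ∃ γ : ℝ → ℝ × ℝ, Continuous γ ∧ (∀ t, γ (t + 1) = γ t) ∧
    Set.InjOn γ (Set.Ico 0 1) ∧ C = γ '' Set.Icc 0 1 ∧ varLength eNorm2 γ ≠ ⊤

/-- The hull of a curve `C`: the union of `C` with all bounded connected components of its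
complement. -/
def hullSet (C : Set (ℝ × ℝ)) : Set (ℝ × ℝ) :=
  C ∪ {x | x ∉ C ∧ Bornology.IsBounded (connectedComponentIn Cᶜ x)}

/-- `R ∈ ℛ`: `R` is a compact subset of the square with nonempty interior whose boundary is
a finite union of rectifiable Jordan curves, any two of which have `ℋ¹`-null intersection. -/
def MemR (R : Set (ℝ × ℝ)) : Prop :=
  IsCompact R ∧ R ⊆ Isq ∧ (interior R).Nonempty ∧
    ∃ F : Finset (Set (ℝ × ℝ)),
      (∀ C ∈ F, IsRectJordanCurve C) ∧ frontier R = ⋃ C ∈ F, C ∧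
        ∀ C ∈ F, ∀ C' ∈ F, C ≠ C' →
          (MeasureTheory.Measure.hausdorffMeasure 1 : Measure (ℝ × ℝ)) (C ∩ C') = 0

/-- The optimal conductance `φ_τ^(a)` over the class `ℛ`. -/
def phiR (τ : ℝ × ℝ → ℝ) (a : ℝ) : ℝ≥0∞ :=
  ⨅ R ∈ {R : Set (ℝ × ℝ) | MemR R ∧ volume R ≤ ENNReal.ofReal a}, conduct τ R

/-- The set of optimizers `ℛ_τ^(a)`. -/
def Ropt (τ : ℝ × ℝ → ℝ) (a : ℝ) : Set (Set (ℝ × ℝ)) :=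
  {R | MemR R ∧ volume R ≤ ENNReal.ofReal a ∧ conduct τ R = phiR τ a}

/-- `L¹` convergence of sets: `Leb(E_k Δ E₀) → 0`. -/
def TendstoL1 (E : ℕ → Set (ℝ × ℝ)) (E₀ : Set (ℝ × ℝ)) : Prop :=
  Tendsto (fun k => volume (symmDiff (E k) E₀)) atTop (nhds 0)

/-- `ρ` is a (piecewise-linear) polygonal curve on `[0,1]`. -/
def IsPolygonal (ρ : ℝ → ℝ × ℝ) : Prop :=
  ∃ (n : ℕ) (s : Fin (n + 1) → ℝ), Monotone s ∧ s 0 = 0 ∧ s (Fin.last n) = 1 ∧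
    ∀ i : Fin n, ∀ t ∈ Set.Icc (s i.castSucc) (s i.succ),
      ρ t = ρ (s i.castSucc) +
        ((t - s i.castSucc) / (s i.succ - s i.castSucc)) • (ρ (s i.succ) - ρ (s i.castSucc))

end

theorem mem_Isq_iff {z : ℝ × ℝ} : z ∈ Isq ↔ (-1 ≤ z.1 ∧ -1 ≤ z.2) ∧ z.1 ≤ 1 ∧ z.2 ≤ 1 := by
  unfold Isq; rw [Set.mem_Icc, Prod.le_def, Prod.le_def]

theorem Isq_eq_prod : Isq = Icc (-1:ℝ) 1 ×ˢ Icc (-1:ℝ) 1 := by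
  unfold Isq; rw [Set.Icc_prod_Icc]

theorem Osq_subset_Isq : Osq ⊆ Isq := Ioo_subset_Icc_self

theorem open_subset_Osq : Ioo (-1:ℝ) 1 ×ˢ Ioo (-1:ℝ) 1 ⊆ Osq := by
  rintro ⟨x, y⟩ ⟨⟨h1, h2⟩, h3, h4⟩
  refine ⟨?_, ?_⟩ <;> rw [Prod.lt_iff]
  · left; exact ⟨h1, h3.le⟩
  · left; exact ⟨h2, h4.le⟩


noncomputable section
open scoped Topology

def D1 (v : ℝ × ℝ → ℝ) (z : ℝ × ℝ) : ℝ := fderiv ℝ v z (1, 0)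
def D2 (v : ℝ × ℝ → ℝ) (z : ℝ × ℝ) : ℝ := fderiv ℝ v z (0, 1)
def gm (v : ℝ × ℝ → ℝ) (z : ℝ × ℝ) : ℝ≥0∞ := max ‖D1 v z‖ₑ ‖D2 v z‖ₑ

theorem D1_cont {v : ℝ × ℝ → ℝ} (hv : ContDiff ℝ 1 v) : Continuous (D1 v) :=
  (hv.continuous_fderiv (by simp)).clm_apply continuous_const
theorem D2_cont {v : ℝ × ℝ → ℝ} (hv : ContDiff ℝ 1 v) : Continuous (D2 v) :=
  (hv.continuous_fderiv (by simp)).clm_apply continuous_const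
theorem gm_cont {v : ℝ × ℝ → ℝ} (hv : ContDiff ℝ 1 v) : Continuous (gm v) := by
  unfold gm
  exact (continuous_enorm.comp (D1_cont hv)).max (continuous_enorm.comp (D2_cont hv))

theorem ftc_le {f f' : ℝ → ℝ} {a b : ℝ} (hab : a ≤ b) {s : Set ℝ} (hs : s.Countable)
    (hc : ContinuousOn f (Icc a b)) (hd : ∀ x ∈ Ioo a b \ s, HasDerivAt f (f' x) x)
    (hm : Measurable f') : ‖f b - f a‖ₑ ≤ ∫⁻ x in Ioc a b, ‖f' x‖ₑ := by
  by_cases hi : IntegrableOn f' (Ioc a b)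
  · have := integral_eq_of_hasDerivAt_off_countable_of_le f f' hab hs hc hd
      ((intervalIntegrable_iff_integrableOn_Ioc_of_le hab).2 hi)
    rw [← this, intervalIntegral.integral_of_le hab]
    exact enorm_integral_le_lintegral_enorm _
  · have : ∫⁻ x in Ioc a b, ‖f' x‖ₑ = ⊤ := by
      by_contra h
      exact hi ⟨hm.aestronglyMeasurable, lt_top_iff_ne_top.2 h⟩
    rw [this]; exact le_top

theorem hasDerivAt_path {v : ℝ × ℝ → ℝ} (hv : ContDiff ℝ 1 v) {p q : ℝ → ℝ} {p' q' t : ℝ}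
    (hp : HasDerivAt p p' t) (hq : HasDerivAt q q' t) :
    HasDerivAt (fun t => v (p t, q t)) (p' * D1 v (p t, q t) + q' * D2 v (p t, q t)) t := by
  have h1 : HasFDerivAt v (fderiv ℝ v (p t, q t)) (p t, q t) :=
    (hv.differentiable (by simp) _).hasFDerivAt
  have h2 := h1.comp_hasDerivAt t (hp.prodMk hq)
  have h3 : fderiv ℝ v (p t, q t) (p', q')
      = p' * D1 v (p t, q t) + q' * D2 v (p t, q t) := by
    have : ((p', q') : ℝ × ℝ) = p' • (1, 0) + q' • (0, 1) := by simp
    rw [this, map_add, map_smul, map_smul]; simp [D1, D2]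
  rw [← h3]
  exact h2

theorem enorm_add_sub (a b : ℝ) : ‖a + b‖ₑ + ‖a - b‖ₑ = 2 * max ‖a‖ₑ ‖b‖ₑ := by
  have h : |a + b| + |a - b| = 2 * max |a| |b| := by
    rcases le_total |a| |b| with h | h
    · rw [max_eq_right h]
      rcases abs_cases a with h1 | h1 <;> rcases abs_cases b with h2 | h2 <;>
      rcases abs_cases (a + b) with h3 | h3 <;> rcases abs_cases (a - b) with h4 | h4 <;> linarith
    · rw [max_eq_left h]
      rcases abs_cases a with h1 | h1 <;> rcases abs_cases b with h2 | h2 <;>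
      rcases abs_cases (a + b) with h3 | h3 <;> rcases abs_cases (a - b) with h4 | h4 <;> linarith
  simp only [Real.enorm_eq_ofReal_abs]
  rw [← ENNReal.ofReal_add (abs_nonneg _) (abs_nonneg _), h, ENNReal.ofReal_mul (by norm_num),
    ← ENNReal.ofReal_max]
  simp

/-- horizontal estimate -/
theorem horiz_le {v : ℝ × ℝ → ℝ} (hv : ContDiff ℝ 1 v) {a b : ℝ} (hab : a ≤ b) (y : ℝ) :
    ‖v (b, y) - v (a, y)‖ₑ ≤ ∫⁻ x in Ioc a b, ‖D1 v (x, y)‖ₑ := by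
  refine ftc_le (f := fun x => v (x, y)) (f' := fun x => D1 v (x, y)) hab countable_empty ?_ ?_ ?_
  · exact (hv.continuous.comp (by fun_prop)).continuousOn
  · intro x _
    simpa using hasDerivAt_path hv (hasDerivAt_id x) (hasDerivAt_const x y)
  · exact ((D1_cont hv).comp (by fun_prop)).measurable

theorem vert_le {v : ℝ × ℝ → ℝ} (hv : ContDiff ℝ 1 v) {a b : ℝ} (hab : a ≤ b) (x : ℝ) :
    ‖v (x, b) - v (x, a)‖ₑ ≤ ∫⁻ y in Ioc a b, ‖D2 v (x, y)‖ₑ := by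
  refine ftc_le (f := fun y => v (x, y)) (f' := fun y => D2 v (x, y)) hab countable_empty ?_ ?_ ?_
  · exact (hv.continuous.comp (by fun_prop)).continuousOn
  · intro y _
    simpa using hasDerivAt_path hv (hasDerivAt_const y x) (hasDerivAt_id y)
  · exact ((D2_cont hv).comp (by fun_prop)).measurable

theorem sgn_sq_enorm {s : ℝ} (hs : s = 1 ∨ s = -1) (a : ℝ) : ‖s * a‖ₑ = ‖a‖ₑ := by
  rcases hs with rfl | rfl <;> simp

/-- reflection/translation of a `C¹` function -/
def refl2 (s t p q : ℝ) (v : ℝ × ℝ → ℝ) : ℝ × ℝ → ℝ := fun z => v (p + s * z.1, q + t * z.2)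

theorem refl2_contDiff {v : ℝ × ℝ → ℝ} (hv : ContDiff ℝ 1 v) (s t p q : ℝ) :
    ContDiff ℝ 1 (refl2 s t p q v) := by
  unfold refl2; exact hv.comp (by fun_prop)

theorem refl2_D1 {v : ℝ × ℝ → ℝ} (hv : ContDiff ℝ 1 v) (s t p q : ℝ) (z : ℝ × ℝ) :
    D1 (refl2 s t p q v) z = s * D1 v (p + s * z.1, q + t * z.2) := by
  have h1 := hasDerivAt_path (refl2_contDiff hv s t p q) (hasDerivAt_id z.1) (hasDerivAt_const z.1 z.2)
  have h2 := hasDerivAt_path hv (((hasDerivAt_id z.1).const_mul s).const_add p)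
    (hasDerivAt_const z.1 (q + t * z.2))
  simpa using h1.unique h2

theorem refl2_D2 {v : ℝ × ℝ → ℝ} (hv : ContDiff ℝ 1 v) (s t p q : ℝ) (z : ℝ × ℝ) :
    D2 (refl2 s t p q v) z = t * D2 v (p + s * z.1, q + t * z.2) := by
  have h1 := hasDerivAt_path (refl2_contDiff hv s t p q) (hasDerivAt_const z.2 z.1) (hasDerivAt_id z.2)
  have h2 := hasDerivAt_path hv (hasDerivAt_const z.2 (p + s * z.1))
    (((hasDerivAt_id z.2).const_mul t).const_add q)
  simpa using h1.unique h2

theorem refl2_gm {v : ℝ × ℝ → ℝ} (hv : ContDiff ℝ 1 v) {s t : ℝ} (hs : s = 1 ∨ s = -1)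
    (ht : t = 1 ∨ t = -1) (p q : ℝ) (z : ℝ × ℝ) :
    gm (refl2 s t p q v) z = gm v (p + s * z.1, q + t * z.2) := by
  unfold gm; rw [refl2_D1 hv, refl2_D2 hv, sgn_sq_enorm hs, sgn_sq_enorm ht]

/-- swap of coordinates -/
theorem swap_contDiff {v : ℝ × ℝ → ℝ} (hv : ContDiff ℝ 1 v) :
    ContDiff ℝ 1 (fun z : ℝ × ℝ => v (z.2, z.1)) := hv.comp (by fun_prop)

theorem swap_D1 {v : ℝ × ℝ → ℝ} (hv : ContDiff ℝ 1 v) (z : ℝ × ℝ) :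
    D1 (fun z : ℝ × ℝ => v (z.2, z.1)) z = D2 v (z.2, z.1) := by
  have h1 := hasDerivAt_path (swap_contDiff hv) (hasDerivAt_id z.1) (hasDerivAt_const z.1 z.2)
  have h2 := hasDerivAt_path hv (hasDerivAt_const z.1 z.2) (hasDerivAt_id z.1)
  simpa using h1.unique h2

theorem swap_D2 {v : ℝ × ℝ → ℝ} (hv : ContDiff ℝ 1 v) (z : ℝ × ℝ) :
    D2 (fun z : ℝ × ℝ => v (z.2, z.1)) z = D1 v (z.2, z.1) := by
  have h1 := hasDerivAt_path (swap_contDiff hv) (hasDerivAt_const z.2 z.1) (hasDerivAt_id z.2)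
  have h2 := hasDerivAt_path hv (hasDerivAt_id z.2) (hasDerivAt_const z.2 z.1)
  simpa using h1.unique h2

theorem swap_gm {v : ℝ × ℝ → ℝ} (hv : ContDiff ℝ 1 v) (z : ℝ × ℝ) :
    gm (fun z : ℝ × ℝ => v (z.2, z.1)) z = gm v (z.2, z.1) := by
  unfold gm; rw [swap_D1 hv, swap_D2 hv, max_comm]

theorem one_sub_gm (v : ℝ × ℝ → ℝ) (z : ℝ × ℝ) : gm (fun z => 1 - v z) z = gm v z := by
  unfold gm D1 D2; rw [fderiv_const_sub]; simp

end


noncomputable section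
open scoped Topology

theorem shear_lintegral {f : ℝ × ℝ → ℝ≥0∞} (hf : Measurable f) :
    ∫⁻ v : ℝ, ∫⁻ t : ℝ, f (t, t - v) = ∫⁻ z, f z := by
  rw [lintegral_lintegral_swap (by fun_prop), Measure.volume_eq_prod,
    lintegral_prod _ hf.aemeasurable]
  refine lintegral_congr fun t => ?_
  exact lintegral_sub_left_eq_self (fun y => f (t, y)) t

theorem shear_ae {P : ℝ × ℝ → Prop} (h : ∀ᵐ z : ℝ × ℝ, P z) :
    ∀ᵐ v : ℝ, ∀ᵐ t : ℝ, P (t, t - v) := by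
  obtain ⟨N, hN, hNm, hN0⟩ := exists_measurable_superset_of_null (ae_iff.1 h)
  have h1 := shear_lintegral (f := N.indicator 1) (measurable_one.indicator hNm)
  rw [lintegral_indicator_one hNm, hN0, lintegral_eq_zero_iff] at h1
  · filter_upwards [h1] with v hv
    have hv' : ∫⁻ t : ℝ, N.indicator (1 : ℝ × ℝ → ℝ≥0∞) (t, t - v) = 0 := hv
    rw [lintegral_eq_zero_iff] at hv'
    · filter_upwards [hv'] with t ht
      by_contra hc
      have : (t, t - v) ∈ N := hN hc
      simp [this] at ht
    · exact (measurable_one.indicator hNm).comp (by fun_prop)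
  · exact Measurable.lintegral_prod_right' (f := fun p : ℝ × ℝ =>
      N.indicator (1 : ℝ × ℝ → ℝ≥0∞) (p.2, p.2 - p.1))
      ((measurable_one.indicator hNm).comp (by fun_prop))

theorem refl_mp {s t : ℝ} (hs : s = 1 ∨ s = -1) (ht : t = 1 ∨ t = -1) (p q : ℝ) :
    MeasurePreserving (fun z : ℝ × ℝ => (p + s * z.1, q + t * z.2)) := by
  have key : ∀ s : ℝ, (s = 1 ∨ s = -1) → ∀ p : ℝ, MeasurePreserving (fun x : ℝ => p + s * x) := by
    rintro s (rfl | rfl) p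
    · simpa using measurePreserving_add_left (volume : Measure ℝ) p
    · have := Measure.measurePreserving_sub_left (volume : Measure ℝ) p
      simpa [sub_eq_add_neg] using this
  exact (key s hs p).prod (key t ht q)

theorem ae_abs2 {P : ℝ × ℝ → Prop} (h : ∀ᵐ z : ℝ × ℝ, P z) :
    ∀ᵐ z : ℝ × ℝ, P (|z.1|, |z.2|) := by
  have k : ∀ s t : ℝ, (s = 1 ∨ s = -1) → (t = 1 ∨ t = -1) →
      ∀ᵐ z : ℝ × ℝ, P (0 + s * z.1, 0 + t * z.2) := fun s t hs ht =>
    (refl_mp hs ht 0 0).quasiMeasurePreserving.ae h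
  filter_upwards [k 1 1 (by simp) (by simp), k 1 (-1) (by simp) (by simp),
    k (-1) 1 (by simp) (by simp), k (-1) (-1) (by simp) (by simp)] with z h1 h2 h3 h4
  simp only [zero_add, one_mul, neg_mul] at h1 h2 h3 h4
  rcases abs_choice z.1 with h | h <;> rcases abs_choice z.2 with h' | h' <;> rw [h, h'] <;>
    assumption

theorem ae_abs1 {P : ℝ → Prop} (h : ∀ᵐ z : ℝ, P z) {s : ℝ} (hs : s = 1 ∨ s = -1) (p : ℝ) :
    ∀ᵐ z : ℝ, P (|s * z + p|) := by
  have h1 : ∀ᵐ z : ℝ, P z ∧ P (-z) :=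
    h.and ((Measure.measurePreserving_neg (volume : Measure ℝ)).quasiMeasurePreserving.ae h)
  have h2 : ∀ᵐ z : ℝ, P (s * z + p) ∧ P (-(s * z + p)) := by
    rcases hs with rfl | rfl
    · simpa using (measurePreserving_add_right (volume : Measure ℝ) p).quasiMeasurePreserving.ae h1
    · have := (Measure.measurePreserving_sub_left (volume : Measure ℝ) p).quasiMeasurePreserving.ae h1
      filter_upwards [this] with z hz
      have e : -1 * z + p = p - z := by ring
      rw [e]; exact hz
  filter_upwards [h2] with z hz
  rcases abs_choice (s * z + p) with h | h <;> rw [h]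
  exacts [hz.1, hz.2]

theorem fold_lintegral {k : ℝ → ℝ≥0∞} (hk : Measurable k) (A : ℝ) (hA : 0 < A) :
    ∫⁻ x in Ioo (-A) A, k x = ∫⁻ x in Ioo 0 A, (k x + k (-x)) := by
  have h1 : (Ioo (-A) A : Set ℝ) =ᵐ[volume] (Ioo (-A) 0 ∪ Ioo 0 A : Set ℝ) := by
    have : (Ioo (-A) A : Set ℝ) = Ioc (-A) 0 ∪ Ioo 0 A := (Ioc_union_Ioo_eq_Ioo (by linarith) hA).symm
    rw [this]
    exact (Ioo_ae_eq_Ioc.symm).union (ae_eq_refl _)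
  rw [setLIntegral_congr h1, lintegral_union measurableSet_Ioo, lintegral_add_left hk, add_comm]
  · congr 1
    have := (Measure.measurePreserving_neg (volume : Measure ℝ)).setLIntegral_comp_preimage
      (measurableSet_Ioo (a := -A) (b := 0)) hk
    rw [← this]; simp
  · rw [disjoint_left]; rintro x ⟨_, h⟩ ⟨h', _⟩; linarith

theorem fold_lintegral2 {k : ℝ × ℝ → ℝ≥0∞} (hk : Measurable k) {A B : ℝ} (hA : 0 < A) (hB : 0 < B) :
    ∫⁻ z in Ioo (-A) A ×ˢ Ioo (-B) B, k z = ∫⁻ z in Ioo 0 A ×ˢ Ioo 0 B,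
      ((k (z.1, z.2) + k (z.1, -z.2)) + (k (-z.1, z.2) + k (-z.1, -z.2))) := by
  rw [Measure.volume_eq_prod, ← Measure.prod_restrict, ← Measure.prod_restrict,
    lintegral_prod _ hk.aemeasurable, lintegral_prod _ (by fun_prop)]
  rw [fold_lintegral (Measurable.lintegral_prod_right' hk) A hA]
  refine lintegral_congr fun x => ?_
  rw [fold_lintegral (k := fun y => k (x, y)) (by fun_prop) B hB,
    fold_lintegral (k := fun y => k (-x, y)) (by fun_prop) B hB,
    ← lintegral_add_left (by fun_prop)]

def sg (x : ℝ) : ℝ := if 0 < x then 1 else -1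
theorem sg_meas : Measurable sg := Measurable.ite measurableSet_Ioi measurable_const measurable_const

theorem sg_deriv {x : ℝ} (hx : x ≠ 0) : HasDerivAt (fun x : ℝ => |x|) (sg x) x := by
  unfold sg
  split_ifs with h
  · exact hasDerivAt_abs_pos h
  · exact hasDerivAt_abs_neg (lt_of_le_of_ne (not_lt.1 h) hx)

/-- derivative along diagonals of the unfolded function -/
def gdiag (w : ℝ × ℝ → ℝ) (z : ℝ × ℝ) : ℝ :=
  sg z.1 * D1 w (|z.1|, |z.2|) + sg z.2 * D2 w (|z.1|, |z.2|)

theorem gdiag_meas {w : ℝ × ℝ → ℝ} (hw : ContDiff ℝ 1 w) : Measurable (gdiag w) := by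
  unfold gdiag
  have h1 := (D1_cont hw).measurable
  have h2 := (D2_cont hw).measurable
  have h3 : Measurable (fun z : ℝ × ℝ => (|z.1|, |z.2|)) := by fun_prop
  exact ((sg_meas.comp measurable_fst).mul (h1.comp h3)).add
    ((sg_meas.comp measurable_snd).mul (h2.comp h3))

theorem gdiag_lintegral {w : ℝ × ℝ → ℝ} (hw : ContDiff ℝ 1 w) {A B : ℝ} (hA : 0 < A) (hB : 0 < B) :
    ∫⁻ z in Ioo (-A) A ×ˢ Ioo (-B) B, ‖gdiag w z‖ₑ = 4 * ∫⁻ z in Ioo 0 A ×ˢ Ioo 0 B, gm w z := by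
  rw [fold_lintegral2 (gdiag_meas hw).enorm hA hB, ← lintegral_const_mul _ (gm_cont hw).measurable]
  refine setLIntegral_congr_fun (measurableSet_Ioo.prod measurableSet_Ioo) ?_
  rintro ⟨x, y⟩ ⟨⟨hx, _⟩, ⟨hy, _⟩⟩
  have hx' : ¬ (0 < -x) := by simpa using le_of_lt hx
  have hy' : ¬ (0 < -y) := by simpa using le_of_lt hy
  simp only at hx hy
  simp only [gdiag, sg, hx, hy, hx', hy', if_true, if_false, abs_neg, abs_of_pos, one_mul, neg_mul]
  set a := D1 w (x, y)
  set b := D2 w (x, y)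
  have e1 : ‖-a + b‖ₑ = ‖a - b‖ₑ := by rw [← enorm_neg]; congr 1; ring
  have e2 : ‖-a + -b‖ₑ = ‖a + b‖ₑ := by rw [← enorm_neg]; congr 1; ring
  have e3 : a + -b = a - b := by ring
  rw [e1, e2, e3, add_comm ‖a - b‖ₑ, enorm_add_sub]
  show _ = 4 * max ‖a‖ₑ ‖b‖ₑ
  rw [← add_mul]; norm_num

theorem diag_le {w : ℝ × ℝ → ℝ} (hw : ContDiff ℝ 1 w) {a b : ℝ} (hab : a ≤ b) (v : ℝ) :
    ‖w (|b|, |b - v|) - w (|a|, |a - v|)‖ₑ ≤ ∫⁻ t in Ioc a b, ‖gdiag w (t, t - v)‖ₑ := by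
  refine ftc_le (f := fun t => w (|t|, |t - v|)) (f' := fun t => gdiag w (t, t - v)) hab
    (s := {0, v}) (by simp) ?_ ?_ ?_
  · exact (hw.continuous.comp (by fun_prop)).continuousOn
  · rintro x ⟨_, hx⟩
    simp only [mem_insert_iff, mem_singleton_iff, not_or] at hx
    have h1 := sg_deriv hx.1
    have h2 := (sg_deriv (sub_ne_zero.2 hx.2)).comp_sub_const x v
    exact hasDerivAt_path hw h1 h2
  · exact (gdiag_meas hw).comp (by fun_prop)

end


noncomputable section
open scoped Topology

theorem box_aux {A B : ℝ} (hA : 0 < A) (hB : 0 < B)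
    {w : ℕ → ℝ × ℝ → ℝ} (hw : ∀ n, ContDiff ℝ 1 (w n)) {F : Set (ℝ × ℝ)}
    (hFs : F ⊆ Ioo 0 A ×ˢ Ioo 0 B)
    (hconv : ∀ᵐ z : ℝ × ℝ, z ∈ F → Tendsto (fun n => w n z) atTop (𝓝 1))
    (h1 : ∀ᵐ Y : ℝ, Y ∈ Ioo 0 B → Tendsto (fun n => w n (A, Y)) atTop (𝓝 0))
    (h2 : ∀ᵐ X : ℝ, X ∈ Ioo 0 A → Tendsto (fun n => w n (X, B)) atTop (𝓝 0)) :
    ∀ᵐ v : ℝ, volume {t : ℝ | (|t|, |t - v|) ∈ F} ≠ 0 →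
      2 ≤ liminf (fun n => ∫⁻ t : ℝ, (Ioo (-A) A ×ˢ Ioo (-B) B).indicator
        (fun z => ‖gdiag (w n) z‖ₑ) (t, t - v)) atTop := by
  have hc := shear_ae (ae_abs2 hconv)
  have fin : ∀ a : ℝ, ∀ᵐ v : ℝ, v ≠ a := fun a => by
    simp [ae_iff]
  filter_upwards [hc, ae_abs1 h1 (s := -1) (by simp) (-A), ae_abs1 h1 (s := -1) (by simp) A,
    ae_abs1 h2 (s := 1) (by simp) (-B), ae_abs1 h2 (s := 1) (by simp) B, fin A, fin (-A), fin B,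
    fin (-B), fin (B - A), fin (A - B), fin (A + B), fin (-A - B)]
    with v hc a1 a2 b1 b2 n1 n2 n3 n4 n5 n6 n7 n8 hv
  obtain ⟨t, htF, htc⟩ : ∃ t, (|t|, |t - v|) ∈ F ∧
      Tendsto (fun n => w n (|t|, |t - v|)) atTop (𝓝 1) := by
    by_contra hcon
    push Not at hcon
    apply hv
    have : ∀ᵐ t : ℝ, ¬ (|t|, |t - v|) ∈ F := by
      filter_upwards [hc] with t ht h
      exact hcon t h (ht h)
    simpa [ae_iff] using this
  have hR := hFs htF
  simp only [mem_prod, mem_Ioo, abs_pos, abs_lt] at hR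
  obtain ⟨⟨_, hR1, hR2⟩, _, hR3, hR4⟩ := hR
  set a := max (-A) (v - B) with ha
  set b := min A (v + B) with hb
  have hat : a < t := by rw [ha, max_lt_iff]; constructor <;> linarith
  have htb : t < b := by rw [hb, lt_min_iff]; constructor <;> linarith
  have hae : Tendsto (fun n => w n (|a|, |a - v|)) atTop (𝓝 0) := by
    rcases le_total (v - B) (-A) with h | h
    · have e : a = -A := max_eq_left h
      have e2 : |(-1) * v + -A| = |a - v| := by rw [e]; congr 1; ring
      rw [e2] at a1
      rw [show |a| = A by rw [e, abs_neg, abs_of_pos hA]]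
      apply a1
      rw [e]
      refine ⟨abs_pos.2 fun h => n2 (by linarith), abs_lt.2 ⟨lt_of_le_of_ne (by linarith) fun h => n5 (by linarith), by linarith⟩⟩
    · have e : a = v - B := max_eq_right h
      have e2 : |1 * v + -B| = |a| := by rw [e]; congr 1; ring
      rw [e2] at b1
      rw [show |a - v| = B by rw [e]; simp [abs_of_pos hB]]
      apply b1
      rw [e]
      refine ⟨abs_pos.2 fun h => n3 (by linarith), abs_lt.2 ⟨lt_of_le_of_ne (by linarith) fun h => n5 (by linarith), by linarith⟩⟩
  have hbe : Tendsto (fun n => w n (|b|, |b - v|)) atTop (𝓝 0) := by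
    rcases le_total A (v + B) with h | h
    · have e : b = A := min_eq_left h
      have e2 : |(-1) * v + A| = |b - v| := by rw [e]; congr 1; ring
      rw [e2] at a2
      rw [show |b| = A by rw [e, abs_of_pos hA]]
      apply a2
      rw [e]
      refine ⟨abs_pos.2 fun h => n1 (by linarith), abs_lt.2 ⟨by linarith, lt_of_le_of_ne (by linarith) fun h => n6 (by linarith)⟩⟩
    · have e : b = v + B := min_eq_right h
      have e2 : |1 * v + B| = |b| := by rw [e]; congr 1; ring
      rw [e2] at b2
      rw [show |b - v| = B by rw [e]; simp [abs_of_pos hB]]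
      apply b2
      rw [e]
      refine ⟨abs_pos.2 fun h => n4 (by linarith), abs_lt.2 ⟨by linarith, lt_of_le_of_ne (by linarith) fun h => n6 (by linarith)⟩⟩
  have hlim : Tendsto (fun n => ‖w n (|t|, |t - v|) - w n (|a|, |a - v|)‖ₑ
      + ‖w n (|b|, |b - v|) - w n (|t|, |t - v|)‖ₑ) atTop (𝓝 2) := by
    have := ((htc.sub hae).enorm).add ((hbe.sub htc).enorm)
    convert this using 2
    simp; norm_num
  rw [← hlim.liminf_eq]
  refine liminf_le_liminf (Eventually.of_forall fun n => ?_)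
  calc _ ≤ (∫⁻ t in Ioc a t, ‖gdiag (w n) (t, t - v)‖ₑ) + ∫⁻ t in Ioc t b, ‖gdiag (w n) (t, t - v)‖ₑ :=
        add_le_add (diag_le (hw n) hat.le v) (diag_le (hw n) htb.le v)
    _ = ∫⁻ t in Ioc a b, ‖gdiag (w n) (t, t - v)‖ₑ := by
        rw [← lintegral_union measurableSet_Ioc, Ioc_union_Ioc_eq_Ioc hat.le htb.le]
        rw [disjoint_left]; rintro x ⟨_, h⟩ ⟨h', _⟩; linarith
    _ = ∫⁻ t in Ioo a b, ‖gdiag (w n) (t, t - v)‖ₑ := (setLIntegral_congr Ioo_ae_eq_Ioc).symm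
    _ ≤ _ := by
        rw [← lintegral_indicator measurableSet_Ioo]
        refine lintegral_mono fun s => ?_
        simp only [indicator]
        split_ifs with h h'
        · exact le_rfl
        · exfalso; apply h'
          have h1 := h.1
          have h2 := h.2
          rw [ha, max_lt_iff] at h1
          rw [hb, lt_min_iff] at h2
          refine ⟨⟨h1.1, h2.1⟩, ?_, ?_⟩ <;> simp only <;> linarith
        · exact bot_le
        · exact bot_le

theorem half_vol (v : ℝ) (T : Set ℝ) :
    volume {t : ℝ | 2 * t - v ∈ T} = ENNReal.ofReal (1/2) * volume T := by
  have h1 : volume ((fun x => x - v) ⁻¹' T) = volume T := by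
    simp only [sub_eq_add_neg]; exact measure_preimage_add_right _ _ _
  have h2 := Real.volume_preimage_mul_left (a := 2) (by norm_num) ((fun x => x - v) ⁻¹' T)
  rw [h1] at h2
  rw [show (1/2 : ℝ) = |2⁻¹| by norm_num, ← h2]; rfl

theorem box_lemma {A B : ℝ} (hA : 0 < A) (hA2 : A < 2) (hB : 0 < B) (hB2 : B < 2)
    {w : ℕ → ℝ × ℝ → ℝ} (hw : ∀ n, ContDiff ℝ 1 (w n)) {F : Set (ℝ × ℝ)} (hF : MeasurableSet F)
    (hFs : F ⊆ Ioo 0 A ×ˢ Ioo 0 B)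
    (hconv : ∀ᵐ z : ℝ × ℝ, z ∈ F → Tendsto (fun n => w n z) atTop (𝓝 1))
    (h1 : ∀ᵐ Y : ℝ, Y ∈ Ioo 0 B → Tendsto (fun n => w n (A, Y)) atTop (𝓝 0))
    (h2 : ∀ᵐ X : ℝ, X ∈ Ioo 0 A → Tendsto (fun n => w n (X, B)) atTop (𝓝 0))
    {J : ℝ≥0∞} (hJ : J = liminf (fun n => ∫⁻ z in Ioo 0 A ×ˢ Ioo 0 B, gm (w n) z) atTop)
    (hJ2 : J ≤ 2) : volume F ≤ J ∧ (volume F = 0 ∨ volume F < J) := by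
  set Ft : Set (ℝ × ℝ) := {z | (|z.1|, |z.2|) ∈ F} with hFt
  have hFtm : MeasurableSet Ft := hF.preimage (by fun_prop : Measurable fun z : ℝ × ℝ => (|z.1|, |z.2|))
  set S : Set ℝ := {v | volume {t : ℝ | (|t|, |t - v|) ∈ F} ≠ 0} with hS
  have hslice : Measurable fun v : ℝ => volume {t : ℝ | (|t|, |t - v|) ∈ F} := by
    have : MeasurableSet {p : ℝ × ℝ | (p.2, p.2 - p.1) ∈ Ft} :=
      hFtm.preimage (by fun_prop : Measurable fun p : ℝ × ℝ => (p.2, p.2 - p.1))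
    exact measurable_measure_prodMk_left this
  have hSm : MeasurableSet S := hslice (measurableSet_singleton 0).compl
  -- the measure bound on S
  have hSJ : 2 * volume S ≤ 4 * J := by
    have hb := box_aux hA hB hw hFs hconv h1 h2
    have meas : ∀ n, Measurable (fun p : ℝ × ℝ => (Ioo (-A) A ×ˢ Ioo (-B) B).indicator
        (fun z => ‖gdiag (w n) z‖ₑ) (p.2, p.2 - p.1)) := fun n =>
      ((gdiag_meas (hw n)).enorm.indicator (measurableSet_Ioo.prod measurableSet_Ioo)).comp
        (by fun_prop)
    calc 2 * volume S = ∫⁻ v in S, 2 := by simp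
      _ ≤ ∫⁻ v in S, liminf (fun n => ∫⁻ t : ℝ, (Ioo (-A) A ×ˢ Ioo (-B) B).indicator
          (fun z => ‖gdiag (w n) z‖ₑ) (t, t - v)) atTop := by
          refine lintegral_mono_ae ?_
          rw [ae_restrict_iff' hSm]
          exact hb
      _ ≤ ∫⁻ v, liminf (fun n => ∫⁻ t : ℝ, (Ioo (-A) A ×ˢ Ioo (-B) B).indicator
          (fun z => ‖gdiag (w n) z‖ₑ) (t, t - v)) atTop := setLIntegral_le_lintegral _ _
      _ ≤ liminf (fun n => ∫⁻ v, ∫⁻ t : ℝ, (Ioo (-A) A ×ˢ Ioo (-B) B).indicator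
          (fun z => ‖gdiag (w n) z‖ₑ) (t, t - v)) atTop :=
          lintegral_liminf_le fun n => (meas n).lintegral_prod_right'
      _ = liminf (fun n => 4 * ∫⁻ z in Ioo 0 A ×ˢ Ioo 0 B, gm (w n) z) atTop := by
          congr 1; ext n
          rw [shear_lintegral ((gdiag_meas (hw n)).enorm.indicator
            (measurableSet_Ioo.prod measurableSet_Ioo)),
            lintegral_indicator (measurableSet_Ioo.prod measurableSet_Ioo), gdiag_lintegral (hw n) hA hB]
      _ = 4 * J := by
          rw [hJ]
          exact ENNReal.liminf_const_mul_of_ne_top (by norm_num)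
  -- volumes
  have hvol4 : volume Ft = 4 * volume F := by
    have e : Ft ⊆ Ioo (-A) A ×ˢ Ioo (-B) B := by
      intro z hz
      have := hFs hz
      simp only [mem_prod, mem_Ioo, abs_pos, abs_lt] at this
      exact ⟨this.1.2, this.2.2⟩
    have h := fold_lintegral2 (k := Ft.indicator 1) (measurable_one.indicator hFtm) hA hB
    rw [setLIntegral_indicator hFtm, inter_eq_left.2 e] at h
    simp only [Pi.one_apply, lintegral_const, one_mul, Measure.restrict_apply, MeasurableSet.univ, univ_inter] at h
    rw [h]
    have : ∀ z ∈ Ioo 0 A ×ˢ Ioo 0 B, ((Ft.indicator (1 : ℝ × ℝ → ℝ≥0∞) (z.1, z.2) + Ft.indicator 1 (z.1, -z.2)) + (Ft.indicator 1 (-z.1, z.2) + Ft.indicator 1 (-z.1, -z.2))) = 4 * F.indicator 1 z := by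
      rintro ⟨x, y⟩ ⟨⟨hx, _⟩, hy, _⟩
      simp only at hx hy
      have q : ∀ s t : ℝ, (|s| = x) → (|t| = y) → Ft.indicator (1 : ℝ × ℝ → ℝ≥0∞) (s, t) = F.indicator 1 (x, y) := by
        intro s t hs ht
        have e : (s, t) ∈ Ft ↔ (x, y) ∈ F := by
          show (|s|, |t|) ∈ F ↔ _
          rw [hs, ht]
        by_cases h : (x, y) ∈ F
        · rw [indicator_of_mem h, indicator_of_mem (e.2 h)]; rfl
        · rw [indicator_of_notMem h, indicator_of_notMem (fun h' => h (e.1 h'))]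
      rw [q _ _ (abs_of_pos hx) (abs_of_pos hy), q _ (-y) (abs_of_pos hx) (by rw [abs_neg, abs_of_pos hy]),
        q (-x) _ (by rw [abs_neg, abs_of_pos hx]) (abs_of_pos hy),
        q (-x) (-y) (by rw [abs_neg, abs_of_pos hx]) (by rw [abs_neg, abs_of_pos hy])]
      ring
    rw [setLIntegral_congr_fun (measurableSet_Ioo.prod measurableSet_Ioo) this,
      lintegral_const_mul _ (measurable_one.indicator hF), setLIntegral_indicator hF,
      inter_eq_left.2 hFs]
    simp
  have hv1 : ∀ᵐ z : ℝ × ℝ, z ∈ Ft → z.1 - z.2 ∈ S := by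
    have hm : MeasurableSet (Ft ∩ {z | z.1 - z.2 ∉ S}) :=
      hFtm.inter (hSm.compl.preimage (by fun_prop : Measurable fun z : ℝ × ℝ => z.1 - z.2))
    have h := shear_lintegral (f := (Ft ∩ {z | z.1 - z.2 ∉ S}).indicator 1) (measurable_one.indicator hm)
    rw [lintegral_indicator_one hm] at h
    have h0 : volume (Ft ∩ {z | z.1 - z.2 ∉ S}) = 0 := by
      rw [← h]
      rw [← nonpos_iff_eq_zero]
      refine (lintegral_mono (g := fun _ => 0) fun v => ?_).trans (by simp)
      by_cases hv : v ∈ S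
      · simp [hv]
      · have hv' : volume {t : ℝ | (|t|, |t - v|) ∈ F} = 0 := by simpa [hS] using hv
        calc _ ≤ ∫⁻ t, {t : ℝ | (|t|, |t - v|) ∈ F}.indicator 1 t := by
              refine lintegral_mono fun t => ?_
              by_cases ht : (t, t - v) ∈ Ft
              · have ht2 : t ∈ {t : ℝ | (|t|, |t - v|) ∈ F} := ht
                rw [indicator_of_mem ht2]
                exact indicator_le_self' (fun _ _ => zero_le_one) _
              · rw [indicator_of_notMem (fun h => ht h.1)]; exact bot_le
            _ ≤ _ := by
              refine (lintegral_indicator_one_le _).trans hv'.le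
    rw [ae_iff]; convert h0 using 2; ext z; simp
  have hv2 : ∀ᵐ z : ℝ × ℝ, z ∈ Ft → z.1 + z.2 ∈ S := by
    have := (refl_mp (s := 1) (t := -1) (by simp) (by simp) 0 0).quasiMeasurePreserving.ae hv1
    filter_upwards [this] with z hz h
    have := hz (by simpa [hFt] using h)
    simpa using this
  set D := max A B with hD
  have hD0 : 0 < D := lt_max_of_lt_left hA
  have hD2 : D < 2 := max_lt hA2 hB2
  set S1 := S ∩ Ioo (-D) D with hS1
  set S2 := S \ Ioo (-D) D with hS2
  have hS1m : MeasurableSet S1 := hSm.inter measurableSet_Ioo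
  have hS2m : MeasurableSet S2 := hSm.diff measurableSet_Ioo
  have hS12 : volume S = volume S1 + volume S2 := (measure_inter_add_diff S measurableSet_Ioo).symm
  have hsl : volume Ft = ∫⁻ v, volume {t : ℝ | (t, t - v) ∈ Ft} := by
    rw [← lintegral_indicator_one hFtm, ← shear_lintegral (measurable_one.indicator hFtm)]
    refine lintegral_congr fun v => ?_
    rw [← lintegral_indicator_one]
    · rfl
    · exact hFtm.preimage (by fun_prop : Measurable fun t : ℝ => (t, t - v))
  have hsl2 : ∀ᵐ v : ℝ, volume {t : ℝ | (t, t - v) ∈ Ft}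
      ≤ S1.indicator (fun _ => ENNReal.ofReal (1/2) * volume S) v
        + S2.indicator (fun _ => ENNReal.ofReal (1/2) * volume S1) v := by
    filter_upwards [shear_ae hv2, shear_ae hv1] with v hv hv'
    by_cases hvS : v ∈ S
    · by_cases hvD : v ∈ Ioo (-D) D
      · rw [indicator_of_mem (show v ∈ S1 from ⟨hvS, hvD⟩), indicator_of_notMem (fun h => h.2 hvD), add_zero,
          ← half_vol v S]
        refine measure_mono_ae ?_
        filter_upwards [hv] with t ht h
        have : t + (t - v) ∈ S := ht h
        rw [show t + (t - v) = 2 * t - v by ring] at this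
        exact this
      · rw [indicator_of_notMem (fun h => hvD h.2), indicator_of_mem (show v ∈ S2 from ⟨hvS, hvD⟩), zero_add,
          ← half_vol v S1]
        refine measure_mono_ae ?_
        filter_upwards [hv] with t ht h
        have h0 : t + (t - v) ∈ S := ht h
        have hR := hFs h
        simp only [mem_prod, mem_Ioo, abs_pos, abs_lt] at hR
        rw [show t + (t - v) = 2 * t - v by ring] at h0
        have hAD : A ≤ D := le_max_left _ _
        have hBD : B ≤ D := le_max_right _ _
        refine ⟨h0, ?_⟩
        simp only [mem_Ioo, not_and_or, not_lt] at hvD ⊢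
        rcases hvD with hvD | hvD <;> constructor <;> linarith
    · rw [indicator_of_notMem (fun h => hvS h.1), indicator_of_notMem (fun h => hvS h.1)]
      rw [add_zero, nonpos_iff_eq_zero]
      simpa [hS, hFt] using hvS
  have hmain : 4 * volume F ≤ ENNReal.ofReal (1/2) * volume S * volume S1
      + ENNReal.ofReal (1/2) * volume S1 * volume S2 := by
    rw [← hvol4, hsl]
    refine (lintegral_mono_ae hsl2).trans ?_
    rw [lintegral_add_left (measurable_const.indicator hS1m), lintegral_indicator hS1m,
      lintegral_indicator hS2m]
    simp
  have hs1D : volume S1 ≤ ENNReal.ofReal (2 * D) := by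
    refine (measure_mono inter_subset_right).trans ?_
    rw [Real.volume_Ioo]; apply le_of_eq; congr 1; ring
  have hJt : J ≠ ⊤ := ne_top_of_le_ne_top (by norm_num) hJ2
  have hSt : volume S ≠ ⊤ := by
    intro h
    rw [h] at hSJ
    have : (2 : ℝ≥0∞) * ⊤ = ⊤ := ENNReal.mul_top (by norm_num)
    rw [this, top_le_iff] at hSJ
    exact ENNReal.mul_ne_top (by norm_num) hJt hSJ
  have hS1t : volume S1 ≠ ⊤ := ne_top_of_le_ne_top hSt (measure_mono inter_subset_left)
  have hS2t : volume S2 ≠ ⊤ := ne_top_of_le_ne_top hSt (measure_mono diff_subset)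
  have hFt' : volume F ≠ ⊤ := by
    intro h
    rw [h, ENNReal.mul_top (by norm_num), top_le_iff] at hmain
    refine absurd hmain (ENNReal.add_ne_top.2 ⟨?_, ?_⟩) <;>
      exact ENNReal.mul_ne_top (ENNReal.mul_ne_top (by simp) (by assumption)) (by assumption)
  rw [hS12] at hSJ hmain
  generalize volume S1 = x1 at *
  generalize volume S2 = x2 at *
  generalize volume F = f at *
  clear hJ
  lift x1 to NNReal using hS1t
  lift x2 to NNReal using hS2t
  lift f to NNReal using hFt'
  lift J to NNReal using hJt
  have e1 : (x1 : ℝ) ≤ 2 * D := by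
    have := ENNReal.toReal_mono ENNReal.ofReal_ne_top hs1D
    rwa [ENNReal.toReal_ofReal (by linarith)] at this
  have e2 : 2 * ((x1 : ℝ) + x2) ≤ 4 * J := by exact_mod_cast hSJ
  have e3 : (J : ℝ) ≤ 2 := by exact_mod_cast hJ2
  have e4 : 4 * (f : ℝ) ≤ 1/2 * (x1 + x2) * x1 + 1/2 * x1 * x2 := by
    have : ENNReal.ofReal (1/2) = ((1/2 : NNReal) : ℝ≥0∞) := by
      rw [ENNReal.ofReal]; congr 1; ext; simp
    rw [this] at hmain
    exact_mod_cast hmain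
  have p1 : (0:ℝ) ≤ x1 := x1.2
  have p2 : (0:ℝ) ≤ x2 := x2.2
  have p3 : (0:ℝ) ≤ J := J.2
  have p4 : (0:ℝ) ≤ f := f.2
  have k1 : (f : ℝ) ≤ J := by nlinarith
  refine ⟨by exact_mod_cast k1, ?_⟩
  by_contra hcon
  push Not at hcon
  obtain ⟨hc1, hc2⟩ := hcon
  have k2 : (J : ℝ) ≤ f := by exact_mod_cast hc2
  have k3 : (0:ℝ) < f := lt_of_le_of_ne p4 fun h => hc1 (by exact_mod_cast h.symm)
  have k5 : 2 ≤ (J : ℝ) := by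
    by_contra h
    have : (J : ℝ) * (2 - J) > 0 := by apply _root_.mul_pos <;> linarith
    nlinarith
  have k6 : (J : ℝ) = 2 := le_antisymm e3 k5
  have k7 : (x2 : ℝ) = 0 := by nlinarith
  nlinarith

end


noncomputable section
open scoped Topology

theorem refl_mp1 {s : ℝ} (hs : s = 1 ∨ s = -1) (p : ℝ) :
    MeasurePreserving (fun x : ℝ => p + s * x) := by
  rcases hs with rfl | rfl
  · simpa using measurePreserving_add_left (volume : Measure ℝ) p
  · have := Measure.measurePreserving_sub_left (volume : Measure ℝ) p
    simpa [sub_eq_add_neg] using this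

theorem neg_sgn {s : ℝ} (hs : s = 1 ∨ s = -1) : -s = 1 ∨ -s = -1 := by
  rcases hs with rfl | rfl <;> simp

theorem sgn_sq {s : ℝ} (hs : s = 1 ∨ s = -1) : s * s = 1 := by
  rcases hs with rfl | rfl <;> simp

theorem corner {σ τ x0 y0 : ℝ} (hσ : σ = 1 ∨ σ = -1) (hτ : τ = 1 ∨ τ = -1)
    (hx : x0 ∈ Ioo (-1 : ℝ) 1) (hy : y0 ∈ Ioo (-1 : ℝ) 1)
    {v : ℕ → ℝ × ℝ → ℝ} (hv : ∀ n, ContDiff ℝ 1 (v n)) {E : Set (ℝ × ℝ)} (hE : MeasurableSet E)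
    (hconv : ∀ᵐ z : ℝ × ℝ, z ∈ E → Tendsto (fun n => v n z) atTop (𝓝 1))
    (hrow : ∀ᵐ x : ℝ, x ∈ Icc (-1 : ℝ) 1 → Tendsto (fun n => v n (x, y0)) atTop (𝓝 0))
    (hcol : ∀ᵐ y : ℝ, y ∈ Icc (-1 : ℝ) 1 → Tendsto (fun n => v n (x0, y)) atTop (𝓝 0))
    {Q : Set (ℝ × ℝ)} (hQ : Q = {z | (1 + -σ * z.1, 1 + -τ * z.2) ∈
      Ioo 0 (1 - σ * x0) ×ˢ Ioo 0 (1 - τ * y0)})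
    {J : ℝ≥0∞} (hJ : J = liminf (fun n => ∫⁻ z in Q, gm (v n) z) atTop) (hJ2 : J ≤ 2) :
    volume (E ∩ Q) ≤ J ∧ (volume (E ∩ Q) = 0 ∨ volume (E ∩ Q) < J) := by
  have hT := refl_mp (neg_sgn hσ) (neg_sgn hτ) 1 1
  have hS := refl_mp (neg_sgn hσ) (neg_sgn hτ) σ τ
  set T := fun z : ℝ × ℝ => (1 + -σ * z.1, 1 + -τ * z.2) with hTdef
  set S := fun z : ℝ × ℝ => (σ + -σ * z.1, τ + -τ * z.2) with hSdef
  have hTT : ∀ z, S (T z) = z := by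
    rintro ⟨x, y⟩
    simp only [hTdef, hSdef]
    have h1 := sgn_sq hσ
    have h2 := sgn_sq hτ
    ext <;> simp only
    · linear_combination x * h1
    · linear_combination y * h2
  have hbox : MeasurableSet (Ioo 0 (1 - σ * x0) ×ˢ Ioo 0 (1 - τ * y0)) :=
    measurableSet_Ioo.prod measurableSet_Ioo
  have hQ' : Q = T ⁻¹' (Ioo 0 (1 - σ * x0) ×ˢ Ioo 0 (1 - τ * y0)) := hQ
  have hQm : MeasurableSet Q := hQ' ▸ hT.measurable hbox
  have hFm : MeasurableSet (S ⁻¹' E ∩ Ioo 0 (1 - σ * x0) ×ˢ Ioo 0 (1 - τ * y0)) :=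
    (hS.measurable hE).inter hbox
  have hvol : volume (S ⁻¹' E ∩ Ioo 0 (1 - σ * x0) ×ˢ Ioo 0 (1 - τ * y0)) = volume (E ∩ Q) := by
    rw [← hT.measure_preimage hFm.nullMeasurableSet]
    congr 1
    ext z
    simp only [mem_preimage, mem_inter_iff, hQ', hTT]
  have hxs : -1 < σ * x0 ∧ σ * x0 < 1 := by
    rcases hσ with rfl | rfl <;> constructor <;> linarith [hx.1, hx.2]
  have hys : -1 < τ * y0 ∧ τ * y0 < 1 := by
    rcases hτ with rfl | rfl <;> constructor <;> linarith [hy.1, hy.2]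
  rw [← hvol]
  refine box_lemma (w := fun n => refl2 (-σ) (-τ) σ τ (v n)) (by linarith) (by linarith) (by linarith)
    (by linarith) (fun n => refl2_contDiff (hv n) _ _ _ _) hFm inter_subset_right ?_ ?_ ?_ ?_ hJ2
  · filter_upwards [hS.quasiMeasurePreserving.ae hconv] with z hz h
    exact hz h.1
  · filter_upwards [(refl_mp1 (neg_sgn hτ) τ).quasiMeasurePreserving.ae hcol] with y hy h
    have : σ + -σ * (1 - σ * x0) = x0 := by linear_combination x0 * sgn_sq hσ
    simp only [refl2, this]
    apply hy
    obtain ⟨h1, h2⟩ := h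
    rcases hτ with rfl | rfl <;> constructor <;> linarith
  · filter_upwards [(refl_mp1 (neg_sgn hσ) σ).quasiMeasurePreserving.ae hrow] with y hy h
    have : τ + -τ * (1 - τ * y0) = y0 := by linear_combination y0 * sgn_sq hτ
    simp only [refl2, this]
    apply hy
    obtain ⟨h1, h2⟩ := h
    rcases hσ with rfl | rfl <;> constructor <;> linarith
  · rw [hJ]
    congr 1; ext n
    rw [← hT.setLIntegral_comp_preimage hbox (gm_cont (refl2_contDiff (hv n) _ _ _ _)).measurable, ← hQ']
    refine lintegral_congr fun z => ?_
    rw [refl2_gm (hv n) (neg_sgn hσ) (neg_sgn hτ)]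
    exact congrArg (gm (v n)) (hTT z).symm

theorem le_liminf_add' (f g : ℕ → ℝ≥0∞) :
    liminf f atTop + liminf g atTop ≤ liminf (fun n => f n + g n) atTop := by
  rw [liminf_eq_iSup_iInf_of_nat, liminf_eq_iSup_iInf_of_nat, liminf_eq_iSup_iInf_of_nat]
  rw [ENNReal.iSup_add_iSup_of_monotone]
  · refine iSup_mono fun n => le_iInf₂ fun i hi => ?_
    exact add_le_add (iInf₂_le i hi) (iInf₂_le i hi)
  · intro a b hab
    exact le_iInf₂ fun i hi => iInf₂_le i (hab.trans hi)
  · intro a b hab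
    exact le_iInf₂ fun i hi => iInf₂_le i (hab.trans hi)

theorem cross_empty {x0 y0 : ℝ} (hx : x0 ∈ Ioo (-1 : ℝ) 1) (hy : y0 ∈ Ioo (-1 : ℝ) 1)
    {v : ℕ → ℝ × ℝ → ℝ} (hv : ∀ n, ContDiff ℝ 1 (v n)) {E : Set (ℝ × ℝ)} (hE : MeasurableSet E)
    (hEs : E ⊆ Isq) (hvol : volume E = 2)
    (hconv : ∀ᵐ z : ℝ × ℝ, z ∈ E → Tendsto (fun n => v n z) atTop (𝓝 1))
    (hen : liminf (fun n => ∫⁻ z in Isq, gm (v n) z) atTop ≤ 2)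
    (hrow : ∀ᵐ x : ℝ, x ∈ Icc (-1 : ℝ) 1 → Tendsto (fun n => v n (x, y0)) atTop (𝓝 0))
    (hcol : ∀ᵐ y : ℝ, y ∈ Icc (-1 : ℝ) 1 → Tendsto (fun n => v n (x0, y)) atTop (𝓝 0)) : False := by
  set Q1 : Set (ℝ × ℝ) := Ioo x0 1 ×ˢ Ioo y0 1 with hQ1
  set Q2 : Set (ℝ × ℝ) := Ioo x0 1 ×ˢ Ioo (-1) y0 with hQ2
  set Q3 : Set (ℝ × ℝ) := Ioo (-1) x0 ×ˢ Ioo y0 1 with hQ3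
  set Q4 : Set (ℝ × ℝ) := Ioo (-1) x0 ×ˢ Ioo (-1) y0 with hQ4
  have hxo := hx.1
  have hxo' := hx.2
  have hyo := hy.1
  have hyo' := hy.2
  have m1 : MeasurableSet Q1 := measurableSet_Ioo.prod measurableSet_Ioo
  have m2 : MeasurableSet Q2 := measurableSet_Ioo.prod measurableSet_Ioo
  have m3 : MeasurableSet Q3 := measurableSet_Ioo.prod measurableSet_Ioo
  have m4 : MeasurableSet Q4 := measurableSet_Ioo.prod measurableSet_Ioo
  have d12 : Disjoint Q1 Q2 := by
    rw [disjoint_left]; rintro ⟨x, y⟩ ⟨⟨_, _⟩, _, _⟩ ⟨⟨_, _⟩, _, _⟩; simp only at *; linarith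
  have d123 : Disjoint (Q1 ∪ Q2) Q3 := by
    rw [disjoint_left]; rintro ⟨x, y⟩ (⟨⟨_, _⟩, _, _⟩ | ⟨⟨_, _⟩, _, _⟩) ⟨⟨_, _⟩, _, _⟩ <;> simp only at * <;> linarith
  have d1234 : Disjoint (Q1 ∪ Q2 ∪ Q3) Q4 := by
    rw [disjoint_left]; rintro ⟨x, y⟩ ((⟨⟨_, _⟩, _, _⟩ | ⟨⟨_, _⟩, _, _⟩) | ⟨⟨_, _⟩, _, _⟩) ⟨⟨_, _⟩, _, _⟩ <;> simp only at * <;> linarith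
  set J : Set (ℝ × ℝ) → ℝ≥0∞ := fun Q => liminf (fun n => ∫⁻ z in Q, gm (v n) z) atTop with hJ
  have hJsum : J Q1 + J Q2 + J Q3 + J Q4 ≤ 2 := by
    refine le_trans ?_ hen
    have a1 : J Q1 + J Q2 ≤ J (Q1 ∪ Q2) := by
      refine (le_liminf_add' _ _).trans (le_of_eq ?_)
      congr 1; ext n; rw [lintegral_union m2 d12]
    have a2 : J (Q1 ∪ Q2) + J Q3 ≤ J (Q1 ∪ Q2 ∪ Q3) := by
      refine (le_liminf_add' _ _).trans (le_of_eq ?_)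
      congr 1; ext n; rw [lintegral_union m3 d123]
    have a3 : J (Q1 ∪ Q2 ∪ Q3) + J Q4 ≤ J (Q1 ∪ Q2 ∪ Q3 ∪ Q4) := by
      refine (le_liminf_add' _ _).trans (le_of_eq ?_)
      congr 1; ext n; rw [lintegral_union m4 d1234]
    refine le_trans (add_le_add_left (add_le_add_left a1 _) _) ?_
    refine le_trans (add_le_add_left a2 _) (a3.trans ?_)
    refine liminf_le_liminf (Eventually.of_forall fun n => lintegral_mono_set ?_)
    rintro ⟨x, y⟩ h
    rw [mem_Isq_iff]
    rcases h with ((⟨⟨_, _⟩, _, _⟩ | ⟨⟨_, _⟩, _, _⟩) | ⟨⟨_, _⟩, _, _⟩) | ⟨⟨_, _⟩, _, _⟩ <;>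
      simp only at * <;> refine ⟨⟨?_, ?_⟩, ?_, ?_⟩ <;> linarith
  have hsum : volume (E ∩ Q1) + volume (E ∩ Q2) + volume (E ∩ Q3) + volume (E ∩ Q4) = 2 := by
    rw [← measure_union (d12.mono inter_subset_right inter_subset_right) (hE.inter m2), ← inter_union_distrib_left,
      ← measure_union (d123.mono inter_subset_right inter_subset_right) (hE.inter m3), ← inter_union_distrib_left,
      ← measure_union (d1234.mono inter_subset_right inter_subset_right) (hE.inter m4), ← inter_union_distrib_left,
      ← hvol]
    refine measure_congr ?_
    have fin : ∀ a : ℝ, ∀ᵐ v : ℝ, v ≠ a := fun a => by simp [ae_iff]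
    have f1 : ∀ a : ℝ, ∀ᵐ z : ℝ × ℝ, z.1 ≠ a := fun a =>
      Measure.quasiMeasurePreserving_fst.ae (fin a)
    have f2 : ∀ a : ℝ, ∀ᵐ z : ℝ × ℝ, z.2 ≠ a := fun a =>
      Measure.quasiMeasurePreserving_snd.ae (fin a)
    filter_upwards [f1 1, f1 (-1), f1 x0, f2 1, f2 (-1), f2 y0] with z a1 a2 a3 b1 b2 b3
    refine propext ⟨fun h => h.1, fun h => ⟨h, ?_⟩⟩
    have h0 := mem_Isq_iff.1 (hEs h)
    obtain ⟨⟨c1, c2⟩, c3, c4⟩ := h0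
    have c1' := lt_of_le_of_ne c1 (Ne.symm a2)
    have c2' := lt_of_le_of_ne c2 (Ne.symm b2)
    have c3' := lt_of_le_of_ne c3 a1
    have c4' := lt_of_le_of_ne c4 b1
    rcases lt_or_gt_of_ne a3 with h1 | h1 <;> rcases lt_or_gt_of_ne b3 with h2 | h2
    · right; exact ⟨⟨c1', h1⟩, c2', h2⟩
    · left; right; exact ⟨⟨c1', h1⟩, h2, c4'⟩
    · left; left; right; exact ⟨⟨h1, c3'⟩, c2', h2⟩
    · left; left; left; exact ⟨⟨h1, c3'⟩, h2, c4'⟩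
  have s4 : J Q4 ≤ 2 := le_trans le_add_self hJsum
  have s3 : J Q3 ≤ 2 := le_trans le_add_self (le_trans le_self_add hJsum)
  have s2 : J Q2 ≤ 2 := le_trans le_add_self (le_trans le_self_add (le_trans le_self_add hJsum))
  have s1 : J Q1 ≤ 2 := le_trans le_self_add (le_trans le_self_add (le_trans le_self_add hJsum))
  have q1 : Q1 = {z | (1 + -1 * z.1, 1 + -1 * z.2) ∈ Ioo 0 (1 - 1 * x0) ×ˢ Ioo 0 (1 - 1 * y0)} := by
    ext ⟨x, y⟩
    simp only [hQ1, mem_prod, mem_Ioo, mem_ofPred_eq]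
    constructor <;> rintro ⟨⟨_, _⟩, _, _⟩ <;> refine ⟨⟨?_, ?_⟩, ?_, ?_⟩ <;> linarith
  have q2 : Q2 = {z | (1 + -1 * z.1, 1 + -(-1) * z.2) ∈ Ioo 0 (1 - 1 * x0) ×ˢ Ioo 0 (1 - (-1) * y0)} := by
    ext ⟨x, y⟩
    simp only [hQ2, mem_prod, mem_Ioo, mem_ofPred_eq]
    constructor <;> rintro ⟨⟨_, _⟩, _, _⟩ <;> refine ⟨⟨?_, ?_⟩, ?_, ?_⟩ <;> linarith
  have q3 : Q3 = {z | (1 + -(-1) * z.1, 1 + -1 * z.2) ∈ Ioo 0 (1 - (-1) * x0) ×ˢ Ioo 0 (1 - 1 * y0)} := by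
    ext ⟨x, y⟩
    simp only [hQ3, mem_prod, mem_Ioo, mem_ofPred_eq]
    constructor <;> rintro ⟨⟨_, _⟩, _, _⟩ <;> refine ⟨⟨?_, ?_⟩, ?_, ?_⟩ <;> linarith
  have q4 : Q4 = {z | (1 + -(-1) * z.1, 1 + -(-1) * z.2) ∈ Ioo 0 (1 - (-1) * x0) ×ˢ Ioo 0 (1 - (-1) * y0)} := by
    ext ⟨x, y⟩
    simp only [hQ4, mem_prod, mem_Ioo, mem_ofPred_eq]
    constructor <;> rintro ⟨⟨_, _⟩, _, _⟩ <;> refine ⟨⟨?_, ?_⟩, ?_, ?_⟩ <;> linarith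
  have k1 := corner (Or.inl rfl) (Or.inl rfl) hx hy hv hE hconv hrow hcol q1 rfl s1
  have k2 := corner (Or.inl rfl) (Or.inr rfl) hx hy hv hE hconv hrow hcol q2 rfl s2
  have k3 := corner (Or.inr rfl) (Or.inl rfl) hx hy hv hE hconv hrow hcol q3 rfl s3
  have k4 := corner (Or.inr rfl) (Or.inr rfl) hx hy hv hE hconv hrow hcol q4 rfl s4
  change _ ≤ J Q1 ∧ (_ ∨ _ < J Q1) at k1
  change _ ≤ J Q2 ∧ (_ ∨ _ < J Q2) at k2
  change _ ≤ J Q3 ∧ (_ ∨ _ < J Q3) at k3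
  change _ ≤ J Q4 ∧ (_ ∨ _ < J Q4) at k4
  have t2 : (2 : ℝ≥0∞) ≠ ⊤ := by norm_num
  generalize J Q1 = j1 at *
  generalize J Q2 = j2 at *
  generalize J Q3 = j3 at *
  generalize J Q4 = j4 at *
  generalize volume (E ∩ Q1) = e1 at *
  generalize volume (E ∩ Q2) = e2 at *
  generalize volume (E ∩ Q3) = e3 at *
  generalize volume (E ∩ Q4) = e4 at *
  have t1 := ne_top_of_le_ne_top t2 s1
  have t2' := ne_top_of_le_ne_top t2 s2
  have t3 := ne_top_of_le_ne_top t2 s3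
  have t4 := ne_top_of_le_ne_top t2 s4
  have u1 := ne_top_of_le_ne_top t1 k1.1
  have u2 := ne_top_of_le_ne_top t2' k2.1
  have u3 := ne_top_of_le_ne_top t3 k3.1
  have u4 := ne_top_of_le_ne_top t4 k4.1
  lift j1 to NNReal using t1
  lift j2 to NNReal using t2'
  lift j3 to NNReal using t3
  lift j4 to NNReal using t4
  lift e1 to NNReal using u1
  lift e2 to NNReal using u2
  lift e3 to NNReal using u3
  lift e4 to NNReal using u4
  norm_cast at hJsum hsum k1 k2 k3 k4
  have hJs : (j1 : ℝ) + j2 + j3 + j4 ≤ 2 := by exact_mod_cast hJsum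
  have hes : (e1 : ℝ) + e2 + e3 + e4 = 2 := by exact_mod_cast hsum
  have l1 : (e1 : ℝ) ≤ j1 := by exact_mod_cast k1.1
  have l2 : (e2 : ℝ) ≤ j2 := by exact_mod_cast k2.1
  have l3 : (e3 : ℝ) ≤ j3 := by exact_mod_cast k3.1
  have l4 : (e4 : ℝ) ≤ j4 := by exact_mod_cast k4.1
  have z1 : (e1 : ℝ) = 0 := by
    rcases k1.2 with h | h
    · exact_mod_cast h
    · have : (e1 : ℝ) < j1 := by exact_mod_cast h
      linarith
  have z2 : (e2 : ℝ) = 0 := by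
    rcases k2.2 with h | h
    · exact_mod_cast h
    · have : (e2 : ℝ) < j2 := by exact_mod_cast h
      linarith
  have z3 : (e3 : ℝ) = 0 := by
    rcases k3.2 with h | h
    · exact_mod_cast h
    · have : (e3 : ℝ) < j3 := by exact_mod_cast h
      linarith
  have z4 : (e4 : ℝ) = 0 := by
    rcases k4.2 with h | h
    · exact_mod_cast h
    · have : (e4 : ℝ) < j4 := by exact_mod_cast h
      linarith
  linarith

end


noncomputable section
open scoped Topology

/-- row measure -/
def rowm (E : Set (ℝ × ℝ)) (y : ℝ) : ℝ≥0∞ := volume {x : ℝ | (x, y) ∈ E}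

/-- swapped set -/
def swapS (E : Set (ℝ × ℝ)) : Set (ℝ × ℝ) := {z | (z.2, z.1) ∈ E}

theorem swap_mp : MeasurePreserving (fun z : ℝ × ℝ => (z.2, z.1)) :=
  Measure.measurePreserving_swap

theorem swapS_meas {E : Set (ℝ × ℝ)} (hE : MeasurableSet E) : MeasurableSet (swapS E) :=
  swap_mp.measurable hE

theorem swapS_sub {E : Set (ℝ × ℝ)} (hE : E ⊆ Isq) : swapS E ⊆ Isq := by
  intro z hz
  have h := mem_Isq_iff.1 (hE hz)
  exact mem_Isq_iff.2 ⟨⟨h.1.2, h.1.1⟩, h.2.2, h.2.1⟩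

theorem swapS_vol {E : Set (ℝ × ℝ)} (hE : MeasurableSet E) : volume (swapS E) = volume E :=
  swap_mp.measure_preimage hE.nullMeasurableSet

theorem ae_row {P : ℝ × ℝ → Prop} (h : ∀ᵐ z, P z) : ∀ᵐ y : ℝ, ∀ᵐ x : ℝ, P (x, y) := by
  have h2 : ∀ᵐ z : ℝ × ℝ, P (z.2, z.1) := swap_mp.quasiMeasurePreserving.ae h
  exact Measure.ae_ae_of_ae_prod h2

theorem ae_col {P : ℝ × ℝ → Prop} (h : ∀ᵐ z, P z) : ∀ᵐ x : ℝ, ∀ᵐ y : ℝ, P (x, y) :=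
  Measure.ae_ae_of_ae_prod h

theorem rowm_zero {E : Set (ℝ × ℝ)} {y : ℝ} (h : rowm E y = 0) : ∀ᵐ x : ℝ, (x, y) ∉ E := by
  rw [ae_iff]; simpa [rowm] using h

theorem rowm_meas {E : Set (ℝ × ℝ)} (hE : MeasurableSet E) : Measurable (rowm E) :=
  measurable_measure_prodMk_right hE

theorem row_set_meas {E : Set (ℝ × ℝ)} (hE : MeasurableSet E) (y : ℝ) :
    MeasurableSet {x : ℝ | (x, y) ∈ E} :=
  (measurable_id.prodMk measurable_const) hE

theorem Isq_meas : MeasurableSet Isq := by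
  rw [Isq_eq_prod]; exact measurableSet_Icc.prod measurableSet_Icc

theorem Isq_vol : volume Isq = 4 := by
  rw [Isq_eq_prod, Measure.volume_eq_prod, Measure.prod_prod, Real.volume_Icc]
  rw [← ENNReal.ofReal_mul (by norm_num)]; norm_num

theorem rowm_compl {E : Set (ℝ × ℝ)} (hE : MeasurableSet E) (hEs : E ⊆ Isq) {y : ℝ}
    (hy : y ∈ Icc (-1 : ℝ) 1) : rowm E y + rowm (Isq \ E) y = 2 := by
  have h : {x : ℝ | (x, y) ∈ E} ∪ {x : ℝ | (x, y) ∈ Isq \ E} = Icc (-1) 1 := by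
    ext x
    simp only [mem_union, mem_ofPred_eq, Set.mem_sdiff]
    constructor
    · intro h
      have : (x, y) ∈ Isq := by
        rcases h with h | h
        · exact hEs h
        · exact h.1
      have := mem_Isq_iff.1 this
      exact ⟨this.1.1, this.2.1⟩
    · intro h
      have : (x, y) ∈ Isq := mem_Isq_iff.2 ⟨⟨h.1, hy.1⟩, h.2, hy.2⟩
      tauto
  unfold rowm
  rw [← measure_union _ (row_set_meas (Isq_meas.diff hE) y), h, Real.volume_Icc]
  · norm_num
  · rw [disjoint_left]; intro x h1 h2; exact h2.2 h1

theorem rowm_le {E : Set (ℝ × ℝ)} (hE : MeasurableSet E) (hEs : E ⊆ Isq) {y : ℝ}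
    (hy : y ∈ Icc (-1 : ℝ) 1) : rowm E y ≤ 2 := by
  rw [← rowm_compl hE hEs hy]; exact le_self_add

theorem rowm_full {E : Set (ℝ × ℝ)} (hE : MeasurableSet E) (hEs : E ⊆ Isq) {y : ℝ}
    (hy : y ∈ Icc (-1 : ℝ) 1) (h : rowm E y = 2) : rowm (Isq \ E) y = 0 := by
  have := rowm_compl hE hEs hy
  rw [h] at this
  exact (ENNReal.add_right_inj (a := 2) (by norm_num)).1 (by rw [this, add_zero])

theorem compl_vol {E : Set (ℝ × ℝ)} (hE : MeasurableSet E) (hEs : E ⊆ Isq) (hvol : volume E = 2) :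
    volume (Isq \ E) = 2 := by
  rw [measure_diff hEs hE.nullMeasurableSet (by rw [hvol]; norm_num), hvol, Isq_vol]
  rw [show (4 : ℝ≥0∞) = 2 + 2 by norm_num]
  exact ENNReal.add_sub_cancel_right (by norm_num)

theorem swapS_compl (E : Set (ℝ × ℝ)) : swapS (Isq \ E) = Isq \ swapS E := by
  ext z
  simp only [swapS, mem_ofPred_eq, Set.mem_sdiff, mem_Isq_iff]
  tauto

/-- convergence hypothesis -/
def ConvE (v : ℕ → ℝ × ℝ → ℝ) (E : Set (ℝ × ℝ)) : Prop :=
  ∀ᵐ z : ℝ × ℝ, z ∈ Isq → Tendsto (fun n => v n z) atTop (𝓝 (E.indicator (fun _ => (1:ℝ)) z))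

theorem ConvE.swap {v : ℕ → ℝ × ℝ → ℝ} {E : Set (ℝ × ℝ)} (h : ConvE v E) :
    ConvE (fun n z => v n (z.2, z.1)) (swapS E) := by
  filter_upwards [swap_mp.quasiMeasurePreserving.ae h] with z hz hzI
  have h' := mem_Isq_iff.1 hzI
  exact hz (mem_Isq_iff.2 ⟨⟨h'.1.2, h'.1.1⟩, h'.2.2, h'.2.1⟩)

theorem ConvE.compl {v : ℕ → ℝ × ℝ → ℝ} {E : Set (ℝ × ℝ)} (h : ConvE v E) :
    ConvE (fun n z => 1 - v n z) (Isq \ E) := by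
  filter_upwards [h] with z hz hzI
  have := (hz hzI).const_sub 1
  convert this using 2
  by_cases hzE : z ∈ E <;> simp [hzE, hzI]

theorem no_empty_cross {v : ℕ → ℝ × ℝ → ℝ} (hv : ∀ n, ContDiff ℝ 1 (v n)) {E : Set (ℝ × ℝ)}
    (hE : MeasurableSet E) (hEs : E ⊆ Isq) (hvol : volume E = 2) (hconv : ConvE v E)
    (hen : liminf (fun n => ∫⁻ z in Isq, gm (v n) z) atTop ≤ 2)
    (hr : ∃ᶠ y in ae (volume : Measure ℝ), y ∈ Icc (-1 : ℝ) 1 ∧ rowm E y = 0)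
    (hc : ∃ᶠ x in ae (volume : Measure ℝ), x ∈ Icc (-1 : ℝ) 1 ∧ rowm (swapS E) x = 0) : False := by
  have fin : ∀ a : ℝ, ∀ᵐ v : ℝ, v ≠ a := fun a => by simp [ae_iff]
  obtain ⟨y, ⟨⟨hy, hy0⟩, hyc, hy1, hy2⟩⟩ := (hr.and_eventually ((ae_row hconv).and
    ((fin 1).and (fin (-1))))).exists
  obtain ⟨x, ⟨⟨hx, hx0⟩, hxc, hx1, hx2⟩⟩ := (hc.and_eventually ((ae_col hconv).and
    ((fin 1).and (fin (-1))))).exists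
  refine cross_empty (x0 := x) (y0 := y) ⟨lt_of_le_of_ne hx.1 hx2.symm, lt_of_le_of_ne hx.2 hx1⟩
    ⟨lt_of_le_of_ne hy.1 hy2.symm, lt_of_le_of_ne hy.2 hy1⟩ hv hE hEs hvol ?_ hen ?_ ?_
  · filter_upwards [hconv] with z hz hzE
    have := hz (hEs hzE)
    rwa [indicator_of_mem hzE] at this
  · filter_upwards [hyc, rowm_zero hy0] with t h1 h2 ht
    have := h1 (mem_Isq_iff.2 ⟨⟨ht.1, hy.1⟩, ht.2, hy.2⟩)
    rwa [indicator_of_notMem h2] at this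
  · filter_upwards [hxc, rowm_zero hx0] with t h1 h2 ht
    have := h1 (mem_Isq_iff.2 ⟨⟨hx.1, ht.1⟩, hx.2, ht.2⟩)
    rwa [indicator_of_notMem (show (x, t) ∉ E from h2)] at this

theorem no_mixed_cross {E : Set (ℝ × ℝ)} (hE : MeasurableSet E)
    (hr : ∃ᶠ y in ae (volume : Measure ℝ), y ∈ Icc (-1 : ℝ) 1 ∧ rowm E y = 0)
    (hc : ∃ᶠ x in ae (volume : Measure ℝ), x ∈ Icc (-1 : ℝ) 1 ∧ rowm (Isq \ swapS E) x = 0) :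
    False := by
  have h1 : ∀ᵐ y : ℝ, ∀ᵐ x : ℝ, rowm E y = 0 → (x, y) ∉ E := by
    refine Eventually.of_forall fun y => ?_
    by_cases h : rowm E y = 0
    · filter_upwards [rowm_zero h] with x hx _ using hx
    · exact Eventually.of_forall fun x h' => absurd h' h
  have hm : MeasurableSet {z : ℝ × ℝ | rowm E z.1 = 0 → (z.2, z.1) ∉ E} := by
    have m1 : MeasurableSet {z : ℝ × ℝ | rowm E z.1 = 0} :=
      ((rowm_meas hE).comp measurable_fst) (measurableSet_singleton 0)
    have m2 := swapS_meas hE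
    have : {z : ℝ × ℝ | rowm E z.1 = 0 → (z.2, z.1) ∉ E} = {z : ℝ × ℝ | rowm E z.1 = 0}ᶜ ∪ (swapS E)ᶜ := by
      ext z; simp only [mem_union, mem_compl_iff, mem_ofPred_eq, swapS]; tauto
    rw [this]; exact m1.compl.union m2.compl
  have h2 := (Measure.ae_ae_comm hm).1 h1
  obtain ⟨x, ⟨hx, hx0⟩, hxc⟩ := (hc.and_eventually h2).exists
  obtain ⟨y, ⟨hy, hy0⟩, a, b⟩ := (hr.and_eventually (hxc.and (rowm_zero hx0))).exists
  have := a hy0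
  exact b ⟨mem_Isq_iff.2 ⟨⟨hy.1, hx.1⟩, hy.2, hx.2⟩, this⟩

theorem not_mixed {E : Set (ℝ × ℝ)} (hE : MeasurableSet E) (hEs : E ⊆ Isq)
    (h : ¬ ∀ᵐ y : ℝ, y ∈ Icc (-1 : ℝ) 1 → 0 < rowm E y ∧ rowm E y < 2) :
    (∃ᶠ y in ae (volume : Measure ℝ), y ∈ Icc (-1 : ℝ) 1 ∧ rowm E y = 0) ∨
    (∃ᶠ y in ae (volume : Measure ℝ), y ∈ Icc (-1 : ℝ) 1 ∧ rowm (Isq \ E) y = 0) := by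
  rw [← frequently_or_distrib]
  have h2 : ∃ᶠ y in ae (volume : Measure ℝ), ¬ (y ∈ Icc (-1 : ℝ) 1 → 0 < rowm E y ∧ rowm E y < 2) := not_eventually.1 h
  refine h2.mono fun y hy => ?_
  push Not at hy
  obtain ⟨hy, hy2⟩ := hy
  rcases eq_or_ne (rowm E y) 0 with h0 | h0
  · left; exact ⟨hy, h0⟩
  · right
    refine ⟨hy, rowm_full hE hEs hy (le_antisymm (rowm_le hE hEs hy) (hy2 (pos_iff_ne_zero.2 h0)))⟩

theorem dichotomy {v : ℕ → ℝ × ℝ → ℝ} (hv : ∀ n, ContDiff ℝ 1 (v n)) {E : Set (ℝ × ℝ)}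
    (hE : MeasurableSet E) (hEs : E ⊆ Isq) (hvol : volume E = 2) (hconv : ConvE v E)
    (hen : liminf (fun n => ∫⁻ z in Isq, gm (v n) z) atTop ≤ 2) :
    (∀ᵐ y : ℝ, y ∈ Icc (-1 : ℝ) 1 → 0 < rowm E y ∧ rowm E y < 2) ∨
    (∀ᵐ y : ℝ, y ∈ Icc (-1 : ℝ) 1 → 0 < rowm (swapS E) y ∧ rowm (swapS E) y < 2) := by
  by_contra hcon
  rw [not_or] at hcon
  obtain ⟨h1, h2⟩ := hcon
  have hE' := Isq_meas.diff hE
  rcases not_mixed hE hEs h1 with a | a <;>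
    rcases not_mixed (swapS_meas hE) (swapS_sub hEs) h2 with b | b
  · exact no_empty_cross hv hE hEs hvol hconv hen a b
  · exact no_mixed_cross hE a b
  · refine no_mixed_cross hE' a ?_
    rw [swapS_compl, sdiff_sdiff_cancel_left (swapS_sub hEs)]
    exact b
  · rw [← swapS_compl] at b
    refine no_empty_cross (v := fun n z => 1 - v n z) (fun n => contDiff_const.sub (hv n)) hE' sdiff_subset
      (compl_vol hE hEs hvol) hconv.compl ?_ a b
    refine le_trans (le_of_eq ?_) hen
    congr 1; ext n; refine lintegral_congr fun z => ?_
    exact one_sub_gm (v n) z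

end


noncomputable section
open scoped Topology

theorem fold_split {kp km : ℝ → ℝ≥0∞} {t : ℝ} (ht : t ∈ Icc (0 : ℝ) 2)
    {K1 K2 : ℝ → ℝ≥0∞}
    (a1 : ∀ c ∈ Ioo (-1 : ℝ) (1 - t), K1 c = kp (c + t)) (a2 : ∀ c ∈ Ioo (1 - t) (1 : ℝ), K1 c = km (2 - c - t))
    (b1 : ∀ c ∈ Ioo (-1 : ℝ) (1 - t), K2 c = km (-(c + t))) (b2 : ∀ c ∈ Ioo (1 - t) (1 : ℝ), K2 c = kp (-(2 - c - t)))
    (hkp : Measurable kp) (hkm : Measurable km) :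
    (∫⁻ c in Ioo (-1 : ℝ) 1, K1 c) + (∫⁻ c in Ioo (-1 : ℝ) 1, K2 c) =
      (∫⁻ c in Ioo (-1 : ℝ) 1, kp c) + ∫⁻ c in Ioo (-1 : ℝ) 1, km c := by
  have spl : ∀ (k : ℝ → ℝ≥0∞) (m : ℝ), m ∈ Icc (-1 : ℝ) 1 → ∫⁻ c in Ioo (-1 : ℝ) 1, k c =
      (∫⁻ c in Ioo (-1) m, k c) + ∫⁻ c in Ioo m 1, k c := by
    intro k m hm
    have h1 : (Ioo (-1) 1 : Set ℝ) =ᵐ[volume] (Ioo (-1) m ∪ Ioo m 1 : Set ℝ) := by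
      have : (Ioc (-1) 1 : Set ℝ) = Ioc (-1) m ∪ Ioc m 1 := (Ioc_union_Ioc_eq_Ioc hm.1 hm.2).symm
      refine Ioo_ae_eq_Ioc.trans ?_
      rw [this]
      exact Ioo_ae_eq_Ioc.symm.union Ioo_ae_eq_Ioc.symm
    rw [setLIntegral_congr h1, lintegral_union measurableSet_Ioo]
    rw [disjoint_left]; rintro x ⟨_, _⟩ ⟨_, _⟩; linarith
  have sub : ∀ (k : ℝ → ℝ≥0∞) (hk : Measurable k) (s p a b a' b' : ℝ), (s = 1 ∨ s = -1) →
      (∀ x, p + s * x ∈ Ioo a b ↔ x ∈ Ioo a' b') →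
      ∫⁻ c in Ioo a' b', k (p + s * c) = ∫⁻ c in Ioo a b, k c := by
    intro k hk s p a b a' b' hs h
    rw [← (refl_mp1 hs p).setLIntegral_comp_preimage measurableSet_Ioo hk]
    congr 2
    ext x; exact (h x).symm
  obtain ⟨ht0, ht2⟩ := ht
  rw [spl K1 (1 - t) ⟨by linarith, by linarith⟩, spl K2 (1 - t) ⟨by linarith, by linarith⟩,
    setLIntegral_congr_fun measurableSet_Ioo a1, setLIntegral_congr_fun measurableSet_Ioo a2,
    setLIntegral_congr_fun measurableSet_Ioo b1, setLIntegral_congr_fun measurableSet_Ioo b2,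
    spl kp (t - 1) ⟨by linarith, by linarith⟩, spl km (1 - t) ⟨by linarith, by linarith⟩]
  have e1 := sub kp hkp 1 t (t - 1) 1 (-1) (1 - t) (by simp)
    (fun x => ⟨fun h => ⟨by linarith [h.1], by linarith [h.2]⟩, fun h => ⟨by linarith [h.1], by linarith [h.2]⟩⟩)
  have e2 := sub km hkm (-1) (2 - t) (1 - t) 1 (1 - t) 1 (by simp)
    (fun x => ⟨fun h => ⟨by linarith [h.2], by linarith [h.1]⟩, fun h => ⟨by linarith [h.2], by linarith [h.1]⟩⟩)
  have e3 := sub km hkm (-1) (-t) (-1) (1 - t) (-1) (1 - t) (by simp)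
    (fun x => ⟨fun h => ⟨by linarith [h.2], by linarith [h.1]⟩, fun h => ⟨by linarith [h.2], by linarith [h.1]⟩⟩)
  have e4 := sub kp hkp 1 (t - 2) (-1) (t - 1) (1 - t) 1 (by simp)
    (fun x => ⟨fun h => ⟨by linarith [h.1], by linarith [h.2]⟩, fun h => ⟨by linarith [h.1], by linarith [h.2]⟩⟩)
  rw [← e1, ← e2, ← e3, ← e4]
  have c1 : ∀ c : ℝ, kp (t + 1 * c) = kp (c + t) := fun c => by ring_nf
  have c2 : ∀ c : ℝ, km ((2 - t) + -1 * c) = km (2 - c - t) := fun c => by ring_nf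
  have c3 : ∀ c : ℝ, km (-t + -1 * c) = km (-(c + t)) := fun c => by ring_nf
  have c4 : ∀ c : ℝ, kp (t - 2 + 1 * c) = kp (-(2 - c - t)) := fun c => by ring_nf
  simp only [c1, c2, c3, c4]
  ac_rfl

/-- derivative along the folded leg -/
def legd (v : ℝ × ℝ → ℝ) (σ s X0 c t : ℝ) : ℝ :=
  σ * D1 v (X0 + σ * t, s * (1 - |1 - c - t|)) + s * sg (1 - c - t) * D2 v (X0 + σ * t, s * (1 - |1 - c - t|))

theorem legd_meas {v : ℝ × ℝ → ℝ} (hv : ContDiff ℝ 1 v) (σ s X0 : ℝ) :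
    Measurable (fun p : ℝ × ℝ => legd v σ s X0 p.1 p.2) := by
  unfold legd
  have h1 := (D1_cont hv).measurable
  have h2 := (D2_cont hv).measurable
  have h3 : Measurable (fun p : ℝ × ℝ => (X0 + σ * p.2, s * (1 - |1 - p.1 - p.2|))) := by fun_prop
  have h4 : Measurable (fun p : ℝ × ℝ => sg (1 - p.1 - p.2)) := sg_meas.comp (by fun_prop)
  exact ((h1.comp h3).const_mul σ).add ((h4.const_mul s).mul (h2.comp h3))

theorem leg_le {v : ℝ × ℝ → ℝ} (hv : ContDiff ℝ 1 v) (σ s X0 : ℝ) {c d : ℝ} (hc : c ≤ 1) (hd : 0 ≤ d) :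
    ‖v (X0 + σ * d, s * (1 - |1 - c - d|)) - v (X0, s * c)‖ₑ ≤
      ∫⁻ t in Ioc 0 d, ‖legd v σ s X0 c t‖ₑ := by
  have h0 : v (X0, s * c) = v (X0 + σ * 0, s * (1 - |1 - c - 0|)) := by
    rw [sub_zero, abs_of_nonneg (by linarith : (0:ℝ) ≤ 1 - c)]; ring_nf
  rw [h0]
  refine ftc_le (f := fun t => v (X0 + σ * t, s * (1 - |1 - c - t|))) (f' := fun t => legd v σ s X0 c t) hd
    (s := {1 - c}) (by simp) ?_ ?_ ?_
  · exact (hv.continuous.comp (by fun_prop)).continuousOn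
  · rintro t ⟨_, ht⟩
    have ht' : 1 - c - t ≠ 0 := fun h => ht (by rw [mem_singleton_iff]; linarith)
    have h1 : HasDerivAt (fun t : ℝ => X0 + σ * t) σ t := by
      simpa using ((hasDerivAt_id t).const_mul σ).const_add X0
    have h2 : HasDerivAt (fun t : ℝ => s * (1 - |1 - c - t|)) (s * sg (1 - c - t)) t := by
      have a := (sg_deriv ht').comp_const_sub (1 - c) t
      have := ((a.const_sub 1).const_mul s)
      simpa using this
    have := hasDerivAt_path hv h1 h2
    exact this
  · exact (legd_meas hv σ s X0).comp (measurable_const.prodMk measurable_id)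

theorem legd_sum {v : ℝ × ℝ → ℝ} (hv : ContDiff ℝ 1 v) {σ : ℝ} (hσ : σ = 1 ∨ σ = -1) (X0 : ℝ) {t : ℝ}
    (ht : t ∈ Icc (0 : ℝ) 2) :
    (∫⁻ c in Ioo (-1 : ℝ) 1, ‖legd v σ 1 X0 c t‖ₑ) + (∫⁻ c in Ioo (-1 : ℝ) 1, ‖legd v σ (-1) X0 c t‖ₑ) =
      2 * ∫⁻ y in Ioo (-1 : ℝ) 1, gm v (X0 + σ * t, y) := by
  have m1 : Measurable fun y : ℝ => D1 v (X0 + σ * t, y) := (D1_cont hv).measurable.comp (by fun_prop)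
  have m2 : Measurable fun y : ℝ => D2 v (X0 + σ * t, y) := (D2_cont hv).measurable.comp (by fun_prop)
  have m3 : Measurable fun y : ℝ => gm v (X0 + σ * t, y) := (gm_cont hv).measurable.comp (by fun_prop)
  rw [fold_split (kp := fun y => ‖σ * D1 v (X0 + σ * t, y) + D2 v (X0 + σ * t, y)‖ₑ)
    (km := fun y => ‖σ * D1 v (X0 + σ * t, y) - D2 v (X0 + σ * t, y)‖ₑ) ht]
  · rw [← lintegral_add_left (by fun_prop),
      ← lintegral_const_mul _ m3]
    refine lintegral_congr fun y => ?_
    rw [enorm_add_sub, gm, sgn_sq_enorm hσ]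
  · rintro c ⟨h1, h2⟩
    have h : 0 < 1 - c - t := by linarith
    have e : (1 : ℝ) * (1 - (1 - c - t)) = c + t := by ring
    simp only [legd, sg, abs_of_pos h, h, if_true, e, one_mul]
  · rintro c ⟨h1, h2⟩
    have h : 1 - c - t < 0 := by linarith
    have e : (1 : ℝ) * (1 - -(1 - c - t)) = 2 - c - t := by ring
    simp only [legd, sg, abs_of_neg h, h.not_gt, if_false, e, one_mul, neg_mul, ← sub_eq_add_neg]
  · rintro c ⟨h1, h2⟩
    have h : 0 < 1 - c - t := by linarith
    have e : (-1 : ℝ) * (1 - (1 - c - t)) = -(c + t) := by ring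
    simp only [legd, sg, abs_of_pos h, h, if_true, e, one_mul, mul_one, neg_mul, ← sub_eq_add_neg]
  · rintro c ⟨h1, h2⟩
    have h : 1 - c - t < 0 := by linarith
    have e : (-1 : ℝ) * (1 - -(1 - c - t)) = -(2 - c - t) := by ring
    simp only [legd, sg, abs_of_neg h, h.not_gt, if_false, e, one_mul, mul_neg, neg_neg, mul_one, neg_mul]
  · fun_prop
  · fun_prop

theorem leg_total {v : ℝ × ℝ → ℝ} (hv : ContDiff ℝ 1 v) {σ : ℝ} (hσ : σ = 1 ∨ σ = -1) (X0 : ℝ) {d : ℝ}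
    (hd : 0 ≤ d) (hd2 : d ≤ 2) :
    (∫⁻ c in Ioo (-1 : ℝ) 1, ‖v (X0 + σ * d, 1 * (1 - |1 - c - d|)) - v (X0, 1 * c)‖ₑ) +
    (∫⁻ c in Ioo (-1 : ℝ) 1, ‖v (X0 + σ * d, -1 * (1 - |1 - c - d|)) - v (X0, -1 * c)‖ₑ) ≤
      2 * ∫⁻ t in Ioc 0 d, ∫⁻ y in Ioo (-1 : ℝ) 1, gm v (X0 + σ * t, y) := by
  have key : ∀ s : ℝ, (∫⁻ c in Ioo (-1 : ℝ) 1, ‖v (X0 + σ * d, s * (1 - |1 - c - d|)) - v (X0, s * c)‖ₑ) ≤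
      ∫⁻ t in Ioc 0 d, ∫⁻ c in Ioo (-1 : ℝ) 1, ‖legd v σ s X0 c t‖ₑ := by
    intro s
    rw [lintegral_lintegral_swap]
    · refine setLIntegral_mono' measurableSet_Ioo fun c hc => leg_le hv σ s X0 hc.2.le hd
    · have := (legd_meas hv σ s X0).comp measurable_swap
      exact this.enorm.aemeasurable
  refine (add_le_add (key 1) (key (-1))).trans (le_of_eq ?_)
  rw [← lintegral_add_left, ← lintegral_const_mul]
  · refine setLIntegral_congr_fun measurableSet_Ioc fun t ht => ?_
    exact legd_sum hv hσ X0 ⟨ht.1.le, ht.2.trans hd2⟩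
  · have : Measurable (fun p : ℝ × ℝ => gm v (X0 + σ * p.1, p.2)) := (gm_cont hv).measurable.comp (by fun_prop)
    exact this.lintegral_prod_right'
  · have := ((legd_meas hv σ 1 X0).comp measurable_swap).enorm
    exact this.lintegral_prod_right'

end


noncomputable section
open scoped Topology

/-- row variation -/
def Nrow (v : ℝ × ℝ → ℝ) (a b y : ℝ) : ℝ≥0∞ := ∫⁻ x in Ioc a b, ‖D1 v (x, y)‖ₑ

theorem Nrow_meas {v : ℝ × ℝ → ℝ} (hv : ContDiff ℝ 1 v) (a b : ℝ) : Measurable (Nrow v a b) := by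
  have : Measurable (fun p : ℝ × ℝ => ‖D1 v (p.2, p.1)‖ₑ) :=
    ((D1_cont hv).measurable.comp measurable_swap).enorm
  exact this.lintegral_prod_right'

/-- column integrals of `gm` -/
def gcol (v : ℝ × ℝ → ℝ) (X : ℝ) : ℝ≥0∞ := ∫⁻ y in Ioo (-1 : ℝ) 1, gm v (X, y)

theorem gcol_meas {v : ℝ × ℝ → ℝ} (hv : ContDiff ℝ 1 v) : Measurable (gcol v) := by
  have : Measurable (fun p : ℝ × ℝ => gm v p) := (gm_cont hv).measurable
  exact this.lintegral_prod_right'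

theorem gcol_total {v : ℝ × ℝ → ℝ} (hv : ContDiff ℝ 1 v) :
    ∫⁻ X in Ioc (-1 : ℝ) 1, gcol v X = ∫⁻ z in Isq, gm v z := by
  rw [Isq_eq_prod, Measure.volume_eq_prod, ← Measure.prod_restrict,
    lintegral_prod _ (gm_cont hv).measurable.aemeasurable, setLIntegral_congr Ioc_ae_eq_Icc]
  refine lintegral_congr fun x => ?_
  rw [gcol, setLIntegral_congr Ioo_ae_eq_Icc]

theorem Nrow_total {v : ℝ × ℝ → ℝ} (hv : ContDiff ℝ 1 v) {s : ℝ} (hs : s = 1 ∨ s = -1) (a b : ℝ) :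
    ∫⁻ c in Ioo (-1 : ℝ) 1, Nrow v a b (s * c) ≤ ∫⁻ X in Ioc a b, gcol v X := by
  have h1 : ∫⁻ c in Ioo (-1 : ℝ) 1, Nrow v a b (s * c) = ∫⁻ c in Ioo (-1 : ℝ) 1, Nrow v a b c := by
    have := (refl_mp1 hs 0).setLIntegral_comp_preimage (s := Ioo (-1 : ℝ) 1) measurableSet_Ioo (Nrow_meas hv a b)
    rw [← this]
    simp only [zero_add]
    congr 2
    ext x
    rcases hs with rfl | rfl <;> simp only [mem_preimage, mem_Ioo] <;> constructor <;> rintro ⟨_, _⟩ <;>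
      constructor <;> linarith
  rw [h1]
  unfold Nrow gcol
  rw [lintegral_lintegral_swap]
  · refine lintegral_mono fun X => lintegral_mono fun y => ?_
    exact le_max_left _ _
  · have : Measurable (fun p : ℝ × ℝ => ‖D1 v (p.2, p.1)‖ₑ) :=
      ((D1_cont hv).measurable.comp measurable_swap).enorm
    exact this.aemeasurable

/-- five point path -/
def T5 (v : ℝ × ℝ → ℝ) (x d s c : ℝ) : ℝ≥0∞ :=
  (Nrow v (-1) (x - d) (s * c) + Nrow v (x + d) 1 (s * c)) +
  (‖v (x, s * (1 - |1 - c - d|)) - v (x - d, s * c)‖ₑ +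
  ‖v (x, s * (1 - |1 - c - d|)) - v (x + d, s * c)‖ₑ)

theorem T5_meas {v : ℝ × ℝ → ℝ} (hv : ContDiff ℝ 1 v) (x d s : ℝ) : Measurable (T5 v x d s) := by
  have h := hv.continuous
  have e1 : Measurable (fun c : ℝ => v (x, s * (1 - |1 - c - d|))) := (h.comp (by fun_prop)).measurable
  have e2 : Measurable (fun c : ℝ => v (x - d, s * c)) := (h.comp (by fun_prop)).measurable
  have e3 : Measurable (fun c : ℝ => v (x + d, s * c)) := (h.comp (by fun_prop)).measurable
  have f1 : Measurable (fun c : ℝ => Nrow v (-1) (x - d) (s * c)) := (Nrow_meas hv _ _).comp (by fun_prop)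
  have f2 : Measurable (fun c : ℝ => Nrow v (x + d) 1 (s * c)) := (Nrow_meas hv _ _).comp (by fun_prop)
  exact (f1.add f2).add ((e1.sub e2).enorm.add (e1.sub e3).enorm)

theorem five_total {v : ℝ × ℝ → ℝ} (hv : ContDiff ℝ 1 v) {x d : ℝ} (hd : 0 ≤ d) (h1 : -1 ≤ x - d)
    (h2 : x + d ≤ 1) :
    (∫⁻ c in Ioo (-1 : ℝ) 1, T5 v x d 1 c) + (∫⁻ c in Ioo (-1 : ℝ) 1, T5 v x d (-1) c) ≤
      2 * ∫⁻ z in Isq, gm v z := by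
  have h := hv.continuous
  have s1 : ∀ s : ℝ, ∫⁻ c in Ioo (-1 : ℝ) 1, T5 v x d s c =
      ((∫⁻ c in Ioo (-1 : ℝ) 1, Nrow v (-1) (x - d) (s * c)) + ∫⁻ c in Ioo (-1 : ℝ) 1, Nrow v (x + d) 1 (s * c)) +
      ((∫⁻ c in Ioo (-1 : ℝ) 1, ‖v (x, s * (1 - |1 - c - d|)) - v (x - d, s * c)‖ₑ) +
        ∫⁻ c in Ioo (-1 : ℝ) 1, ‖v (x, s * (1 - |1 - c - d|)) - v (x + d, s * c)‖ₑ) := by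
    intro s
    have e1 : Measurable (fun c : ℝ => v (x, s * (1 - |1 - c - d|))) := (h.comp (by fun_prop)).measurable
    have e2 : Measurable (fun c : ℝ => v (x - d, s * c)) := (h.comp (by fun_prop)).measurable
    have f1 : Measurable (fun c : ℝ => Nrow v (-1) (x - d) (s * c)) := (Nrow_meas hv _ _).comp (by fun_prop)
    have f2 : Measurable (fun c : ℝ => Nrow v (x + d) 1 (s * c)) := (Nrow_meas hv _ _).comp (by fun_prop)
    unfold T5
    have f3 : Measurable (fun c : ℝ => Nrow v (-1) (x - d) (s * c) + Nrow v (x + d) 1 (s * c)) := f1.add f2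
    have e3 : Measurable (fun c : ℝ => ‖v (x, s * (1 - |1 - c - d|)) - v (x - d, s * c)‖ₑ) := (e1.sub e2).enorm
    rw [lintegral_add_left f3, lintegral_add_left f1, lintegral_add_left e3]
  have l1 := leg_total hv (σ := 1) (by simp) (x - d) hd (by linarith)
  have l2 := leg_total hv (σ := -1) (by simp) (x + d) hd (by linarith)
  have q1 : ∫⁻ t in Ioc 0 d, ∫⁻ y in Ioo (-1 : ℝ) 1, gm v (x - d + 1 * t, y) = ∫⁻ X in Ioc (x - d) x, gcol v X := by
    rw [← (refl_mp1 (s := 1) (by simp) (x - d)).setLIntegral_comp_preimage measurableSet_Ioc (gcol_meas hv)]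
    have : (fun t : ℝ => x - d + 1 * t) ⁻¹' Ioc (x - d) x = Ioc 0 d := by
      ext t; simp only [mem_preimage, mem_Ioc]; constructor <;> rintro ⟨_, _⟩ <;> constructor <;> linarith
    rw [this]; rfl
  have q2 : ∫⁻ t in Ioc 0 d, ∫⁻ y in Ioo (-1 : ℝ) 1, gm v (x + d + -1 * t, y) = ∫⁻ X in Ioc x (x + d), gcol v X := by
    rw [setLIntegral_congr (Ico_ae_eq_Ioc (a := x) (b := x + d)).symm,
      ← (refl_mp1 (s := -1) (by simp) (x + d)).setLIntegral_comp_preimage measurableSet_Ico (gcol_meas hv)]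
    have : (fun t : ℝ => x + d + -1 * t) ⁻¹' Ico x (x + d) = Ioc 0 d := by
      ext t; simp only [mem_preimage, mem_Ioc, mem_Ico]; constructor <;> rintro ⟨_, _⟩ <;> constructor <;> linarith
    rw [this]; rfl
  rw [q1] at l1
  rw [q2] at l2
  rw [show x - d + 1 * d = x by ring] at l1
  rw [show x + d + -1 * d = x by ring] at l2
  have spl : ∀ a b c : ℝ, a ≤ b → b ≤ c → ∫⁻ X in Ioc a c, gcol v X =
      (∫⁻ X in Ioc a b, gcol v X) + ∫⁻ X in Ioc b c, gcol v X := by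
    intro a b c hab hbc
    rw [← Ioc_union_Ioc_eq_Ioc hab hbc, lintegral_union measurableSet_Ioc]
    rw [disjoint_left]; rintro x ⟨_, _⟩ ⟨_, _⟩; linarith
  have n1 := Nrow_total hv (s := 1) (by simp) (-1) (x - d)
  have n2 := Nrow_total hv (s := -1) (by simp) (-1) (x - d)
  have n3 := Nrow_total hv (s := 1) (by simp) (x + d) 1
  have n4 := Nrow_total hv (s := -1) (by simp) (x + d) 1
  rw [← gcol_total hv, spl (-1) (x - d) 1 h1 (by linarith), spl (x - d) x 1 (by linarith) (by linarith),
    spl x (x + d) 1 (by linarith) h2, s1, s1]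
  have := add_le_add (add_le_add (add_le_add n1 n2) (add_le_add n3 n4)) (add_le_add l1 l2)
  refine le_trans (le_of_eq ?_) (this.trans (le_of_eq ?_))
  · ac_rfl
  · ring

end


noncomputable section
open scoped Topology

/-- hypotheses for the mixed row case -/
structure Setup (v : ℕ → ℝ × ℝ → ℝ) (E : Set (ℝ × ℝ)) : Prop where
  hv : ∀ n, ContDiff ℝ 1 (v n)
  hE : MeasurableSet E
  hEs : E ⊆ Isq
  hvol : volume E = 2
  hconv : ConvE v E
  hen : liminf (fun n => ∫⁻ z in Isq, gm (v n) z) atTop ≤ 2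
  hmix : ∀ᵐ y : ℝ, y ∈ Icc (-1 : ℝ) 1 → 0 < rowm E y ∧ rowm E y < 2

/-- generic point -/
def Gen (v : ℕ → ℝ × ℝ → ℝ) (E : Set (ℝ × ℝ)) (z : ℝ × ℝ) : Prop :=
  Tendsto (fun n => v n z) atTop (𝓝 (E.indicator (fun _ => (1:ℝ)) z))

theorem gen_dist {v : ℕ → ℝ × ℝ → ℝ} {E : Set (ℝ × ℝ)} {z w : ℝ × ℝ} (hz : Gen v E z) (hw : Gen v E w)
    (h : ¬ (z ∈ E ↔ w ∈ E)) : Tendsto (fun n => ‖v n w - v n z‖ₑ) atTop (𝓝 1) := by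
  have := (hw.sub hz).enorm
  convert this using 2
  by_cases h1 : z ∈ E <;> by_cases h2 : w ∈ E <;> simp [h1, h2] at h ⊢

theorem nrow_lower {v : ℕ → ℝ × ℝ → ℝ} (hv : ∀ n, ContDiff ℝ 1 (v n)) {E : Set (ℝ × ℝ)} {a b p q y : ℝ}
    (hp : Gen v E (p, y)) (hq : Gen v E (q, y)) (hpq : p ≤ q) (ha : a ≤ p) (hb : q ≤ b)
    (h : ¬ ((p, y) ∈ E ↔ (q, y) ∈ E)) : 1 ≤ liminf (fun n => Nrow (v n) a b y) atTop := by
  rw [← (gen_dist hp hq h).liminf_eq]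
  refine liminf_le_liminf (Eventually.of_forall fun n => ?_)
  exact (horiz_le (hv n) hpq y).trans (lintegral_mono_set (Ioc_subset_Ioc ha hb))

theorem ae_le_one {f : ℝ → ℝ≥0∞} (hf : Measurable f) {k : ℝ≥0∞} (hk : k ≠ ⊤)
    (h1 : ∀ᵐ y : ℝ, y ∈ Ioo (-1 : ℝ) 1 → k ≤ f y)
    (h2 : ∫⁻ y in Ioo (-1 : ℝ) 1, f y ≤ k * 2) : ∀ᵐ y : ℝ, y ∈ Ioo (-1 : ℝ) 1 → f y ≤ k := by
  have hc : ∫⁻ _ in Ioo (-1 : ℝ) 1, k = k * 2 := by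
    rw [setLIntegral_const, Real.volume_Ioo]; norm_num
  have := ae_eq_of_ae_le_of_lintegral_le (μ := volume.restrict (Ioo (-1 : ℝ) 1)) (f := fun _ => k) (g := f)
    ((ae_restrict_iff' measurableSet_Ioo).2 h1) (by rw [hc]; exact ENNReal.mul_ne_top hk (by norm_num))
    hf.aemeasurable (by rw [hc]; exact h2)
  have := (ae_restrict_iff' measurableSet_Ioo).1 this
  filter_upwards [this] with y hy h
  exact (hy h).ge

theorem mixed_gen {E : Set (ℝ × ℝ)} (hE : MeasurableSet E) (hEs : E ⊆ Isq) {y : ℝ} (hy : y ∈ Icc (-1 : ℝ) 1)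
    (h0 : 0 < rowm E y) (h2 : rowm E y < 2) {P : ℝ → Prop} (hP : ∀ᵐ p : ℝ, p ∈ Ioo (-1 : ℝ) 1 → P p) :
    (∃ p ∈ Ioo (-1 : ℝ) 1, P p ∧ (p, y) ∈ E) ∧ (∃ p ∈ Ioo (-1 : ℝ) 1, P p ∧ (p, y) ∉ E) := by
  have fin : ∀ a : ℝ, ∀ᵐ v : ℝ, v ≠ a := fun a => by simp [ae_iff]
  have aux : ∀ F : Set (ℝ × ℝ), F ⊆ Isq → 0 < rowm F y → ∃ p ∈ Ioo (-1 : ℝ) 1, P p ∧ (p, y) ∈ F := by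
    intro F hF h
    have hf : ∃ᶠ p in ae (volume : Measure ℝ), (p, y) ∈ F := by
      intro hcon
      apply h.ne'
      unfold rowm
      rw [ae_iff] at hcon
      simpa using hcon
    obtain ⟨p, hpF, hp, h1, h2⟩ := (hf.and_eventually (hP.and ((fin 1).and (fin (-1))))).exists
    have := mem_Isq_iff.1 (hF hpF)
    have hp' : p ∈ Ioo (-1 : ℝ) 1 := ⟨lt_of_le_of_ne this.1.1 h2.symm, lt_of_le_of_ne this.2.1 h1⟩
    exact ⟨p, hp', hp hp', hpF⟩
  refine ⟨aux E hEs h0, ?_⟩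
  obtain ⟨p, h1, h2, h3⟩ := aux (Isq \ E) sdiff_subset (by
    rw [pos_iff_ne_zero]
    intro h
    have := rowm_compl hE hEs hy
    rw [h, add_zero] at this
    exact h2.ne this)
  exact ⟨p, h1, h2, h3.2⟩

/-- good row -/
structure GoodRow (v : ℕ → ℝ × ℝ → ℝ) (E : Set (ℝ × ℝ)) (y : ℝ) : Prop where
  mem : y ∈ Ioo (-1 : ℝ) 1
  gen : ∀ᵐ p : ℝ, p ∈ Ioo (-1 : ℝ) 1 → Gen v E (p, y)
  pos : 0 < rowm E y
  lt2 : rowm E y < 2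
  nr : ∀ p q r : ℝ, p ∈ Ioo (-1 : ℝ) 1 → r ∈ Ioo (-1 : ℝ) 1 → p < q → q < r → Gen v E (p, y) → Gen v E (q, y) →
    Gen v E (r, y) → ((p, y) ∈ E ↔ (r, y) ∈ E) → ((q, y) ∈ E ↔ (p, y) ∈ E)

theorem Setup.genrow {v : ℕ → ℝ × ℝ → ℝ} {E : Set (ℝ × ℝ)} (S : Setup v E) :
    ∀ᵐ y : ℝ, y ∈ Ioo (-1 : ℝ) 1 → ∀ᵐ p : ℝ, p ∈ Ioo (-1 : ℝ) 1 → Gen v E (p, y) := by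
  filter_upwards [ae_row S.hconv] with y h hy
  filter_upwards [h] with p h hp
  exact h (mem_Isq_iff.2 ⟨⟨hp.1.le, hy.1.le⟩, hp.2.le, hy.2.le⟩)

theorem Setup.gencol {v : ℕ → ℝ × ℝ → ℝ} {E : Set (ℝ × ℝ)} (S : Setup v E) :
    ∀ᵐ x : ℝ, x ∈ Ioo (-1 : ℝ) 1 → ∀ᵐ y : ℝ, y ∈ Ioo (-1 : ℝ) 1 → Gen v E (x, y) := by
  filter_upwards [ae_col S.hconv] with y h hy
  filter_upwards [h] with p h hp
  exact h (mem_Isq_iff.2 ⟨⟨hy.1.le, hp.1.le⟩, hy.2.le, hp.2.le⟩)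

theorem Setup.good {v : ℕ → ℝ × ℝ → ℝ} {E : Set (ℝ × ℝ)} (S : Setup v E) :
    ∀ᵐ y : ℝ, y ∈ Ioo (-1 : ℝ) 1 → GoodRow v E y := by
  have hm : ∀ n, Measurable (Nrow (v n) (-1) 1) := fun n => Nrow_meas (S.hv n) _ _
  have key : ∀ᵐ y : ℝ, y ∈ Ioo (-1 : ℝ) 1 → liminf (fun n => Nrow (v n) (-1) 1 y) atTop ≤ 1 := by
    refine ae_le_one (.liminf hm) one_ne_top ?_ ?_
    · filter_upwards [S.genrow, S.hmix] with y h1 h2 hy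
      have hy' := Ioo_subset_Icc_self hy
      obtain ⟨⟨p, hp, hpg, hpE⟩, q, hq, hqg, hqE⟩ :=
        mixed_gen S.hE S.hEs hy' (h2 hy').1 (h2 hy').2 (h1 hy)
      rcases le_total p q with h | h
      · exact nrow_lower S.hv hpg hqg h hp.1.le hq.2.le (by tauto)
      · exact nrow_lower S.hv hqg hpg h hq.1.le hp.2.le (by tauto)
    · refine (lintegral_liminf_le hm).trans ?_
      rw [one_mul]
      refine le_trans (liminf_le_liminf (Eventually.of_forall fun n => ?_)) S.hen
      have := Nrow_total (S.hv n) (s := 1) (by simp) (-1) 1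
      rw [gcol_total (S.hv n)] at this
      simpa using this
  filter_upwards [key, S.genrow, S.hmix] with y h1 h2 h3 hy
  have hy' := Ioo_subset_Icc_self hy
  refine ⟨hy, h2 hy, (h3 hy').1, (h3 hy').2, ?_⟩
  intro p q r hp hr hpq hqr gp gq gr hpr
  by_contra hcon
  have a1 := nrow_lower S.hv gp gq hpq.le hp.1.le le_rfl (by tauto)
  have a2 := nrow_lower S.hv gq gr hqr.le le_rfl hr.2.le (by tauto)
  have a3 := (add_le_add a1 a2).trans (le_liminf_add' _ _)
  have : liminf (fun n => Nrow (v n) (-1) q y + Nrow (v n) q 1 y) atTop ≤ 1 := by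
    refine le_trans (le_of_eq ?_) (h1 hy)
    congr 1; ext n
    unfold Nrow
    have hu : Ioc (-1:ℝ) 1 = Ioc (-1) q ∪ Ioc q 1 :=
      (Ioc_union_Ioc_eq_Ioc (by linarith [hp.1]) (by linarith [hr.2])).symm
    rw [hu, lintegral_union measurableSet_Ioc]
    rw [disjoint_left]; rintro x ⟨_, _⟩ ⟨_, _⟩; linarith
  have := a3.trans this
  norm_num at this

/-- lower bound for the five point path -/
theorem five_rows {v : ℕ → ℝ × ℝ → ℝ} {E : Set (ℝ × ℝ)} (S : Setup v E) {y : ℝ} (g : GoodRow v E y) {x d : ℝ}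
    (hd : 0 < d) (h1 : -1 < x - d) (h2 : x + d < 1) (g1 : Gen v E (x - d, y)) (g2 : Gen v E (x + d, y))
    (h : (x - d, y) ∈ E ↔ (x + d, y) ∈ E) :
    1 ≤ liminf (fun n => Nrow (v n) (-1) (x - d) y + Nrow (v n) (x + d) 1 y) atTop := by
  have hy' := Ioo_subset_Icc_self g.mem
  obtain ⟨A, B⟩ := mixed_gen S.hE S.hEs hy' g.pos g.lt2 g.gen
  have : ∃ p ∈ Ioo (-1 : ℝ) 1, Gen v E (p, y) ∧ ¬ ((p, y) ∈ E ↔ (x - d, y) ∈ E) := by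
    by_cases hx : (x - d, y) ∈ E
    · obtain ⟨p, a, b, c⟩ := B; exact ⟨p, a, b, by tauto⟩
    · obtain ⟨p, a, b, c⟩ := A; exact ⟨p, a, b, by tauto⟩
  obtain ⟨p, hp, gp, hpE⟩ := this
  rcases le_or_gt p (x - d) with hlt | hlt
  · refine (nrow_lower S.hv gp g1 hlt hp.1.le le_rfl hpE).trans ?_
    exact liminf_le_liminf (Eventually.of_forall fun n => le_self_add)
  · rcases le_or_gt (x + d) p with hlt2 | hlt2
    · refine (nrow_lower S.hv g2 gp hlt2 le_rfl hp.2.le (by tauto)).trans ?_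
      exact liminf_le_liminf (Eventually.of_forall fun n => le_add_self)
    · exact absurd (g.nr (x - d) p (x + d) ⟨h1, by linarith⟩ ⟨by linarith, h2⟩ hlt hlt2 g1 gp g2 h) hpE

theorem five_lower {v : ℕ → ℝ × ℝ → ℝ} {E : Set (ℝ × ℝ)} (S : Setup v E) {c s : ℝ} (g : GoodRow v E (s * c)) {x d : ℝ}
    (hd : 0 < d) (h1 : -1 < x - d) (h2 : x + d < 1) (g1 : Gen v E (x - d, s * c)) (g2 : Gen v E (x + d, s * c)) :
    1 ≤ liminf (fun n => T5 (v n) x d s c) atTop := by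
  by_cases h : (x - d, s * c) ∈ E ↔ (x + d, s * c) ∈ E
  · refine (five_rows S g hd h1 h2 g1 g2 h).trans ?_
    exact liminf_le_liminf (Eventually.of_forall fun n => le_self_add)
  · rw [← (gen_dist g1 g2 h).liminf_eq]
    refine liminf_le_liminf (Eventually.of_forall fun n => ?_)
    refine le_trans ?_ le_add_self
    rw [← edist_eq_enorm_sub, ← edist_eq_enorm_sub, ← edist_eq_enorm_sub]
    refine (edist_triangle_left _ _ (v n (x, s * (1 - |1 - c - d|)))).trans (le_of_eq ?_)
    exact add_comm _ _

theorem five_equal {v : ℕ → ℝ × ℝ → ℝ} {E : Set (ℝ × ℝ)} (S : Setup v E) {c s : ℝ} (g : GoodRow v E (s * c)) {x d : ℝ}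
    (hd : 0 < d) (h1 : -1 < x - d) (h2 : x + d < 1) (g1 : Gen v E (x - d, s * c)) (g2 : Gen v E (x + d, s * c))
    (hc : c + d < 1) (g3 : Gen v E (x, s * (c + d)))
    (hT : liminf (fun n => T5 (v n) x d s c) atTop ≤ 1) (h : (x - d, s * c) ∈ E ↔ (x + d, s * c) ∈ E) :
    (x, s * (c + d)) ∈ E ↔ (x - d, s * c) ∈ E := by
  by_contra hcon
  have a1 := five_rows S g hd h1 h2 g1 g2 h
  have hfold : s * (1 - |1 - c - d|) = s * (c + d) := by
    rw [abs_of_pos (by linarith)]; ring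
  have a2 := gen_dist g1 g3 (by tauto)
  rw [← hfold] at a2
  have a3 := a2.liminf_eq
  have a4 : 1 ≤ liminf (fun n => ‖v n (x, s * (1 - |1 - c - d|)) - v n (x - d, s * c)‖ₑ +
      ‖v n (x, s * (1 - |1 - c - d|)) - v n (x + d, s * c)‖ₑ) atTop := by
    rw [← a3]
    exact liminf_le_liminf (Eventually.of_forall fun n => le_self_add)
  have := ((add_le_add a1 a4).trans (le_liminf_add' _ _)).trans hT
  norm_num at this

theorem coupling {v : ℕ → ℝ × ℝ → ℝ} {E : Set (ℝ × ℝ)} (S : Setup v E) {x d : ℝ}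
    (hd : 0 < d) (h1 : -1 < x - d) (h2 : x + d < 1)
    (g1 : ∀ᵐ y : ℝ, y ∈ Ioo (-1 : ℝ) 1 → Gen v E (x - d, y))
    (g2 : ∀ᵐ y : ℝ, y ∈ Ioo (-1 : ℝ) 1 → Gen v E (x + d, y))
    (g3 : ∀ᵐ y : ℝ, y ∈ Ioo (-1 : ℝ) 1 → Gen v E (x, y)) {s : ℝ} (hs : s = 1 ∨ s = -1) :
    ∀ᵐ y : ℝ, y ∈ Ioo (-1 : ℝ) 1 → y + s * d ∈ Ioo (-1 : ℝ) 1 → ((x - d, y) ∈ E ↔ (x + d, y) ∈ E) →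
      ((x, y + s * d) ∈ E ↔ (x - d, y) ∈ E) := by
  have good := S.good
  have pull : ∀ (P : ℝ → Prop), (∀ᵐ y : ℝ, y ∈ Ioo (-1 : ℝ) 1 → P y) → ∀ s : ℝ, (s = 1 ∨ s = -1) →
      ∀ᵐ c : ℝ, c ∈ Ioo (-1 : ℝ) 1 → P (s * c) := by
    intro P hP s hs
    filter_upwards [(refl_mp1 hs 0).quasiMeasurePreserving.ae hP] with c hc h
    rw [zero_add] at hc
    apply hc
    rcases hs with rfl | rfl <;> constructor <;> linarith [h.1, h.2]
  have low : ∀ s : ℝ, (s = 1 ∨ s = -1) → ∀ᵐ c : ℝ, c ∈ Ioo (-1 : ℝ) 1 → 1 ≤ liminf (fun n => T5 (v n) x d s c) atTop := by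
    intro s hs
    filter_upwards [pull _ good s hs, pull _ g1 s hs, pull _ g2 s hs] with c a b e hc
    exact five_lower S (a hc) hd h1 h2 (b hc) (e hc)
  have l1 := low 1 (by simp)
  have l2 := low (-1) (by simp)
  have hm : ∀ s, Measurable (fun c => liminf (fun n => T5 (v n) x d s c) atTop) := fun s =>
    .liminf fun n => T5_meas (S.hv n) x d s
  have key : ∀ᵐ c : ℝ, c ∈ Ioo (-1 : ℝ) 1 → liminf (fun n => T5 (v n) x d 1 c) atTop +
      liminf (fun n => T5 (v n) x d (-1) c) atTop ≤ 2 := by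
    refine ae_le_one ((hm 1).add (hm (-1))) (by norm_num) ?_ ?_
    · filter_upwards [l1, l2] with c a b hc
      have := add_le_add (a hc) (b hc)
      rwa [one_add_one_eq_two] at this
    · have : ∫⁻ c in Ioo (-1 : ℝ) 1, (liminf (fun n => T5 (v n) x d 1 c) atTop +
        liminf (fun n => T5 (v n) x d (-1) c) atTop) ≤
          ∫⁻ c in Ioo (-1 : ℝ) 1, liminf (fun n => T5 (v n) x d 1 c + T5 (v n) x d (-1) c) atTop :=
        lintegral_mono fun c => le_liminf_add' _ _
      refine this.trans ((lintegral_liminf_le fun n => ((T5_meas (S.hv n) x d 1).add (T5_meas (S.hv n) x d (-1)))).trans ?_)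
      calc _ ≤ liminf (fun n => 2 * ∫⁻ z in Isq, gm (v n) z) atTop := by
            refine liminf_le_liminf (Eventually.of_forall fun n => ?_)
            have := five_total (S.hv n) hd.le h1.le h2.le
            rwa [← lintegral_add_left (T5_meas (S.hv n) x d 1)] at this
        _ = 2 * liminf (fun n => ∫⁻ z in Isq, gm (v n) z) atTop :=
            ENNReal.liminf_const_mul_of_ne_top (by norm_num)
        _ ≤ 2 * 2 := by gcongr; exact S.hen
  have fin : ∀ᵐ c : ℝ, c ∈ Ioo (-1 : ℝ) 1 → liminf (fun n => T5 (v n) x d s c) atTop ≤ 1 := by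
    filter_upwards [key, l1, l2] with c a b e hc
    have a := a hc
    have b := b hc
    have e := e hc
    rcases hs with rfl | rfl
    · by_contra hcon
      push Not at hcon
      have := ENNReal.add_lt_add_of_lt_of_le (by norm_num) hcon e
      rw [one_add_one_eq_two] at this
      exact absurd a this.not_ge
    · by_contra hcon
      push Not at hcon
      have := ENNReal.add_lt_add_of_le_of_lt (by norm_num) b hcon
      rw [one_add_one_eq_two] at this
      exact absurd a this.not_ge
  have res : ∀ᵐ c : ℝ, c ∈ Ioo (-1 : ℝ) 1 → c + d < 1 → ((x - d, s * c) ∈ E ↔ (x + d, s * c) ∈ E) →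
      ((x, s * (c + d)) ∈ E ↔ (x - d, s * c) ∈ E) := by
    filter_upwards [pull _ good s hs, pull _ g1 s hs, pull _ g2 s hs, fin,
      (refl_mp1 hs (s * d)).quasiMeasurePreserving.ae g3] with c a b e f g hc hcd h
    refine five_equal S (a hc) hd h1 h2 (b hc) (e hc) hcd ?_ (f hc) h
    rw [show s * d + s * c = s * (c + d) by ring] at g
    apply g
    rcases hs with rfl | rfl <;> constructor <;> linarith [hc.1, hc.2]
  have hss := sgn_sq hs
  filter_upwards [(refl_mp1 hs 0).quasiMeasurePreserving.ae res] with y h hy hyd hyE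
  rw [zero_add] at h
  have e1 : s * (s * y) = y := by rw [← mul_assoc, hss, one_mul]
  have e2 : s * (s * y + d) = y + s * d := by rw [mul_add, e1]
  rw [e1, e2] at h
  refine h ?_ ?_ hyE
  · rcases hs with rfl | rfl <;> constructor <;> linarith [hy.1, hy.2]
  · rcases hs with rfl | rfl <;> linarith [hyd.1, hyd.2]

end


noncomputable section
open scoped Topology

/-- the normalised height of a row -/
def thet (E : Set (ℝ × ℝ)) (y : ℝ) : ℝ := (rowm E y).toReal - 1

/-- row type -/
def RT (E : Set (ℝ × ℝ)) (t : ℝ) (y : ℝ) : Prop :=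
  ∀ᵐ p : ℝ, p ∈ Ioo (-1 : ℝ) 1 → ((p, y) ∈ E ↔ t * p ≤ thet E y)

theorem thet_meas {E : Set (ℝ × ℝ)} (hE : MeasurableSet E) : Measurable (thet E) :=
  (rowm_meas hE).ennreal_toReal.sub_const 1

theorem RT_meas {E : Set (ℝ × ℝ)} (hE : MeasurableSet E) (t : ℝ) : MeasurableSet {y | RT E t y} := by
  have hm := thet_meas hE
  have h : MeasurableSet {z : ℝ × ℝ | ¬ (z.1 ∈ Ioo (-1:ℝ) 1 → (z ∈ E ↔ t * z.1 ≤ thet E z.2))} := by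
    apply MeasurableSet.compl
    refine MeasurableSet.imp (measurable_fst measurableSet_Ioo) ?_
    refine MeasurableSet.iff hE ?_
    exact measurableSet_le (measurable_fst.const_mul t) (hm.comp measurable_snd)
  have := measurable_measure_prodMk_right (μ := (volume : Measure ℝ)) h
  have h2 := this (measurableSet_singleton 0)
  exact h2

theorem GoodRow.type {v : ℕ → ℝ × ℝ → ℝ} {E : Set (ℝ × ℝ)} (hE : MeasurableSet E) (hEs : E ⊆ Isq)
    {y : ℝ} (g : GoodRow v E y) : RT E 1 y ∨ RT E (-1) y := by
  obtain ⟨⟨p0, hp0, gp0, ep0⟩, q0, hq0, gq0, eq0⟩ :=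
    mixed_gen hE hEs (Ioo_subset_Icc_self g.mem) g.pos g.lt2 g.gen
  have nr' : ∀ t : ℝ, (t = 1 ∨ t = -1) → ∀ p q r : ℝ, p ∈ Ioo (-1 : ℝ) 1 → r ∈ Ioo (-1 : ℝ) 1 →
      t * p < t * q → t * q < t * r → Gen v E (p, y) → Gen v E (q, y) →
      Gen v E (r, y) → ((p, y) ∈ E ↔ (r, y) ∈ E) → ((q, y) ∈ E ↔ (p, y) ∈ E) := by
    rintro t (rfl | rfl) p q r hp hr h1 h2 a b c h
    · exact g.nr p q r hp hr (by linarith) (by linarith) a b c h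
    · rw [g.nr r q p hr hp (by linarith) (by linarith) c b a h.symm, h]
  have inj : ∀ t : ℝ, (t = 1 ∨ t = -1) → ∀ p q : ℝ, (p, y) ∈ E → (q, y) ∉ E → t * p ≠ t * q := by
    rintro t (rfl | rfl) p q h1 h2 h
    · simp only [one_mul] at h; subst h; exact h2 h1
    · simp only [neg_mul, one_mul, neg_inj] at h; subst h; exact h2 h1
  have fin : ∀ a : ℝ, ∀ᵐ v : ℝ, v ≠ a := fun a => by simp [ae_iff]
  have hne : rowm E y ≠ ⊤ := (g.lt2.trans (by norm_num)).ne
  have main : ∀ t : ℝ, (t = 1 ∨ t = -1) → t * p0 < t * q0 → RT E t y := by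
    intro t ht h0
    have sep : ∀ p q : ℝ, p ∈ Ioo (-1:ℝ) 1 → q ∈ Ioo (-1:ℝ) 1 → Gen v E (p, y) → Gen v E (q, y) → (p, y) ∈ E →
        (q, y) ∉ E → t * p < t * q := by
      intro p q hp hq gp gq ep eq
      by_contra hcon
      have hcon := lt_of_le_of_ne (not_lt.1 hcon) (inj t ht p q ep eq).symm
      rcases lt_trichotomy (t * q) (t * p0) with h | h | h
      · have := nr' t ht q p0 q0 hq hq0 h h0 gq gp0 gq0 (by tauto); tauto
      · exact inj t ht p0 q ep0 eq h.symm
      · have := nr' t ht p0 q p hp0 hp h hcon gp0 gq gp (by tauto); tauto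
    have vol1 : ∀ q ∈ Ioo (-1:ℝ) 1, Gen v E (q, y) → (q, y) ∉ E → thet E y ≤ t * q := by
      intro q hq gq eq
      have h1 : rowm E y ≤ volume {p : ℝ | p ∈ Icc (-1:ℝ) 1 ∧ t * p ≤ t * q} := by
        apply measure_mono_ae
        filter_upwards [g.gen, fin 1, fin (-1)] with p hp h1 h2 (hpE : (p, y) ∈ E)
        have := mem_Isq_iff.1 (hEs hpE)
        have hp' : p ∈ Ioo (-1 : ℝ) 1 := ⟨lt_of_le_of_ne this.1.1 h2.symm, lt_of_le_of_ne this.2.1 h1⟩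
        exact ⟨Ioo_subset_Icc_self hp', (sep p q hp' hq (hp hp') gq hpE eq).le⟩
      have h2 : volume {p : ℝ | p ∈ Icc (-1:ℝ) 1 ∧ t * p ≤ t * q} ≤ ENNReal.ofReal (t * q + 1) := by
        rcases ht with rfl | rfl
        · refine (measure_mono (t := Icc (-1) q) ?_).trans ?_
          · rintro p ⟨h, h'⟩; exact ⟨h.1, by linarith⟩
          · rw [Real.volume_Icc]; apply ENNReal.ofReal_le_ofReal; linarith
        · refine (measure_mono (t := Icc q 1) ?_).trans ?_
          · rintro p ⟨h, h'⟩; exact ⟨by linarith, h.2⟩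
          · rw [Real.volume_Icc]; apply ENNReal.ofReal_le_ofReal; linarith
      have h3 := ENNReal.toReal_mono ofReal_ne_top (h1.trans h2)
      rw [ENNReal.toReal_ofReal (by rcases ht with rfl | rfl <;> linarith [hq.1, hq.2])] at h3
      unfold thet; linarith
    have vol2 : ∀ q ∈ Ioo (-1:ℝ) 1, Gen v E (q, y) → (q, y) ∈ E → t * q ≤ thet E y := by
      intro q hq gq eq
      have h1 : rowm (Isq \ E) y ≤ volume {p : ℝ | p ∈ Icc (-1:ℝ) 1 ∧ t * q ≤ t * p} := by
        apply measure_mono_ae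
        filter_upwards [g.gen, fin 1, fin (-1)] with p hp h1 h2 (hpE : (p, y) ∈ Isq \ E)
        have := mem_Isq_iff.1 hpE.1
        have hp' : p ∈ Ioo (-1 : ℝ) 1 := ⟨lt_of_le_of_ne this.1.1 h2.symm, lt_of_le_of_ne this.2.1 h1⟩
        exact ⟨Ioo_subset_Icc_self hp', (sep q p hq hp' gq (hp hp') eq hpE.2).le⟩
      have h2 : volume {p : ℝ | p ∈ Icc (-1:ℝ) 1 ∧ t * q ≤ t * p} ≤ ENNReal.ofReal (1 - t * q) := by
        rcases ht with rfl | rfl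
        · refine (measure_mono (t := Icc q 1) ?_).trans ?_
          · rintro p ⟨h, h'⟩; exact ⟨by linarith, h.2⟩
          · rw [Real.volume_Icc]; apply ENNReal.ofReal_le_ofReal; linarith
        · refine (measure_mono (t := Icc (-1) q) ?_).trans ?_
          · rintro p ⟨h, h'⟩; exact ⟨h.1, by linarith⟩
          · rw [Real.volume_Icc]; apply ENNReal.ofReal_le_ofReal; linarith
      have hc := rowm_compl hE hEs (Ioo_subset_Icc_self g.mem)
      have hne2 : rowm (Isq \ E) y ≠ ⊤ := fun h => by rw [h] at hc; simp at hc
      have hc2 := congrArg ENNReal.toReal hc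
      rw [ENNReal.toReal_add hne hne2] at hc2
      have h3 := ENNReal.toReal_mono ofReal_ne_top (h1.trans h2)
      rw [ENNReal.toReal_ofReal (by rcases ht with rfl | rfl <;> linarith [hq.1, hq.2])] at h3
      norm_num at hc2
      unfold thet; linarith
    filter_upwards [g.gen, fin (t * thet E y)] with p hp hne hpI
    refine ⟨fun h => vol2 p hpI (hp hpI) h, fun h => ?_⟩
    by_contra hcon
    have := vol1 p hpI (hp hpI) hcon
    apply hne
    rw [le_antisymm this h, ← mul_assoc, sgn_sq ht, one_mul]
  rcases lt_or_gt_of_ne (inj 1 (by simp) p0 q0 ep0 eq0) with h | h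
  · exact Or.inl (main 1 (by simp) h)
  · exact Or.inr (main (-1) (by simp) (by linarith))

theorem ae_pick {P : ℝ → Prop} (hP : ∀ᵐ x : ℝ, P x) {a b : ℝ} (hab : a < b) : ∃ x, P x ∧ x ∈ Ioo a b := by
  have : ∃ᶠ x in ae (volume : Measure ℝ), x ∈ Ioo a b := by
    intro h
    have h0 := (ae_iff.1 h)
    simp only [not_not] at h0
    have h1 := Real.volume_Ioo (a := a) (b := b)
    rw [show Ioo a b = {x | x ∈ Ioo a b} from rfl, h0] at h1
    have := (ENNReal.ofReal_pos.2 (sub_pos.2 hab))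
    exact this.ne h1
  obtain ⟨x, h1, h2⟩ := (this.and_eventually hP).exists
  exact ⟨x, h2, h1⟩

theorem ae_pick_sgn {P : ℝ → Prop} (hP : ∀ᵐ x : ℝ, P x) {a b t : ℝ} (ht : t = 1 ∨ t = -1) (hab : a < b) :
    ∃ x, P x ∧ t * x ∈ Ioo a b := by
  obtain ⟨x, h1, h2⟩ := ae_pick ((refl_mp1 ht 0).quasiMeasurePreserving.ae hP) hab
  refine ⟨0 + t * x, h1, ?_⟩
  rwa [zero_add, ← mul_assoc, sgn_sq ht, one_mul]

theorem pair_num {t1 t2 a b d : ℝ} (h1 : t1 = 1 ∨ t1 = -1) (h2 : t2 = 1 ∨ t2 = -1)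
    (ha : a ∈ Ioo (-1:ℝ) 1) (hb : b ∈ Ioo (-1 : ℝ) 1) (hd : 0 < d) (hd4 : d < 1 / 4)
    (hC : ∀ᵐ x : ℝ, x ∈ Ioo (-1 + d) (1 - d) → (a < t1 * x - d → ¬ (t2 * x ≤ b)) ∧ (t1 * x + d < a → t2 * x ≤ b)) :
    (a ≤ 0 → b ≤ a + d) ∧ (0 ≤ a → a - d ≤ b) ∧ (2 * d - 1 < a → a < 1 - 2 * d → t1 = t2) := by
  have hC' : ∀ l r : ℝ, -1 + d ≤ l → r ≤ 1 - d → l < r → ∃ x, t1 * x ∈ Ioo l r ∧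
      (a < t1 * x - d → ¬ (t2 * x ≤ b)) ∧ (t1 * x + d < a → t2 * x ≤ b) := by
    intro l r hl hr hlr
    obtain ⟨x, hx, hxI⟩ := ae_pick_sgn hC h1 hlr
    refine ⟨x, hxI, hx ?_⟩
    rcases h1 with rfl | rfl <;> constructor <;> linarith [hxI.1, hxI.2]
  have ht : t2 = t1 ∨ t2 = - t1 := by
    rcases h1 with rfl | rfl <;> rcases h2 with rfl | rfl <;> norm_num
  obtain ⟨ha1, ha2⟩ := ha
  obtain ⟨hb1, hb2⟩ := hb
  refine ⟨fun h => ?_, fun h => ?_, fun h h' => ?_⟩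
  · by_contra hcon
    push Not at hcon
    rcases ht with rfl | rfl
    · obtain ⟨x, hx, hx1, -⟩ := hC' (a + d) (min (1 - d) b) (by linarith) (min_le_left _ _)
        (lt_min (by linarith) (by linarith))
      have := hx.2.trans_le (min_le_right _ _)
      exact hx1 (by linarith [hx.1]) this.le
    · obtain ⟨x, hx, hx1, -⟩ := hC' (max (a + d) (- b)) (1 - d) (by linarith [le_max_left (a + d) (-b)]) le_rfl
        (max_lt (by linarith) (by linarith))
      have := (le_max_left _ _).trans_lt hx.1
      have := (le_max_right _ _).trans_lt hx.1
      exact hx1 (by linarith) (by linarith)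
  · by_contra hcon
    push Not at hcon
    rcases ht with rfl | rfl
    · obtain ⟨x, hx, -, hx1⟩ := hC' (max (-1 + d) b) (a - d) (le_max_left _ _) (by linarith)
        (max_lt (by linarith) (by linarith))
      have := (le_max_right _ _).trans_lt hx.1
      linarith [hx1 (by linarith [hx.2])]
    · obtain ⟨x, hx, -, hx1⟩ := hC' (-1 + d) (min (a - d) (-b)) le_rfl (by linarith [min_le_left (a - d) (-b)])
        (lt_min (by linarith) (by linarith))
      have := hx.2.trans_le (min_le_left _ _)
      have := hx.2.trans_le (min_le_right _ _)
      linarith [hx1 (by linarith)]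
  · rcases ht with rfl | rfl
    · rfl
    · obtain ⟨x, hx, hx1, -⟩ := hC' (a + d) (1 - d) (by linarith) le_rfl (by linarith)
      obtain ⟨w, hw, -, hw1⟩ := hC' (-1 + d) (a - d) le_rfl (by linarith) (by linarith)
      have a1 := hx1 (by linarith [hx.1])
      have a2 := hw1 (by linarith [hw.2])
      exfalso; linarith [hx.1, hw.2]

theorem Setup.shift {v : ℕ → ℝ × ℝ → ℝ} {E : Set (ℝ × ℝ)} (S : Setup v E) {d : ℝ} (hd : 0 < d) {s : ℝ}
    (hs : s = 1 ∨ s = -1) :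
    ∀ᵐ y : ℝ, ∀ᵐ x : ℝ, x ∈ Ioo (-1 + d) (1 - d) → y ∈ Ioo (-1 : ℝ) 1 → y + s * d ∈ Ioo (-1 : ℝ) 1 →
      ((x - d, y) ∈ E ↔ (x + d, y) ∈ E) → ((x, y + s * d) ∈ E ↔ (x - d, y) ∈ E) := by
  have hmE : ∀ f : ℝ × ℝ → ℝ × ℝ, Measurable f → MeasurableSet {z | f z ∈ E} := fun f hf => hf S.hE
  rw [← Measure.ae_ae_comm]
  · have c := S.gencol
    filter_upwards [c, (measurePreserving_add_right volume d).quasiMeasurePreserving.ae c,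
      (measurePreserving_sub_right volume d).quasiMeasurePreserving.ae c] with x h1 h2 h3
    by_cases hx : x ∈ Ioo (-1 + d) (1 - d)
    · obtain ⟨ha, hb⟩ := hx
      filter_upwards [coupling S hd (by linarith) (by linarith) (h3 ⟨by linarith, by linarith⟩)
        (h2 ⟨by linarith, by linarith⟩) (h1 ⟨by linarith, by linarith⟩) hs] with y h _
      exact h
    · exact Eventually.of_forall fun y h => absurd h hx
  · refine MeasurableSet.imp (measurable_fst measurableSet_Ioo) (MeasurableSet.imp (measurable_snd measurableSet_Ioo)
      (MeasurableSet.imp ?_ (MeasurableSet.imp (MeasurableSet.iff (hmE _ ?_) (hmE _ ?_)) (MeasurableSet.iff (hmE _ ?_) (hmE _ ?_)))))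
    · exact (measurable_snd.add_const (s * d)) measurableSet_Ioo
    all_goals fun_prop

/-- two-row relation -/
def FR (E : Set (ℝ × ℝ)) (y d : ℝ) : Prop :=
  d ∈ Ioo (0:ℝ) (1/4) → y ∈ Ioo (-1:ℝ) 1 → y + d ∈ Ioo (-1:ℝ) 1 → |thet E y - thet E (y + d)| ≤ d ∧
    (2 * d - 1 < thet E y → thet E y < 1 - 2 * d → (RT E 1 y ↔ RT E 1 (y + d)))

theorem GoodRow.thet_mem {v : ℕ → ℝ × ℝ → ℝ} {E : Set (ℝ × ℝ)} {y : ℝ} (g : GoodRow v E y) :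
    thet E y ∈ Ioo (-1:ℝ) 1 := by
  have hne : rowm E y ≠ ⊤ := (g.lt2.trans (by norm_num)).ne
  have h1 := ENNReal.toReal_pos g.pos.ne' hne
  have h2 := (ENNReal.toReal_lt_toReal hne (by norm_num)).2 g.lt2
  norm_num at h2
  unfold thet; constructor <;> linarith

theorem Setup.half {v : ℕ → ℝ × ℝ → ℝ} {E : Set (ℝ × ℝ)} (S : Setup v E) {d s y1 y2 : ℝ} (hd : d ∈ Ioo (0:ℝ) (1/4))
    (g1 : GoodRow v E y1) (g2 : GoodRow v E y2) (e : y2 = y1 + s * d)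
    (h : ∀ᵐ x : ℝ, x ∈ Ioo (-1 + d) (1 - d) → y1 ∈ Ioo (-1 : ℝ) 1 → y1 + s * d ∈ Ioo (-1 : ℝ) 1 →
      ((x - d, y1) ∈ E ↔ (x + d, y1) ∈ E) → ((x, y1 + s * d) ∈ E ↔ (x - d, y1) ∈ E)) {t1 t2 : ℝ}
    (ht1 : t1 = 1 ∨ t1 = -1) (ht2 : t2 = 1 ∨ t2 = -1) (r1 : RT E t1 y1) (r2 : RT E t2 y2) :
    (thet E y1 ≤ 0 → thet E y2 ≤ thet E y1 + d) ∧ (0 ≤ thet E y1 → thet E y1 - d ≤ thet E y2) ∧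
      (2 * d - 1 < thet E y1 → thet E y1 < 1 - 2 * d → t1 = t2) := by
  refine pair_num ht1 ht2 g1.thet_mem g2.thet_mem hd.1 hd.2 ?_
  rw [← e] at h
  filter_upwards [h, r2, (measurePreserving_add_right volume d).quasiMeasurePreserving.ae r1,
      (measurePreserving_sub_right volume d).quasiMeasurePreserving.ae r1] with x a b c e hx
  obtain ⟨hd1, hd2⟩ := hd
  obtain ⟨hx1, hx2⟩ := hx
  have a := a ⟨hx1, hx2⟩ g1.mem g2.mem
  have b := b ⟨by linarith, by linarith⟩
  have c := c ⟨by linarith, by linarith⟩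
  have e := e ⟨by linarith, by linarith⟩
  constructor
  · intro hlt
    have n1 : ¬ (t1 * (x + d) ≤ thet E y1) := by rcases ht1 with rfl | rfl <;> linarith
    have n2 : ¬ (t1 * (x - d) ≤ thet E y1) := by rcases ht1 with rfl | rfl <;> linarith
    exact fun hb => n2 (e.1 ((a ⟨fun q => absurd (e.1 q) n2, fun q => absurd (c.1 q) n1⟩).1 (b.2 hb)))
  · intro hlt
    have n1 : (t1 * (x + d) ≤ thet E y1) := by rcases ht1 with rfl | rfl <;> linarith
    have n2 : (t1 * (x - d) ≤ thet E y1) := by rcases ht1 with rfl | rfl <;> linarith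
    exact b.1 ((a ⟨fun _ => c.2 n1, fun _ => e.2 n2⟩).2 (e.2 n2))

theorem Setup.fr {v : ℕ → ℝ × ℝ → ℝ} {E : Set (ℝ × ℝ)} (S : Setup v E) (d : ℝ) : ∀ᵐ y : ℝ, FR E y d := by
  by_cases hd : d ∈ Ioo (0:ℝ) (1/4)
  swap
  · exact Eventually.of_forall fun y h => absurd h hd
  have sh1 := S.shift hd.1 (s := 1) (by simp)
  have sh2 := S.shift hd.1 (s := -1) (by simp)
  filter_upwards [sh1, (measurePreserving_add_right volume d).quasiMeasurePreserving.ae sh2, S.good,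
    (measurePreserving_add_right volume d).quasiMeasurePreserving.ae S.good] with y a b g1 g2 _ hy hyd
  have g1 := g1 hy
  have g2 := g2 hyd
  have ex : ∀ {y}, GoodRow v E y → ∃ t : ℝ, (t = 1 ∨ t = -1) ∧ RT E t y := by
    intro y g
    rcases g.type S.hE S.hEs with h | h
    · exact ⟨1, by simp, h⟩
    · exact ⟨-1, by simp, h⟩
  obtain ⟨t1, ht1, r1⟩ := ex g1
  obtain ⟨t2, ht2, r2⟩ := ex g2
  have A := S.half hd g1 g2 (by ring) a ht1 ht2 r1 r2
  have B := S.half hd g2 g1 (by ring) b ht2 ht1 r2 r1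
  refine ⟨?_, fun h1 h2 => ⟨fun r => ?_, fun r => ?_⟩⟩
  · obtain ⟨A1, A2, -⟩ := A
    obtain ⟨B1, B2, -⟩ := B
    have := hd.1
    rw [abs_le]
    rcases le_total (thet E y) 0 with h | h <;> rcases le_total (thet E (y + d)) 0 with h' | h'
    · constructor <;> linarith [A1 h, B1 h']
    · constructor <;> linarith [A1 h, B2 h']
    · constructor <;> linarith [A2 h, B1 h']
    · constructor <;> linarith [A2 h, B2 h']
  · have := (S.half hd g1 g2 (by ring) a (t1 := 1) (by simp) ht2 r r2).2.2 h1 h2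
    rwa [← this] at r2
  · have := (S.half hd g1 g2 (by ring) a (t2 := 1) ht1 (by simp) r1 r).2.2 h1 h2
    rwa [this] at r1

theorem FR_meas {E : Set (ℝ × ℝ)} (hE : MeasurableSet E) : MeasurableSet {z : ℝ × ℝ | FR E z.2 z.1} := by
  have hm := thet_meas hE
  have hR := RT_meas hE 1
  have hadd : Measurable fun z : ℝ × ℝ => z.2 + z.1 := by fun_prop
  refine MeasurableSet.imp (measurable_fst measurableSet_Ioo) (MeasurableSet.imp (measurable_snd measurableSet_Ioo)
      (MeasurableSet.imp (hadd measurableSet_Ioo) (MeasurableSet.inter ?_ (MeasurableSet.imp ?_ (MeasurableSet.imp ?_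
        (MeasurableSet.iff (measurable_snd hR) (hadd hR)))))))
  · refine measurableSet_le ?_ measurable_fst
    exact ((hm.comp measurable_snd).sub (hm.comp hadd)).abs
  · exact measurableSet_lt (by fun_prop) (hm.comp measurable_snd)
  · exact measurableSet_lt (hm.comp measurable_snd) (by fun_prop)

theorem Setup.frfr {v : ℕ → ℝ × ℝ → ℝ} {E : Set (ℝ × ℝ)} (S : Setup v E) :
    ∀ᵐ y : ℝ, ∀ᵐ y2 : ℝ, FR E y (y2 - y) ∧ FR E y2 (y - y2) := by
  have h0 : ∀ᵐ d : ℝ, ∀ᵐ y : ℝ, FR E y d := Eventually.of_forall fun d => S.fr d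
  rw [Measure.ae_ae_comm (p := fun d y => FR E y d) (FR_meas S.hE)] at h0
  have h1 : ∀ᵐ y : ℝ, ∀ᵐ y2 : ℝ, FR E y (y2 - y) := by
    filter_upwards [h0] with y h
    exact (measurePreserving_sub_right volume y).quasiMeasurePreserving.ae h
  have h2 := h1
  rw [Measure.ae_ae_comm (p := fun y y2 => FR E y (y2 - y))] at h2
  · filter_upwards [h1, h2] with y a b
    exact a.and b
  · exact (by fun_prop : Measurable fun z : ℝ × ℝ => (z.2 - z.1, z.1)) (FR_meas S.hE)

end


noncomputable section
open scoped Topology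

/-- set of fully good rows -/
def Yg (v : ℕ → ℝ × ℝ → ℝ) (E : Set (ℝ × ℝ)) : Set ℝ :=
  {y | GoodRow v E y ∧ ∀ᵐ y2 : ℝ, FR E y (y2 - y) ∧ FR E y2 (y - y2)}

theorem Setup.yg {v : ℕ → ℝ × ℝ → ℝ} {E : Set (ℝ × ℝ)} (S : Setup v E) :
    ∀ᵐ y : ℝ, y ∈ Ioo (-1 : ℝ) 1 → y ∈ Yg v E := by
  filter_upwards [S.good, S.frfr] with y a b hy
  exact ⟨a hy, b⟩

theorem Setup.pick {v : ℕ → ℝ × ℝ → ℝ} {E : Set (ℝ × ℝ)} (S : Setup v E) {a b : ℝ} (ha : -1 ≤ a) (hb : b ≤ 1)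
    (hab : a < b) : ∃ y ∈ Yg v E, y ∈ Ioo a b := by
  obtain ⟨y, h1, h2⟩ := ae_pick S.yg hab
  exact ⟨y, h1 ⟨by linarith [h2.1], by linarith [h2.2]⟩, h2⟩

theorem Setup.step {v : ℕ → ℝ × ℝ → ℝ} {E : Set (ℝ × ℝ)} (S : Setup v E) {y w : ℝ} (hy : y ∈ Yg v E)
    (hw : w ∈ Yg v E) (hlt : y < w) (h4 : w < y + 1 / 4) : |thet E y - thet E w| ≤ w - y := by
  obtain ⟨z, ⟨h1, h2⟩, hz⟩ := ae_pick (hy.2.and hw.2) hlt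
  have m1 := hy.1.mem
  have m2 := hw.1.mem
  have mz : z ∈ Ioo (-1:ℝ) 1 := ⟨by linarith [m1.1, hz.1], by linarith [m2.2, hz.2]⟩
  have A := (h1.1 ⟨by linarith [hz.1], by linarith [hz.2]⟩ m1 (by simpa using mz)).1
  have B := (h2.2 ⟨by linarith [hz.2], by linarith [hz.1]⟩ mz (by simpa using m2)).1
  rw [add_sub_cancel] at A B
  have := abs_sub_le (thet E y) (thet E z) (thet E w)
  linarith

theorem Setup.typ {v : ℕ → ℝ × ℝ → ℝ} {E : Set (ℝ × ℝ)} (S : Setup v E) {y w r : ℝ} (hy : y ∈ Yg v E)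
    (hw : w ∈ Yg v E) (hlt : y < w) (h4 : w < y + 1 / 4) (hr : |thet E y| < r) (hwy : 3 * (w - y) ≤ 1 - r) :
    RT E 1 y ↔ RT E 1 w := by
  obtain ⟨z, ⟨⟨h1, h2⟩, hgz⟩, hz⟩ := ae_pick ((hy.2.and hw.2).and S.yg) hlt
  have m1 := hy.1.mem
  have m2 := hw.1.mem
  have mz : z ∈ Ioo (-1:ℝ) 1 := ⟨by linarith [m1.1, hz.1], by linarith [m2.2, hz.2]⟩
  have A := (h1.1 ⟨by linarith [hz.1], by linarith [hz.2]⟩ m1 (by simpa using mz)).2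
  have B := (h2.2 ⟨by linarith [hz.2], by linarith [hz.1]⟩ mz (by simpa using m2)).2
  have C := S.step hy (hgz mz) hz.1 (by linarith [hz.2])
  rw [add_sub_cancel] at A B
  rw [abs_lt] at hr
  rw [abs_le] at C
  obtain ⟨hz1, hz2⟩ := hz
  rw [A (by linarith) (by linarith), B (by linarith) (by linarith)]

theorem Setup.lip {v : ℕ → ℝ × ℝ → ℝ} {E : Set (ℝ × ℝ)} (S : Setup v E) :
    LipschitzOnWith 1 (thet E) (Yg v E) := by
  have key : ∀ n : ℕ, ∀ y ∈ Yg v E, ∀ w ∈ Yg v E, y < w → w - y < (n + 1) / 8 → |thet E y - thet E w| ≤ w - y := by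
    intro n
    induction n with
    | zero => intro y hy w hw h h'; exact S.step hy hw h (by norm_num at h'; linarith)
    | succ n ih =>
      intro y hy w hw h h'
      by_cases hs : w < y + 1 / 4
      · exact S.step hy hw h hs
      · push Not at hs
        obtain ⟨z, hz, hz1, hz2⟩ := S.pick (a := y + 1/8) (b := y + 1/4) (by linarith [hy.1.mem.1])
          (by linarith [hw.1.mem.2]) (by linarith)
        push_cast at h'
        have A := S.step hy hz (by linarith) (by linarith)
        have B := ih z hz w hw (by linarith) (by linarith)
        have := abs_sub_le (thet E y) (thet E z) (thet E w)
        linarith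
  have key2 : ∀ y ∈ Yg v E, ∀ w ∈ Yg v E, y < w → |thet E y - thet E w| ≤ w - y := by
    intro y hy w hw h
    obtain ⟨n, hn⟩ := exists_nat_gt (8 * (w - y))
    exact key n y hy w hw h (by linarith)
  refine LipschitzOnWith.of_dist_le_mul fun y hy w hw => ?_
  rw [NNReal.coe_one, one_mul, Real.dist_eq, Real.dist_eq]
  rcases lt_trichotomy y w with h | h | h
  · rw [abs_sub_comm y w, abs_of_pos (sub_pos.2 h)]; exact key2 y hy w hw h
  · subst h; simp
  · rw [abs_sub_comm (thet E y), abs_of_pos (sub_pos.2 h)]; exact key2 w hw y hy h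

theorem int_abs (a : ℝ) (ha : a ∈ Ioo (-1:ℝ) 1) : ∫ y in (-1:ℝ)..1, |y - a| = 1 + a ^ 2 := by
  have hc : Continuous fun y : ℝ => |y - a| := by fun_prop
  rw [← intervalIntegral.integral_add_adjacent_intervals (b := a) (hc.intervalIntegrable _ _) (hc.intervalIntegrable _ _)]
  have h1 : ∫ y in (-1:ℝ)..a, |y - a| = ∫ y in (-1:ℝ)..a, (a - y) := by
    apply intervalIntegral.integral_congr
    intro y hy
    rw [uIcc_of_le ha.1.le] at hy
    simp only
    rw [abs_of_nonpos (by linarith [hy.2])]; ring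
  have h2 : ∫ y in a..(1:ℝ), |y - a| = ∫ y in a..(1:ℝ), (y - a) := by
    apply intervalIntegral.integral_congr
    intro y hy
    rw [uIcc_of_le ha.2.le] at hy
    simp only
    rw [abs_of_nonneg (by linarith [hy.1])]
  rw [h1, h2]
  have i1 : ∀ p q : ℝ, IntervalIntegrable (fun _ : ℝ => a) volume p q := fun p q => intervalIntegrable_const
  have i2 : ∀ p q : ℝ, IntervalIntegrable (fun y : ℝ => y) volume p q := fun p q => continuous_id.intervalIntegrable _ _
  rw [intervalIntegral.integral_sub (i1 _ _) (i2 _ _), intervalIntegral.integral_sub (i2 _ _) (i1 _ _)]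
  simp only [intervalIntegral.integral_const, integral_id, smul_eq_mul]
  ring

theorem lip_interior {G : ℝ → ℝ} (hG : LipschitzWith 1 G) (hI : ∀ y ∈ Icc (-1:ℝ) 1, G y ∈ Icc (-1:ℝ) 1)
    (h0 : ∫ y in (-1:ℝ)..1, G y = 0) : ∀ y ∈ Ioo (-1:ℝ) 1, G y ∈ Ioo (-1:ℝ) 1 := by
  intro a ha
  have hb := hI a (Ioo_subset_Icc_self ha)
  have hl : ∀ y, |G y - G a| ≤ |y - a| := fun y => by simpa [Real.dist_eq] using hG.dist_le_mul y a
  have ci : ∀ f : ℝ → ℝ, Continuous f → IntervalIntegrable f volume (-1) 1 := fun f hf => hf.intervalIntegrable _ _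
  have hab := int_abs a ha
  have ha2 : a ^ 2 < 1 := by nlinarith [ha.1, ha.2]
  refine ⟨lt_of_le_of_ne hb.1 fun h => ?_, lt_of_le_of_ne hb.2 fun h => ?_⟩
  · have : ∫ y in (-1:ℝ)..1, G y ≤ ∫ y in (-1:ℝ)..1, (|y - a| - 1) := by
      apply intervalIntegral.integral_mono_on (by norm_num) (ci _ hG.continuous) (ci _ (by fun_prop))
      intro y _
      have := (abs_le.1 (hl y)).2
      linarith
    rw [intervalIntegral.integral_sub (ci _ (by fun_prop)) (ci _ (by fun_prop)), hab] at this
    norm_num at this; linarith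
  · have : ∫ y in (-1:ℝ)..1, (1 - |y - a|) ≤ ∫ y in (-1:ℝ)..1, G y := by
      apply intervalIntegral.integral_mono_on (by norm_num) (ci _ (by fun_prop)) (ci _ hG.continuous)
      intro y _
      have := (abs_le.1 (hl y)).1
      linarith
    rw [intervalIntegral.integral_sub (ci _ (by fun_prop)) (ci _ (by fun_prop)), hab] at this
    norm_num at this; linarith

theorem Setup.int_thet {v : ℕ → ℝ × ℝ → ℝ} {E : Set (ℝ × ℝ)} (S : Setup v E) :
    ∫ y in (-1:ℝ)..1, thet E y = 0 := by
  have h1 : ∫⁻ y in Ioc (-1:ℝ) 1, rowm E y = 2 := by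
    rw [← S.hvol, Measure.volume_eq_prod, Measure.prod_apply_symm S.hE]
    rw [← lintegral_indicator measurableSet_Ioc]
    have fin : ∀ᵐ v : ℝ, v ≠ -1 := by simp [ae_iff]
    apply lintegral_congr_ae
    filter_upwards [fin] with y hy
    by_cases h : y ∈ Ioc (-1:ℝ) 1
    · rw [indicator_of_mem h]; rfl
    · rw [indicator_of_notMem h]
      symm
      convert measure_empty (μ := (volume : Measure ℝ))
      ext x
      simp only [mem_preimage, mem_empty_iff_false, iff_false]
      intro hx
      have := mem_Isq_iff.1 (S.hEs hx)
      exact h ⟨lt_of_le_of_ne this.1.2 (Ne.symm hy), this.2.2⟩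
  have hfin : ∀ᵐ y ∂(volume.restrict (Ioc (-1:ℝ) 1)), rowm E y < ⊤ :=
    ae_lt_top (rowm_meas S.hE) (by rw [h1]; norm_num)
  have h2 : ∫ y in (-1:ℝ)..1, (rowm E y).toReal = 2 := by
    rw [intervalIntegral.integral_of_le (by norm_num), integral_toReal (rowm_meas S.hE).aemeasurable hfin, h1]; norm_num
  have h3 : IntervalIntegrable (fun y => (rowm E y).toReal) volume (-1) 1 := by
    rw [intervalIntegrable_iff_integrableOn_Ioc_of_le (by norm_num)]
    exact integrable_toReal_of_lintegral_ne_top (rowm_meas S.hE).aemeasurable (by rw [h1]; norm_num)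
  unfold thet
  rw [intervalIntegral.integral_sub h3 intervalIntegrable_const, h2]
  norm_num

theorem Setup.graph {v : ℕ → ℝ × ℝ → ℝ} {E : Set (ℝ × ℝ)} (S : Setup v E) :
    ∃ G : ℝ → ℝ, LipschitzWith 1 G ∧ (∀ y ∈ Icc (-1:ℝ) 1, G y ∈ Icc (-1:ℝ) 1) ∧
      (∀ y ∈ Ioo (-1:ℝ) 1, G y ∈ Ioo (-1:ℝ) 1) ∧
      ∃ t : ℝ, (t = 1 ∨ t = -1) ∧ ∀ᵐ z : ℝ × ℝ, (z ∈ E ↔ z ∈ Isq ∧ t * z.1 ≤ G z.2) := by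
  obtain ⟨G, hG, hGe⟩ := S.lip.extend_real
  have hGc := hG.continuous
  have hl : ∀ y w, |G y - G w| ≤ |y - w| := fun y w => by simpa [Real.dist_eq] using hG.dist_le_mul y w
  have hI : ∀ y ∈ Icc (-1:ℝ) 1, G y ∈ Icc (-1:ℝ) 1 := by
    intro y hy
    have hcl : y ∈ closure (Yg v E) := by
      rw [Metric.mem_closure_iff]
      intro ε hε
      obtain ⟨w, hw, h⟩ := S.pick (a := max (-1) (y - ε)) (b := min 1 (y + ε)) (le_max_left _ _) (min_le_left _ _)
        (max_lt (lt_min (by norm_num) (by linarith [hy.1])) (lt_min (by linarith [hy.2]) (by linarith)))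
      refine ⟨w, hw, ?_⟩
      have := (le_max_right _ _).trans_lt h.1
      have := h.2.trans_le (min_le_right _ _)
      rw [Real.dist_eq, abs_lt]; constructor <;> linarith
    have : closure (Yg v E) ⊆ G ⁻¹' (Icc (-1) 1) := by
      apply closure_minimal _ (isClosed_Icc.preimage hGc)
      intro w hw
      rw [mem_preimage, ← hGe hw]
      exact Ioo_subset_Icc_self hw.1.thet_mem
    exact this hcl
  have h0 : ∫ y in (-1:ℝ)..1, G y = 0 := by
    rw [← S.int_thet]
    apply intervalIntegral.integral_congr_ae
    have fin : ∀ᵐ v : ℝ, v ≠ 1 := by simp [ae_iff]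
    filter_upwards [S.yg, fin] with y hy h1 h
    rw [uIoc_of_le (by norm_num)] at h
    exact (hGe (hy ⟨h.1, lt_of_le_of_ne h.2 h1⟩)).symm
  have hO := lip_interior hG hI h0
  refine ⟨G, hG, hI, hO, ?_⟩
  -- constant type
  have hconst : ∀ x ∈ Ioo (-1:ℝ) 1, ∀ y ∈ Ioo (-1:ℝ) 1, ∃ δ > 0, ∀ y1 ∈ Yg v E, ∀ y2 ∈ Yg v E,
      |y1 - x| < δ → |y2 - y| < δ → (RT E 1 y1 ↔ RT E 1 y2) := by
    intro x hx y hy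
    refine isPreconnected_Ioo.induction₂ (fun x y => ∃ δ > 0, ∀ y1 ∈ Yg v E, ∀ y2 ∈ Yg v E,
      |y1 - x| < δ → |y2 - y| < δ → (RT E 1 y1 ↔ RT E 1 y2)) ?_ ?_ ?_ hx hy
    · intro x hx
      have hgx : |G x| < 1 := abs_lt.2 (hO x hx)
      set δ := (1 - |G x|) / 16 with hδ
      have hδ1 : δ ≤ 1 / 16 := by rw [hδ]; linarith [abs_nonneg (G x)]
      have hδ0 : 0 < δ := by rw [hδ]; linarith
      filter_upwards [mem_nhdsWithin_of_mem_nhds (Metric.ball_mem_nhds x hδ0)] with y hyx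
      rw [Metric.mem_ball, Real.dist_eq, abs_lt] at hyx
      refine ⟨δ, hδ0, ?_⟩
      have aux : ∀ y1 ∈ Yg v E, ∀ y2 ∈ Yg v E, y1 < y2 → |y1 - x| < 2 * δ → |y2 - x| < 2 * δ → (RT E 1 y1 ↔ RT E 1 y2) := by
        intro y1 h1 y2 h2 hlt ha hb
        have hG1 : |thet E y1| < |G x| + 2 * δ := by
          rw [hGe h1]
          have := hl y1 x
          have := abs_sub_abs_le_abs_sub (G y1) (G x)
          linarith
        rw [abs_lt] at ha hb
        exact S.typ h1 h2 hlt (by linarith) hG1 (by linarith)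
      intro y1 h1 y2 h2 ha hb
      rw [abs_lt] at ha hb
      have ha' : |y1 - x| < 2 * δ := by rw [abs_lt]; constructor <;> linarith
      have hb' : |y2 - x| < 2 * δ := by rw [abs_lt]; constructor <;> linarith
      rcases lt_trichotomy y1 y2 with h | h | h
      · exact aux y1 h1 y2 h2 h ha' hb'
      · rw [h]
      · exact (aux y2 h2 y1 h1 h hb' ha').symm
    · rintro x y z hx hy hz ⟨δ, hδ, h⟩ ⟨δ', hδ', h'⟩
      refine ⟨min δ δ', lt_min hδ hδ', fun y1 h1 y2 h2 ha hb => ?_⟩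
      set η := min δ δ'
      have hη : 0 < η := lt_min hδ hδ'
      obtain ⟨w, hw, hwI⟩ := S.pick (a := max (-1) (y - η)) (b := min 1 (y + η)) (le_max_left _ _) (min_le_left _ _)
        (max_lt (lt_min (by norm_num) (by linarith [hy.1])) (lt_min (by linarith [hy.2]) (by linarith)))
      have w1 := (le_max_right _ _).trans_lt hwI.1
      have w2 := hwI.2.trans_le (min_le_right _ _)
      have hwy : |w - y| < η := by rw [abs_lt]; constructor <;> linarith
      rw [h y1 h1 w hw (ha.trans_le (min_le_left _ _)) (hwy.trans_le (min_le_left _ _)),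
        h' w hw y2 h2 (hwy.trans_le (min_le_right _ _)) (hb.trans_le (min_le_right _ _))]
    · rintro x y hx hy ⟨δ, hδ, h⟩
      exact ⟨δ, hδ, fun y1 h1 y2 h2 ha hb => (h y2 h2 y1 h1 hb ha).symm⟩
  have hiff : ∀ x ∈ Yg v E, ∀ y ∈ Yg v E, (RT E 1 x ↔ RT E 1 y) := by
    intro x hx y hy
    obtain ⟨δ, hδ, h⟩ := hconst x hx.1.mem y hy.1.mem
    exact h x hx y hy (by simpa) (by simpa)
  have hex : ∃ t : ℝ, (t = 1 ∨ t = -1) ∧ ∀ y ∈ Yg v E, RT E t y := by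
    by_cases h : ∃ y ∈ Yg v E, RT E 1 y
    · obtain ⟨y, hy, hr⟩ := h
      exact ⟨1, by simp, fun w hw => (hiff y hy w hw).1 hr⟩
    · refine ⟨-1, by simp, fun w hw => ?_⟩
      rcases hw.1.type S.hE S.hEs with h' | h'
      · exact absurd ⟨w, hw, h'⟩ h
      · exact h'
  obtain ⟨t, ht, hR⟩ := hex
  refine ⟨t, ht, ?_⟩
  have hms : MeasurableSet {z : ℝ × ℝ | z ∈ E ↔ z ∈ Isq ∧ t * z.1 ≤ G z.2} := by
    refine MeasurableSet.iff S.hE (MeasurableSet.inter Isq_meas ?_)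
    exact measurableSet_le (by fun_prop) (hGc.measurable.comp measurable_snd)
  rw [Measure.volume_eq_prod, Measure.ae_prod_iff_ae_ae hms, Measure.ae_ae_comm (p := fun x y => ((x, y) ∈ E ↔ (x, y) ∈ Isq ∧ t * x ≤ G y)) hms]
  have fin : ∀ a : ℝ, ∀ᵐ v : ℝ, v ≠ a := fun a => by simp [ae_iff]
  filter_upwards [S.yg, fin 1, fin (-1)] with y hy h1 h2
  by_cases hyI : y ∈ Ioo (-1:ℝ) 1
  · have hyg := hy hyI
    filter_upwards [hR y hyg, fin 1, fin (-1)] with x hx a1 a2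
    by_cases hxI : x ∈ Ioo (-1:ℝ) 1
    · rw [hx hxI, hGe hyg]
      have : (x, y) ∈ Isq := mem_Isq_iff.2 ⟨⟨hxI.1.le, hyI.1.le⟩, hxI.2.le, hyI.2.le⟩
      simp [this]
    · have : (x, y) ∉ Isq := fun h => by
        have := mem_Isq_iff.1 h
        exact hxI ⟨lt_of_le_of_ne this.1.1 (Ne.symm a2), lt_of_le_of_ne this.2.1 a1⟩
      exact ⟨fun h => absurd (S.hEs h) this, fun h => absurd h.1 this⟩
  · refine Eventually.of_forall fun x => ?_
    have : (x, y) ∉ Isq := fun h => by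
        have := mem_Isq_iff.1 h
        exact hyI ⟨lt_of_le_of_ne this.1.2 (Ne.symm h2), lt_of_le_of_ne this.2.2 h1⟩
    exact ⟨fun h => absurd (S.hEs h) this, fun h => absurd h.1 this⟩

end


noncomputable section
open scoped Topology

/-- graph type set -/
def gset (G : ℝ → ℝ) (t : ℝ) : Set (ℝ × ℝ) := {z | z ∈ Isq ∧ t * z.1 ≤ G z.2}

theorem limit_graph {v : ℕ → ℝ × ℝ → ℝ} (hv : ∀ n, ContDiff ℝ 1 (v n)) {E : Set (ℝ × ℝ)}
    (hE : MeasurableSet E) (hEs : E ⊆ Isq) (hvol : volume E = 2) (hconv : ConvE v E)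
    (hen : liminf (fun n => ∫⁻ z in Isq, gm (v n) z) atTop ≤ 2) :
    ∃ G : ℝ → ℝ, LipschitzWith 1 G ∧ (∀ y ∈ Icc (-1:ℝ) 1, G y ∈ Icc (-1:ℝ) 1) ∧
      (∀ y ∈ Ioo (-1:ℝ) 1, G y ∈ Ioo (-1:ℝ) 1) ∧
      ∃ t : ℝ, (t = 1 ∨ t = -1) ∧ ((∀ᵐ z : ℝ × ℝ, (z ∈ E ↔ z ∈ gset G t)) ∨
        (∀ᵐ z : ℝ × ℝ, (z ∈ E ↔ z ∈ swapS (gset G t)))) := by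
  rcases dichotomy hv hE hEs hvol hconv hen with h | h
  · obtain ⟨G, h1, h2, h3, t, ht, h4⟩ := Setup.graph (v := v) (E := E) ⟨hv, hE, hEs, hvol, hconv, hen, h⟩
    exact ⟨G, h1, h2, h3, t, ht, Or.inl h4⟩
  · have hen' : liminf (fun n => ∫⁻ z in Isq, gm (fun z => v n (z.2, z.1)) z) atTop ≤ 2 := by
      refine le_trans (le_of_eq ?_) hen
      congr 1; ext n
      have hs : (fun z : ℝ × ℝ => (z.2, z.1)) ⁻¹' Isq = Isq := by
        ext z; simp only [mem_preimage, mem_Isq_iff]; tauto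
      rw [← swap_mp.setLIntegral_comp_preimage Isq_meas (gm_cont (hv n)).measurable, hs]
      exact lintegral_congr fun z => swap_gm (hv n) z
    obtain ⟨G, h1, h2, h3, t, ht, h4⟩ := Setup.graph (v := fun n z => v n (z.2, z.1)) (E := swapS E)
      ⟨fun n => swap_contDiff (hv n), swapS_meas hE, swapS_sub hEs, (swapS_vol hE).trans hvol, hconv.swap, hen', h⟩
    refine ⟨G, h1, h2, h3, t, ht, Or.inr ?_⟩
    exact swap_mp.quasiMeasurePreserving.ae h4


theorem eNorm2_le (v : ℝ × ℝ) : eNorm2 v ≤ |v.1| + |v.2| := by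
  unfold eNorm2
  rw [Real.sqrt_le_left (by positivity)]
  nlinarith [abs_nonneg v.1, abs_nonneg v.2, sq_abs v.1, sq_abs v.2, mul_nonneg (abs_nonneg v.1) (abs_nonneg v.2)]

theorem IsRectJordanCurve.image {C : Set (ℝ × ℝ)} (hC : IsRectJordanCurve C) {φ : ℝ × ℝ → ℝ × ℝ}
    (hφ : Continuous φ) (hi : Function.Injective φ) {K : ℝ} (hK : 0 ≤ K)
    (hl : ∀ z w, eNorm2 (φ z - φ w) ≤ K * eNorm2 (z - w)) : IsRectJordanCurve (φ '' C) := by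
  obtain ⟨γ, h1, h2, h3, h4, h5⟩ := hC
  refine ⟨φ ∘ γ, hφ.comp h1, fun t => by simp [h2], (hi.comp_injOn h3), by rw [h4, image_comp], ?_⟩
  have : varLength eNorm2 (φ ∘ γ) ≤ ENNReal.ofReal K * varLength eNorm2 γ := by
    unfold varLength
    refine iSup_le fun n => iSup_le fun t => iSup_le fun ht => ?_
    calc _ ≤ ENNReal.ofReal (K * ∑ i : Fin n, eNorm2 (γ (t i.succ) - γ (t i.castSucc))) := by
          apply ENNReal.ofReal_le_ofReal
          rw [Finset.mul_sum]
          exact Finset.sum_le_sum fun i _ => hl _ _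
      _ = ENNReal.ofReal K * ENNReal.ofReal (∑ i : Fin n, eNorm2 (γ (t i.succ) - γ (t i.castSucc))) :=
          ENNReal.ofReal_mul hK
      _ ≤ _ := by
          gcongr
          exact le_iSup_of_le n (le_iSup_of_le t (le_iSup_of_le ht le_rfl))
  exact (this.trans_lt (ENNReal.mul_lt_top ofReal_lt_top (lt_top_iff_ne_top.2 h5))).ne

theorem rect_of_lip {P : ℝ → ℝ × ℝ} {L K : ℝ} (hL : 0 < L) (hPc : Continuous P)
    (hP : ∀ s r, s ≤ r → eNorm2 (P r - P s) ≤ K * (r - s)) (hend : P 0 = P L) (hinj : InjOn P (Ico 0 L)) :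
    IsRectJordanCurve (P '' Icc 0 L) := by
  have e : ∀ t ∈ Icc (0:ℝ) 1, P (L * Int.fract t) = P (L * t) := by
    intro t ht
    rcases ht.2.lt_or_eq with h | h
    · rw [Int.fract_eq_self.2 ⟨ht.1, h⟩]
    · rw [h]; simp [hend]
  refine ⟨fun t => P (L * Int.fract t), ?_, fun t => by simp, ?_, ?_, ?_⟩
  · have := ContinuousOn.comp_fract'' (f := fun t => P (L * t)) (by fun_prop) (by simp [hend])
    exact this
  · intro s hs r hr h
    simp only [Int.fract_eq_self.2 ⟨hs.1, hs.2⟩, Int.fract_eq_self.2 ⟨hr.1, hr.2⟩] at h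
    have := hinj ⟨mul_nonneg hL.le hs.1, by nlinarith [hs.2]⟩ ⟨mul_nonneg hL.le hr.1, by nlinarith [hr.2]⟩ h
    exact mul_left_cancel₀ hL.ne' this
  · ext z
    constructor
    · rintro ⟨s, hs, rfl⟩
      have hI : s / L ∈ Icc (0:ℝ) 1 := ⟨div_nonneg hs.1 hL.le, (div_le_one hL).2 hs.2⟩
      refine ⟨s / L, hI, ?_⟩
      simp only [e _ hI]
      rw [mul_div_cancel₀ _ hL.ne']
    · rintro ⟨t, ht, rfl⟩
      simp only [e _ ht]
      exact ⟨L * t, ⟨mul_nonneg hL.le ht.1, by nlinarith [ht.2]⟩, rfl⟩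
  · refine ne_top_of_le_ne_top (b := ENNReal.ofReal (K * L)) ofReal_ne_top ?_
    unfold varLength
    refine iSup_le fun n => iSup_le fun t => iSup_le fun ht => ?_
    apply ENNReal.ofReal_le_ofReal
    obtain ⟨hm, h0, h1⟩ := ht
    have hI : ∀ i, t i ∈ Icc (0:ℝ) 1 := fun i => ⟨h0 ▸ hm (Fin.zero_le i), h1 ▸ hm (Fin.le_last i)⟩
    calc _ ≤ ∑ i : Fin n, K * L * (t i.succ - t i.castSucc) := by
          refine Finset.sum_le_sum fun i _ => ?_
          simp only [e _ (hI _)]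
          refine (hP _ _ (mul_le_mul_of_nonneg_left (hm i.castSucc_le_succ) hL.le)).trans (le_of_eq (by ring))
      _ = K * L := by
          have a1 := Fin.sum_univ_succ t
          have a2 := Fin.sum_univ_castSucc t
          rw [← Finset.mul_sum, Finset.sum_sub_distrib]
          have : ∑ i : Fin n, t i.succ - ∑ i : Fin n, t i.castSucc = 1 := by
            rw [h0] at a1; rw [h1] at a2; linarith
          rw [this, mul_one]

/-- a set whose boundary is a single rectifiable Jordan curve -/
structure Nice (R : Set (ℝ × ℝ)) : Prop where
  comp : IsCompact R
  sub : R ⊆ Isq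
  int : (interior R).Nonempty
  jor : IsRectJordanCurve (frontier R)
  reg : R ⊆ closure (interior R)

theorem Nice.image {R : Set (ℝ × ℝ)} (h : Nice R) (φ : ℝ × ℝ ≃ₜ ℝ × ℝ)
    (hl : ∀ z w, eNorm2 (φ z - φ w) ≤ eNorm2 (z - w)) (hI : ∀ z ∈ Isq, φ z ∈ Isq) : Nice (φ '' R) := by
  refine ⟨h.comp.image φ.continuous, ?_, ?_, ?_, ?_⟩
  · rintro _ ⟨z, hz, rfl⟩; exact hI z (h.sub hz)
  · rw [← φ.image_interior]; exact h.int.image _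
  · rw [← φ.image_frontier]
    exact h.jor.image φ.continuous φ.injective (K := 1) zero_le_one (by simpa using hl)
  · rw [← φ.image_interior, ← φ.image_closure]; exact image_mono h.reg

theorem Isq_compact : IsCompact Isq := by unfold Isq; exact isCompact_Icc

section curve
variable (G : ℝ → ℝ)

/-- clamp -/
def clm (x : ℝ) : ℝ := max (-1) (min x 1)

/-- boundary parametrisation -/
def bdP (σ : ℝ) : ℝ × ℝ :=
  (G (clm (σ - (G (-1) + 1) - 1)) - max 0 ((G (-1) + 1) - σ)
      - max 0 (min σ (G (-1) + 1 + 2 + (G 1 + 1)) - (G (-1) + 1) - 2),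
    clm (σ - (G (-1) + 1) - 1) - max 0 (σ - (G (-1) + 1 + 2 + (G 1 + 1))))

theorem bdP1 {a : ℝ} (ha : a = G (-1) + 1) (h1 : 0 ≤ G 1 + 1) {σ : ℝ} (h : σ ≤ a) :
    bdP G σ = (σ - 1, -1) := by
  unfold bdP clm
  rw [← ha, max_eq_left (a := (-1:ℝ)) (by rw [min_eq_left] <;> linarith), max_eq_right (a := (0:ℝ)) (b := a - σ) (by linarith),
    min_eq_left (b := a + 2 + (G 1 + 1)) (by linarith), max_eq_left (by linarith), max_eq_left (by linarith)]
  ext <;> simp; linarith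

theorem bdP2 {a : ℝ} (ha : a = G (-1) + 1) (h1 : 0 ≤ G 1 + 1) {σ : ℝ} (h : a ≤ σ) (h' : σ ≤ a + 2) :
    bdP G σ = (G (σ - a - 1), σ - a - 1) := by
  unfold bdP clm
  rw [← ha, min_eq_left (a := σ - a - 1) (by linarith), max_eq_right (a := (-1:ℝ)) (by linarith),
    max_eq_left (a := (0:ℝ)) (b := a - σ) (by linarith),
    min_eq_left (b := a + 2 + (G 1 + 1)) (by linarith), max_eq_left (by linarith), max_eq_left (by linarith)]
  ext <;> simp

theorem bdP3 {a : ℝ} (ha : a = G (-1) + 1) {b : ℝ} (hb : b = G 1 + 1) {σ : ℝ} (h : a + 2 ≤ σ) (h' : σ ≤ a + 2 + b) :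
    bdP G σ = (a + 2 + b - 1 - σ, 1) := by
  unfold bdP clm
  rw [← ha, ← hb, min_eq_right (a := σ - a - 1) (by linarith), max_eq_right (a := (-1:ℝ)) (by linarith),
    max_eq_left (a := (0:ℝ)) (b := a - σ) (by linarith),
    min_eq_left (b := a + 2 + b) (by linarith), max_eq_right (by linarith), max_eq_left (by linarith)]
  ext <;> simp; linarith

theorem bdP4 {a : ℝ} (ha : a = G (-1) + 1) {b : ℝ} (hb : b = G 1 + 1) (hb0 : 0 ≤ b) {σ : ℝ} (h : a + 2 + b ≤ σ) :
    bdP G σ = (-1, 1 - σ + (a + 2 + b)) := by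
  unfold bdP clm
  rw [← ha, ← hb, min_eq_right (a := σ - a - 1) (by linarith), max_eq_right (a := (-1:ℝ)) (by linarith),
    max_eq_left (a := (0:ℝ)) (b := a - σ) (by linarith),
    min_eq_right (b := a + 2 + b) (by linarith), max_eq_right (by linarith), max_eq_right (by linarith)]
  ext <;> simp <;> linarith

end curve

theorem gset_interior {G : ℝ → ℝ} (hG : Continuous G) :
    interior (gset G 1) = {z | (-1 < z.1 ∧ z.1 < G z.2) ∧ (-1 < z.2 ∧ z.2 < 1) ∧ z.1 < 1} := by
  apply Subset.antisymm
  · intro z hz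
    rw [mem_interior_iff_mem_nhds, Metric.mem_nhds_iff] at hz
    obtain ⟨r, hr, hb⟩ := hz
    have key : ∀ u w : ℝ, |u| ≤ r / 2 → |w| ≤ r / 2 → (z.1 + u, z.2 + w) ∈ gset G 1 := by
      intro u w hu hw
      apply hb
      rw [Metric.mem_ball, Prod.dist_eq, max_lt_iff, Real.dist_eq, Real.dist_eq]
      constructor <;> simp <;> linarith
    have hr2 : |r / 2| ≤ r / 2 := (abs_of_pos (by linarith)).le
    have hr2' : |-(r / 2)| ≤ r / 2 := by rw [abs_neg]; exact hr2
    have hr0 : |(0:ℝ)| ≤ r / 2 := by simp; linarith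
    obtain ⟨a1, a2⟩ := key (r/2) 0 hr2 hr0
    obtain ⟨b1, b2⟩ := key (-(r/2)) 0 hr2' hr0
    obtain ⟨c1, c2⟩ := key 0 (r/2) hr0 hr2
    obtain ⟨d1, d2⟩ := key 0 (-(r/2)) hr0 hr2'
    rw [mem_Isq_iff] at a1 b1 c1 d1
    simp only [add_zero, one_mul] at *
    refine ⟨⟨?_, ?_⟩, ⟨?_, ?_⟩, ?_⟩ <;> linarith
  · apply interior_maximal
    · rintro z ⟨⟨h1, h2⟩, ⟨h3, h4⟩, h5⟩
      refine ⟨mem_Isq_iff.2 ⟨⟨h1.le, h3.le⟩, h5.le, h4.le⟩, by rw [one_mul]; exact h2.le⟩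
    · refine IsOpen.inter (IsOpen.inter ?_ ?_) (IsOpen.inter (IsOpen.inter ?_ ?_) ?_)
      · exact isOpen_lt continuous_const continuous_fst
      · exact isOpen_lt continuous_fst (hG.comp continuous_snd)
      · exact isOpen_lt continuous_const continuous_snd
      · exact isOpen_lt continuous_snd continuous_const
      · exact isOpen_lt continuous_fst continuous_const

theorem gset_closed {G : ℝ → ℝ} (hG : Continuous G) (t : ℝ) : IsClosed (gset G t) :=
  IsClosed.inter Isq_compact.isClosed (isClosed_le (by fun_prop) (hG.comp continuous_snd))

theorem gset_nice1 {G : ℝ → ℝ} (hG : LipschitzWith 1 G) (hI : ∀ y ∈ Icc (-1:ℝ) 1, G y ∈ Icc (-1:ℝ) 1)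
    (hO : ∀ y ∈ Ioo (-1:ℝ) 1, G y ∈ Ioo (-1:ℝ) 1) : Nice (gset G 1) := by
  have hGc := hG.continuous
  have hl : ∀ y w, |G y - G w| ≤ |y - w| := fun y w => by simpa [Real.dist_eq] using hG.dist_le_mul y w
  have hcl := gset_closed hGc 1
  have hinr := gset_interior hGc
  have hsub : gset G 1 ⊆ Isq := fun z h => h.1
  refine ⟨Isq_compact.of_isClosed_subset hcl hsub, hsub, ?_, ?_, ?_⟩
  · rw [hinr]
    have := hO 0 (by norm_num)
    refine ⟨((G 0 - 1) / 2, 0), ⟨?_, ?_⟩, ⟨?_, ?_⟩, ?_⟩ <;> simp only <;> linarith [this.1, this.2]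
  · obtain ⟨a, ha⟩ : ∃ a, a = G (-1) + 1 := ⟨_, rfl⟩
    obtain ⟨b, hb⟩ : ∃ b, b = G 1 + 1 := ⟨_, rfl⟩
    have ha0 : 0 ≤ a := by have := (hI (-1) (by norm_num)).1; linarith
    have hb0 : 0 ≤ b := by have := (hI 1 (by norm_num)).1; linarith
    have hb0' : 0 ≤ G 1 + 1 := hb ▸ hb0
    have e1 := fun σ (h : σ ≤ a) => bdP1 G ha hb0' h
    have e2 := fun σ (h : a ≤ σ) (h' : σ ≤ a + 2) => bdP2 G ha hb0' h h'
    have e3 := fun σ (h : a + 2 ≤ σ) (h' : σ ≤ a + 2 + b) => bdP3 G ha hb h h'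
    have e4 := fun σ (h : a + 2 + b ≤ σ) => bdP4 G ha hb hb0 h
    have himg : frontier (gset G 1) = bdP G '' Icc 0 (a + 2 + b + 2) := by
      rw [hcl.frontier_eq, hinr]
      ext z
      constructor
      · rintro ⟨⟨hz, hzG⟩, hn⟩
        obtain ⟨⟨h1, h2⟩, h3, h4⟩ := mem_Isq_iff.1 hz
        rw [one_mul] at hzG
        by_cases c1 : z.1 = -1
        · refine ⟨a + 2 + b + 1 - z.2, ⟨by linarith, by linarith⟩, ?_⟩
          rw [e4 _ (by linarith)]
          ext <;> simp [c1]; ring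
        by_cases c2 : z.2 = -1
        · have := hzG; rw [c2] at this
          refine ⟨z.1 + 1, ⟨by linarith, by linarith⟩, ?_⟩
          rw [e1 _ (by linarith)]
          ext <;> simp [c2]
        by_cases c3 : z.2 = 1
        · have := hzG; rw [c3] at this
          refine ⟨a + 2 + b - 1 - z.1, ⟨by linarith, by linarith⟩, ?_⟩
          rw [e3 _ (by linarith) (by linarith)]
          ext <;> simp [c3]
        have h1' := lt_of_le_of_ne h1 (Ne.symm c1)
        have h2' := lt_of_le_of_ne h2 (Ne.symm c2)
        have h4' := lt_of_le_of_ne h4 c3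
        have hGz := hO z.2 ⟨h2', h4'⟩
        have hxG : z.1 = G z.2 := by
          by_contra hne
          exact hn ⟨⟨h1', lt_of_le_of_ne hzG hne⟩, ⟨h2', h4'⟩, by linarith [hGz.2]⟩
        refine ⟨z.2 + a + 1, ⟨by linarith, by linarith⟩, ?_⟩
        rw [e2 _ (by linarith) (by linarith), show z.2 + a + 1 - a - 1 = z.2 by ring, ← hxG]
      · rintro ⟨σ, ⟨hs0, hs1⟩, rfl⟩
        rcases le_total σ a with h | h
        · rw [e1 σ h]
          have := hI (-1) (by norm_num)
          refine ⟨⟨mem_Isq_iff.2 ⟨⟨?_, ?_⟩, ?_, ?_⟩, ?_⟩, fun hn => ?_⟩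
          · simp only; linarith
          · simp
          · simp only; linarith [this.2]
          · simp
          · simp only; linarith
          · exact lt_irrefl _ hn.2.1.1
        rcases le_total σ (a + 2) with h' | h'
        · rw [e2 σ h h']
          have := hI (σ - a - 1) ⟨by linarith, by linarith⟩
          refine ⟨⟨mem_Isq_iff.2 ⟨⟨this.1, ?_⟩, this.2, ?_⟩, ?_⟩, fun hn => ?_⟩
          · simp only; linarith
          · simp only; linarith
          · simp
          · exact lt_irrefl _ hn.1.2
        rcases le_total σ (a + 2 + b) with h'' | h''
        · rw [e3 σ h' h'']
          have := hI 1 (by norm_num)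
          refine ⟨⟨mem_Isq_iff.2 ⟨⟨?_, ?_⟩, ?_, ?_⟩, ?_⟩, fun hn => ?_⟩
          · simp only; linarith
          · simp
          · simp only; linarith [this.2]
          · simp
          · simp only; linarith
          · exact lt_irrefl _ hn.2.1.2
        · rw [e4 σ h'']
          have := hI (1 - σ + (a + 2 + b)) ⟨by linarith, by linarith⟩
          refine ⟨⟨mem_Isq_iff.2 ⟨⟨?_, ?_⟩, ?_, ?_⟩, ?_⟩, fun hn => ?_⟩
          · simp
          · simp only; linarith
          · simp
          · simp only; linarith
          · simp only; linarith [this.1]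
          · exact lt_irrefl _ hn.1.1
    rw [himg]
    have hclm : ∀ x y : ℝ, |clm x - clm y| ≤ |x - y| := fun x y => by
      unfold clm
      exact (abs_max_sub_max_le_max _ _ _ _).trans (by
        rw [sub_self, abs_zero, max_eq_right (abs_nonneg _)]
        refine (abs_min_sub_min_le_max _ _ _ _).trans ?_
        rw [sub_self, abs_zero, max_eq_left (abs_nonneg _)])
    refine rect_of_lip (K := 5) (by linarith) ?_ ?_ ?_ ?_
    · unfold bdP clm; fun_prop
    · intro s r hsr
      refine (eNorm2_le _).trans ?_
      have hm : ∀ x y : ℝ, |max 0 x - max 0 y| ≤ |x - y| := fun x y => by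
        refine (abs_max_sub_max_le_max _ _ _ _).trans ?_
        rw [sub_self, abs_zero, max_eq_right (abs_nonneg _)]
      have hn : ∀ x y c : ℝ, |min x c - min y c| ≤ |x - y| := fun x y c => by
        refine (abs_min_sub_min_le_max _ _ _ _).trans ?_
        rw [sub_self, abs_zero, max_eq_left (abs_nonneg _)]
      unfold bdP
      rw [← ha, ← hb]
      have hrs : |r - s| = r - s := abs_of_nonneg (by linarith)
      have b1 := hclm (r - a - 1) (s - a - 1)
      have b2 := hl (clm (r - a - 1)) (clm (s - a - 1))
      have b3 := hm (a - r) (a - s)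
      have b4 := hm (min r (a + 2 + b) - a - 2) (min s (a + 2 + b) - a - 2)
      have b5 := hn r s (a + 2 + b)
      have b6 := hm (r - (a + 2 + b)) (s - (a + 2 + b))
      rw [show r - a - 1 - (s - a - 1) = r - s by ring, hrs] at b1
      rw [show a - r - (a - s) = -(r - s) by ring, abs_neg, hrs] at b3
      rw [show min r (a + 2 + b) - a - 2 - (min s (a + 2 + b) - a - 2) = min r (a + 2 + b) - min s (a + 2 + b) by ring] at b4
      rw [hrs] at b5
      rw [show r - (a + 2 + b) - (s - (a + 2 + b)) = r - s by ring, hrs] at b6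
      simp only [Prod.fst_sub, Prod.snd_sub]
      have c1 : |G (clm (r - a - 1)) - max 0 (a - r) - max 0 (min r (a + 2 + b) - a - 2) -
          (G (clm (s - a - 1)) - max 0 (a - s) - max 0 (min s (a + 2 + b) - a - 2))| ≤ 3 * (r - s) := by
        have b2' := abs_le.1 (b2.trans b1)
        have b3' := abs_le.1 b3
        have b4' := abs_le.1 (b4.trans b5)
        rw [abs_le]
        constructor <;> linarith [b2'.1, b2'.2, b3'.1, b3'.2, b4'.1, b4'.2]
      have c2 : |clm (r - a - 1) - max 0 (r - (a + 2 + b)) - (clm (s - a - 1) - max 0 (s - (a + 2 + b)))| ≤ 2 * (r - s) := by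
        rw [abs_le] at *
        constructor <;> linarith [b1.1, b1.2, b6.1, b6.2]
      linarith
    · rw [e1 0 ha0, e4 _ (by linarith)]
      ext <;> simp; ring
    · have hinj : ∀ s r, 0 ≤ s → s < r → r < a + 2 + b + 2 → bdP G s ≠ bdP G r := by
        intro s r hs hsr hr heq
        rcases le_total r a with q1 | q1
        · rw [e1 s (by linarith), e1 r q1, Prod.mk.injEq] at heq; linarith [heq.1]
        rcases le_total r (a + 2) with q2 | q2
        · rw [e2 r q1 q2] at heq
          rcases le_total s a with p1 | p1
          · rw [e1 s p1, Prod.mk.injEq] at heq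
            have : r = a := by linarith [heq.2]
            have := heq.1
            rw [show r - a - 1 = -1 by linarith] at this
            linarith
          · rw [e2 s p1 (by linarith), Prod.mk.injEq] at heq; linarith [heq.2]
        rcases le_total r (a + 2 + b) with q3 | q3
        · rw [e3 r q2 q3] at heq
          rcases le_total s a with p1 | p1
          · rw [e1 s p1, Prod.mk.injEq] at heq; linarith [heq.2]
          rcases le_total s (a + 2) with p2 | p2
          · rw [e2 s p1 p2, Prod.mk.injEq] at heq
            have h1 : s - a - 1 = 1 := heq.2
            have h2 := heq.1
            rw [h1] at h2; linarith
          · rw [e3 s p2 (by linarith), Prod.mk.injEq] at heq; linarith [heq.1]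
        · rw [e4 r q3] at heq
          rcases le_total s a with p1 | p1
          · rw [e1 s p1, Prod.mk.injEq] at heq; linarith [heq.2]
          rcases le_total s (a + 2) with p2 | p2
          · rw [e2 s p1 p2, Prod.mk.injEq] at heq
            obtain ⟨h1, h2⟩ := heq
            rcases eq_or_lt_of_le p2 with p3 | p3
            · rw [show s - a - 1 = 1 by linarith] at h1
              linarith
            · have := hO (s - a - 1) ⟨by linarith, by linarith⟩
              linarith [this.1]
          rcases le_total s (a + 2 + b) with p3 | p3
          · rw [e3 s p2 p3, Prod.mk.injEq] at heq
            linarith [heq.1, heq.2]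
          · rw [e4 s p3, Prod.mk.injEq] at heq; linarith [heq.2]
      intro s hs r hr heq
      rcases lt_trichotomy s r with h | h | h
      · exact absurd heq (hinj s r hs.1 h hr.2)
      · exact h
      · exact absurd heq.symm (hinj r s hr.1 h hs.2)
  · rintro z ⟨hz, hzG⟩
    obtain ⟨⟨h1, h2⟩, h3, h4⟩ := mem_Isq_iff.1 hz
    rw [one_mul] at hzG
    rw [Metric.mem_closure_iff]
    intro ε hε
    obtain ⟨y, hy1, hy2⟩ := exists_between (show max (-1) (z.2 - ε / 4) < min 1 (z.2 + ε / 4) from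
      max_lt (lt_min (by norm_num) (by linarith)) (lt_min (by linarith) (by linarith)))
    rw [max_lt_iff] at hy1
    rw [lt_min_iff] at hy2
    have hGy := hO y ⟨hy1.1, hy2.1⟩
    have hyz : |y - z.2| ≤ ε / 4 := by rw [abs_le]; constructor <;> linarith
    have := (abs_le.1 ((hl y z.2).trans hyz)).1
    obtain ⟨x, hx1, hx2⟩ := exists_between (show max (-1) (z.1 - ε / 2) < min (G y) (z.1 + ε / 2) from
      max_lt (lt_min hGy.1 (by linarith)) (lt_min (by linarith) (by linarith)))
    rw [max_lt_iff] at hx1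
    rw [lt_min_iff] at hx2
    refine ⟨(x, y), ?_, ?_⟩
    · rw [hinr]
      exact ⟨⟨hx1.1, hx2.1⟩, ⟨hy1.1, hy2.1⟩, by linarith [hGy.2]⟩
    · rw [Prod.dist_eq, max_lt_iff, Real.dist_eq, Real.dist_eq, abs_lt, abs_lt]
      refine ⟨⟨?_, ?_⟩, ?_, ?_⟩ <;> simp only <;> linarith

/-- reflection homeomorphism -/
def reflH : ℝ × ℝ ≃ₜ ℝ × ℝ := (Homeomorph.neg ℝ).prodCongr (Homeomorph.refl ℝ)

theorem gset_nice {G : ℝ → ℝ} (hG : LipschitzWith 1 G) (hI : ∀ y ∈ Icc (-1:ℝ) 1, G y ∈ Icc (-1:ℝ) 1)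
    (hO : ∀ y ∈ Ioo (-1:ℝ) 1, G y ∈ Ioo (-1:ℝ) 1) {t : ℝ} (ht : t = 1 ∨ t = -1) : Nice (gset G t) := by
  have h1 := gset_nice1 hG hI hO
  rcases ht with rfl | rfl
  · exact h1
  · have := h1.image reflH (fun z w => by
        simp [reflH, eNorm2]
        apply le_of_eq; congr 1; ring) (fun z hz => by
        have := mem_Isq_iff.1 hz
        rw [mem_Isq_iff]
        simp [reflH]
        refine ⟨⟨?_, ?_⟩, ?_, ?_⟩ <;> linarith [this.1.1, this.1.2, this.2.1, this.2.2])
    convert this using 1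
    ext z
    constructor
    · rintro ⟨hz, hz2⟩
      have := mem_Isq_iff.1 hz
      refine ⟨(-z.1, z.2), ⟨?_, by simpa using hz2⟩, by simp [reflH]⟩
      rw [mem_Isq_iff]
      refine ⟨⟨?_, ?_⟩, ?_, ?_⟩ <;> simp only <;> linarith [this.1.1, this.1.2, this.2.1, this.2.2]
    · rintro ⟨z, ⟨hz, hz2⟩, rfl⟩
      have := mem_Isq_iff.1 hz
      refine ⟨?_, by simpa [reflH] using hz2⟩
      rw [mem_Isq_iff]
      refine ⟨⟨?_, ?_⟩, ?_, ?_⟩ <;> simp [reflH] <;> linarith [this.1.1, this.1.2, this.2.1, this.2.2]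

theorem Nice.swap {R : Set (ℝ × ℝ)} (h : Nice R) : Nice (swapS R) := by
  have := h.image (Homeomorph.prodComm ℝ ℝ) (fun z w => by
        simp [eNorm2]
        apply le_of_eq; congr 1; ring) (fun z hz => by
        have := mem_Isq_iff.1 hz
        rw [mem_Isq_iff]
        exact ⟨⟨this.1.2, this.1.1⟩, this.2.2, this.2.1⟩)
  convert this using 1
  ext z
  constructor
  · intro hz; exact ⟨(z.2, z.1), hz, rfl⟩
  · rintro ⟨z, hz, rfl⟩; exact hz

end


noncomputable section
open scoped Topology

/-- explicit convolution -/
def cv (a ρ : ℝ × ℝ → ℝ) (x : ℝ × ℝ) : ℝ := ∫ t, a t * ρ (x - t)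

theorem cv_eq (a ρ : ℝ × ℝ → ℝ) : cv a ρ = convolution a ρ (ContinuousLinearMap.lsmul ℝ ℝ) volume := by
  ext x; simp [cv, convolution_def]

theorem cv_contDiff {a ρ : ℝ × ℝ → ℝ} {n : ℕ∞} (ha : LocallyIntegrable a) (hρ : ContDiff ℝ n ρ)
    (hc : HasCompactSupport ρ) : ContDiff ℝ n (cv a ρ) := by
  rw [cv_eq]; exact hc.contDiff_convolution_right _ ha hρ

theorem cv_fderiv {a ρ : ℝ × ℝ → ℝ} (ha : LocallyIntegrable a) (hρ : ContDiff ℝ 1 ρ)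
    (hc : HasCompactSupport ρ) (x e : ℝ × ℝ) :
    fderiv ℝ (cv a ρ) x e = cv a (fun z => fderiv ℝ ρ z e) x := by
  rw [cv_eq, cv_eq]
  rw [(hc.hasFDerivAt_convolution_right (ContinuousLinearMap.lsmul ℝ ℝ) ha hρ x).fderiv]
  exact convolution_precompR_apply _ ha (hc.fderiv ℝ) (hρ.continuous_fderiv (by simp)) x e

theorem fderiv_even {ρ : ℝ × ℝ → ℝ} (hρ : ContDiff ℝ 1 ρ) (he : ∀ x, ρ (-x) = ρ x) (x e : ℝ × ℝ) :
    fderiv ℝ ρ (-x) e = - fderiv ℝ ρ x e := by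
  have h1 : fderiv ℝ (fun x => ρ (-x)) x e = - fderiv ℝ ρ (-x) e := by
    have hd := (hρ.differentiable (by simp) (-x)).hasFDerivAt
    have := hd.comp x (hasFDerivAt_id x).neg
    have h3 : fderiv ℝ (fun x => ρ (-x)) x = _ := this.fderiv
    rw [h3]; simp
  have h2 : (fun x => ρ (-x)) = ρ := funext he
  rw [h2] at h1; linarith

theorem cv_fubini {h k m : ℝ × ℝ → ℝ} (hh : Integrable h) (hk : Integrable k) (hm : Continuous m)
    (hc : HasCompactSupport m) (ho : ∀ x, m (-x) = - m x) :
    ∫ x, h x * cv k m x = - ∫ t, k t * cv h m t := by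
  have hinr : Integrable (fun p : (ℝ × ℝ) × (ℝ × ℝ) => h p.1 * (k p.2 * m (p.1 - p.2)))
      (volume.prod volume) := by
    obtain ⟨C, hC⟩ := hc.exists_bound_of_continuous hm
    have h1 : Integrable (fun p : (ℝ × ℝ) × (ℝ × ℝ) => h p.1 * k p.2) (volume.prod volume) :=
      hh.mul_prod hk
    have h2 := h1.bdd_mul (c := C) (f := fun p : (ℝ × ℝ) × (ℝ × ℝ) => m (p.1 - p.2))
      (by fun_prop) (ae_of_all _ fun p => hC _)
    refine h2.congr (ae_of_all _ fun p => ?_)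
    simp only; ring
  have e1 : ∫ x, h x * cv k m x = ∫ x, ∫ t, h x * (k t * m (x - t)) := by
    congr 1; ext x; rw [cv, integral_const_mul]
  rw [e1, integral_integral_swap hinr, ← integral_neg]
  congr 1; ext t
  rw [cv, ← integral_const_mul, ← integral_neg]
  congr 1; ext x
  have := ho (x - t)
  rw [neg_sub] at this
  rw [this]; ring

theorem cv_abs_le {a ρ : ℝ × ℝ → ℝ} (x : ℝ × ℝ) (hρ0 : ∀ x, 0 ≤ ρ x) :
    |cv a ρ x| ≤ ∫ t, |a t| * ρ (x - t) := by
  unfold cv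
  refine (abs_integral_le_integral_abs).trans (le_of_eq ?_)
  congr 1; ext t; rw [abs_mul, abs_of_nonneg (hρ0 _)]

theorem cv_integrable {a ρ : ℝ × ℝ → ℝ} (ha : Integrable a) (hρ : Continuous ρ)
    (hc : HasCompactSupport ρ) (x : ℝ × ℝ) : Integrable (fun t => a t * ρ (x - t)) := by
  obtain ⟨C, hC⟩ := hc.exists_bound_of_continuous hρ
  have := ha.bdd_mul (c := C) (f := fun t => ρ (x - t)) (by fun_prop) (ae_of_all _ fun p => hC _)
  exact this.congr (ae_of_all _ fun t => mul_comm _ _)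

theorem int_shift {ρ : ℝ × ℝ → ℝ} (x : ℝ × ℝ) : ∫ t, ρ (x - t) = ∫ t, ρ t :=
  integral_sub_left_eq_self ρ volume x

/-- sum of absolute values bounded -/
theorem cv_abs_sum {a b ρ : ℝ × ℝ → ℝ} (ha : Integrable a) (hb : Integrable b)
    (hρ : Continuous ρ) (hc : HasCompactSupport ρ) (hρ0 : ∀ x, 0 ≤ ρ x) (hρ1 : ∫ x, ρ x = 1)
    (hab : ∀ t, |a t| + |b t| ≤ 1) (x : ℝ × ℝ) : |cv a ρ x| + |cv b ρ x| ≤ 1 := by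
  refine (add_le_add (cv_abs_le x hρ0) (cv_abs_le x hρ0)).trans ?_
  rw [← integral_add (cv_integrable ha.abs hρ hc x) (cv_integrable hb.abs hρ hc x)]
  refine le_trans ?_ ((int_shift (ρ := ρ) x).trans hρ1).le
  have hi : Integrable (fun t => ρ (x - t)) :=
    (hρ.integrable_of_hasCompactSupport hc).comp_sub_left x
  refine integral_mono ((cv_integrable ha.abs hρ hc x).add (cv_integrable hb.abs hρ hc x)) hi ?_
  intro t
  simp only
  nlinarith [hab t, hρ0 (x - t)]

theorem cv_mem {R : Set (ℝ × ℝ)} {ρ : ℝ × ℝ → ℝ} (hR : MeasurableSet R) (hv : volume R ≠ ⊤)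
    (hρ : Continuous ρ) (hc : HasCompactSupport ρ) (hρ0 : ∀ x, 0 ≤ ρ x) (hρ1 : ∫ x, ρ x = 1)
    (x : ℝ × ℝ) : 0 ≤ cv (R.indicator fun _ => (1:ℝ)) ρ x ∧ cv (R.indicator fun _ => (1:ℝ)) ρ x ≤ 1 := by
  have h1 : Integrable (R.indicator fun _ => (1:ℝ)) := (integrable_indicator_iff hR).2
    (integrableOn_const hv)
  have h0 : ∀ t, 0 ≤ R.indicator (fun _ => (1:ℝ)) t := fun t => indicator_nonneg (by simp) t
  refine ⟨integral_nonneg fun t => mul_nonneg (h0 t) (hρ0 _), ?_⟩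
  have := cv_abs_sum (b := fun _ => 0) h1 (by simp) hρ hc hρ0 hρ1 (fun t => ?_) x
  · linarith [le_abs_self (cv (R.indicator fun _ => (1:ℝ)) ρ x), abs_nonneg (cv (fun _ => (0:ℝ)) ρ x)]
  · by_cases ht : t ∈ R <;> simp [ht]

/-- mollifier -/
theorem exists_moll {ε : ℝ} (hε : 0 < ε) : ∃ ρ : ℝ × ℝ → ℝ, ContDiff ℝ (⊤ : ℕ∞) ρ ∧
    HasCompactSupport ρ ∧ (∀ x, 0 ≤ ρ x) ∧ ∫ x, ρ x = 1 ∧ (∀ x, ρ (-x) = ρ x) ∧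
    (∀ x, ρ x ≠ 0 → ‖x‖ < ε) := by
  let φ : ContDiffBump (0 : ℝ × ℝ) := ⟨ε / 2, ε, by positivity, by linarith⟩
  refine ⟨φ.normed volume, φ.contDiff_normed, φ.hasCompactSupport_normed, φ.nonneg_normed,
    φ.integral_normed, φ.normed_neg, fun x hx => ?_⟩
  have : x ∈ Function.support (φ.normed volume) := hx
  rw [φ.support_normed_eq] at this
  simpa using this

/-- key: energy of mollified indicator in the inner square -/
theorem moll_energy {R : Set (ℝ × ℝ)} (hR : MeasurableSet R) (hRs : R ⊆ Isq) {M : ℝ}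
    (hM : ∀ f : ℝ × ℝ → ℝ × ℝ, ContDiff ℝ (⊤ : ℕ∞) f → HasCompactSupport f → tsupport f ⊆ Osq →
      (∀ x, |(f x).1| + |(f x).2| ≤ 1) → ∫ x in R, div2 f x ≤ M)
    {ε : ℝ} (hε : 0 < ε) {ρ : ℝ × ℝ → ℝ} (hρ : ContDiff ℝ (⊤ : ℕ∞) ρ)
    (hc : HasCompactSupport ρ) (hρ0 : ∀ x, 0 ≤ ρ x) (hρ1 : ∫ x, ρ x = 1) (he : ∀ x, ρ (-x) = ρ x)
    (hs : ∀ x, ρ x ≠ 0 → ‖x‖ < ε) :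
    ∫ z in {z : ℝ × ℝ | ‖z‖ ≤ 1 - 2 * ε}, max |D1 (cv (R.indicator fun _ => (1:ℝ)) ρ) z|
      |D2 (cv (R.indicator fun _ => (1:ℝ)) ρ) z| ≤ M := by
  set w := cv (R.indicator fun _ => (1:ℝ)) ρ with hw
  set Q : Set (ℝ × ℝ) := {z : ℝ × ℝ | ‖z‖ ≤ 1 - 2 * ε} with hQ
  have hρ1' : ContDiff ℝ 1 ρ := hρ.of_le (by exact_mod_cast le_top)
  have hvR : volume R ≠ ⊤ := ((measure_mono hRs).trans_lt (by rw [Isq_vol]; simp)).ne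
  have h1 : Integrable (R.indicator fun _ => (1:ℝ)) := (integrable_indicator_iff hR).2
    (integrableOn_const hvR)
  have hwc : ContDiff ℝ 1 w := cv_contDiff (n := 1) h1.locallyIntegrable hρ1' hc
  have hQc : IsClosed Q := isClosed_le continuous_norm continuous_const
  have hQm : MeasurableSet Q := hQc.measurableSet
  have hQv : volume Q ≠ ⊤ := by
    have : Q ⊆ Metric.closedBall 0 (1 - 2 * ε) := fun z hz => by
      have hz' : ‖z‖ ≤ 1 - 2 * ε := hz
      simpa using hz'
    exact ((measure_mono this).trans_lt measure_closedBall_lt_top).ne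
  have m1 := (D1_cont hwc).measurable
  have m2 := (D2_cont hwc).measurable
  set A : Set (ℝ × ℝ) := {z | |D2 w z| ≤ |D1 w z|} with hA
  have hAm : MeasurableSet A := measurableSet_le m2.abs m1.abs
  set P1 : Set (ℝ × ℝ) := {z | 0 ≤ D1 w z}
  set P2 : Set (ℝ × ℝ) := {z | 0 ≤ D2 w z}
  have hP1 : MeasurableSet P1 := measurableSet_le measurable_const m1
  have hP2 : MeasurableSet P2 := measurableSet_le measurable_const m2
  classical
  set a : ℝ × ℝ → ℝ := fun z => if z ∈ Q ∩ A then (if z ∈ P1 then -1 else 1) else 0 with ha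
  set b : ℝ × ℝ → ℝ := fun z => if z ∈ Q \ A then (if z ∈ P2 then -1 else 1) else 0 with hb
  have ham : Measurable a := Measurable.ite (hQm.inter hAm)
    (Measurable.ite hP1 measurable_const measurable_const) measurable_const
  have hbm : Measurable b := Measurable.ite (hQm.diff hAm)
    (Measurable.ite hP2 measurable_const measurable_const) measurable_const
  have hab : ∀ t, |a t| + |b t| ≤ 1 := by
    intro t
    simp only [ha, hb]
    by_cases q1 : t ∈ Q <;> by_cases q2 : t ∈ A <;> by_cases q3 : t ∈ P1 <;>
      by_cases q4 : t ∈ P2 <;> simp [q1, q2, q3, q4]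
  have haQ : ∀ t, t ∉ Q → a t = 0 := fun t ht => by simp [ha, ht]
  have hbQ : ∀ t, t ∉ Q → b t = 0 := fun t ht => by simp [hb, ht]
  have iQ : Integrable (Q.indicator fun _ => (1:ℝ)) := (integrable_indicator_iff hQm).2
    (integrableOn_const hQv)
  have hai : Integrable a := by
    refine iQ.mono' ham.aestronglyMeasurable (ae_of_all _ fun t => ?_)
    by_cases ht : t ∈ Q
    · simp only [ht, indicator_of_mem, Real.norm_eq_abs]; linarith [hab t, abs_nonneg (b t)]
    · simp [ht, haQ]
  have hbi : Integrable b := by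
    refine iQ.mono' hbm.aestronglyMeasurable (ae_of_all _ fun t => ?_)
    by_cases ht : t ∈ Q
    · simp only [ht, indicator_of_mem, Real.norm_eq_abs]; linarith [hab t, abs_nonneg (a t)]
    · simp [ht, hbQ]
  set f : ℝ × ℝ → ℝ × ℝ := fun x => (cv a ρ x, cv b ρ x) with hf
  have hfa : ContDiff ℝ (⊤ : ℕ∞) (cv a ρ) := cv_contDiff hai.locallyIntegrable hρ hc
  have hfb : ContDiff ℝ (⊤ : ℕ∞) (cv b ρ) := cv_contDiff hbi.locallyIntegrable hρ hc
  have hfc : ContDiff ℝ (⊤ : ℕ∞) f := hfa.prodMk hfb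
  have hz : ∀ k : ℝ × ℝ → ℝ, (∀ t, t ∉ Q → k t = 0) → ∀ x, 1 - ε < ‖x‖ → cv k ρ x = 0 := by
    intro k hk x hx
    unfold cv
    rw [integral_eq_zero_of_ae]
    refine ae_of_all _ fun t => ?_
    by_cases ht : t ∈ Q
    · have : ρ (x - t) = 0 := by
        by_contra h
        have h1 := hs _ h
        have h2 : ‖x‖ ≤ ‖x - t‖ + ‖t‖ := by simpa using norm_add_le (x - t) t
        have h3 : ‖t‖ ≤ 1 - 2 * ε := ht
        linarith
      simp [this]
    · simp [hk t ht]
  have hsup : tsupport f ⊆ Metric.closedBall 0 (1 - ε) := by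
    refine closure_minimal ?_ Metric.isClosed_closedBall
    intro x hx
    by_contra h
    have h' : 1 - ε < ‖x‖ := by simpa using h
    exact hx (by simp [hf, hz a haQ x h', hz b hbQ x h'])
  have hO : Metric.closedBall (0 : ℝ × ℝ) (1 - ε) ⊆ Osq := by
    refine Subset.trans ?_ open_subset_Osq
    intro x hx
    have h' : ‖x‖ ≤ 1 - ε := by simpa using hx
    rw [Prod.norm_def, max_le_iff, Real.norm_eq_abs, Real.norm_eq_abs, abs_le, abs_le] at h'
    refine ⟨⟨?_, ?_⟩, ?_, ?_⟩ <;> linarith [h'.1.1, h'.1.2, h'.2.1, h'.2.2]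
  have hfcs : HasCompactSupport f :=
    (isCompact_closedBall (0 : ℝ × ℝ) (1 - ε)).of_isClosed_subset (isClosed_tsupport f) hsup
  have key := hM f hfc hfcs (hsup.trans hO)
    (fun x => cv_abs_sum hai hbi hρ.continuous hc hρ0 hρ1 hab x)
  refine le_trans (le_of_eq ?_) key
  -- compute
  have hd : ∀ x, div2 f x = cv a (D1 ρ) x + cv b (D2 ρ) x := by
    intro x
    have da : HasFDerivAt (cv a ρ) (fderiv ℝ (cv a ρ) x) x :=
      (hfa.differentiable (by simp) x).hasFDerivAt
    have db : HasFDerivAt (cv b ρ) (fderiv ℝ (cv b ρ) x) x :=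
      (hfb.differentiable (by simp) x).hasFDerivAt
    unfold div2
    rw [(da.prodMk db).fderiv]
    simp only [ContinuousLinearMap.prod_apply]
    rw [cv_fderiv hai.locallyIntegrable hρ1' hc, cv_fderiv hbi.locallyIntegrable hρ1' hc]
    rfl
  have c1 : Continuous (D1 ρ) := D1_cont hρ1'
  have c2 : Continuous (D2 ρ) := D2_cont hρ1'
  have s1 : HasCompactSupport (D1 ρ) := hc.fderiv_apply ℝ _
  have s2 : HasCompactSupport (D2 ρ) := hc.fderiv_apply ℝ _
  have o1 : ∀ x, D1 ρ (-x) = - D1 ρ x := fun x => fderiv_even hρ1' he x _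
  have o2 : ∀ x, D2 ρ (-x) = - D2 ρ x := fun x => fderiv_even hρ1' he x _
  have w1 : cv (R.indicator fun _ => (1:ℝ)) (D1 ρ) = D1 w :=
    funext fun x => (cv_fderiv h1.locallyIntegrable hρ1' hc x _).symm
  have w2 : cv (R.indicator fun _ => (1:ℝ)) (D2 ρ) = D2 w :=
    funext fun x => (cv_fderiv h1.locallyIntegrable hρ1' hc x _).symm
  have F1 := cv_fubini h1 hai c1 s1 o1
  have F2 := cv_fubini h1 hbi c2 s2 o2
  rw [w1] at F1
  rw [w2] at F2
  have j1 : Integrable (fun x => R.indicator (fun _ => (1:ℝ)) x * cv a (D1 ρ) x) := by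
    have := cv_eq a (D1 ρ)
    have cc : Continuous (cv a (D1 ρ)) := by
      rw [this]; exact s1.continuous_convolution_right _ hai.locallyIntegrable c1
    have ccs : IntegrableOn (cv a (D1 ρ)) R := (cc.continuousOn.integrableOn_compact Isq_compact).mono_set hRs
    rw [← integrable_indicator_iff hR] at ccs
    refine ccs.congr (ae_of_all _ fun x => ?_)
    by_cases hx : x ∈ R <;> simp [hx]
  have j2 : Integrable (fun x => R.indicator (fun _ => (1:ℝ)) x * cv b (D2 ρ) x) := by
    have := cv_eq b (D2 ρ)
    have cc : Continuous (cv b (D2 ρ)) := by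
      rw [this]; exact s2.continuous_convolution_right _ hbi.locallyIntegrable c2
    have ccs : IntegrableOn (cv b (D2 ρ)) R := (cc.continuousOn.integrableOn_compact Isq_compact).mono_set hRs
    rw [← integrable_indicator_iff hR] at ccs
    refine ccs.congr (ae_of_all _ fun x => ?_)
    by_cases hx : x ∈ R <;> simp [hx]
  have e1 : ∫ x in R, div2 f x = (∫ x, R.indicator (fun _ => (1:ℝ)) x * cv a (D1 ρ) x)
      + ∫ x, R.indicator (fun _ => (1:ℝ)) x * cv b (D2 ρ) x := by
    rw [← integral_add j1 j2, ← integral_indicator hR]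
    congr 1; ext x
    by_cases hx : x ∈ R <;> simp [hx, hd]
  have hQcpt : IsCompact Q := by
    have : Q = Metric.closedBall 0 (1 - 2 * ε) := by ext z; simp [hQ]
    rw [this]; exact isCompact_closedBall _ _
  have k1 : Integrable (fun t => a t * D1 w t) := by
    have ccs : IntegrableOn (D1 w) Q := (D1_cont hwc).continuousOn.integrableOn_compact hQcpt
    rw [← integrable_indicator_iff hQm] at ccs
    refine ccs.norm.mono' (ham.mul m1).aestronglyMeasurable (ae_of_all _ fun t => ?_)
    by_cases ht : t ∈ Q
    · simp only [indicator_of_mem ht, norm_mul, Real.norm_eq_abs]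
      nlinarith [hab t, abs_nonneg (b t), abs_nonneg (D1 w t)]
    · simp [haQ t ht]
  have k2 : Integrable (fun t => b t * D2 w t) := by
    have ccs : IntegrableOn (D2 w) Q := (D2_cont hwc).continuousOn.integrableOn_compact hQcpt
    rw [← integrable_indicator_iff hQm] at ccs
    refine ccs.norm.mono' (hbm.mul m2).aestronglyMeasurable (ae_of_all _ fun t => ?_)
    by_cases ht : t ∈ Q
    · simp only [indicator_of_mem ht, norm_mul, Real.norm_eq_abs]
      nlinarith [hab t, abs_nonneg (a t), abs_nonneg (D2 w t)]
    · simp [hbQ t ht]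
  have e2 := integral_add k1 k2
  rw [e1, F1, F2, ← neg_add, ← e2, ← integral_neg, ← integral_indicator hQm]
  congr 1; ext t
  by_cases ht : t ∈ Q
  · rw [indicator_of_mem ht]
    by_cases hA' : t ∈ A
    · have hA2 : |D2 w t| ≤ |D1 w t| := hA'
      rw [max_eq_left hA2]
      by_cases hp : t ∈ P1
      · have : 0 ≤ D1 w t := hp
        simp [ha, hb, ht, hA', hp, abs_of_nonneg this]
      · have : D1 w t < 0 := not_le.1 hp
        simp [ha, hb, ht, hA', hp, abs_of_neg this]
    · have hA2 : |D1 w t| ≤ |D2 w t| := (not_le.1 hA').le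
      rw [max_eq_right hA2]
      by_cases hp : t ∈ P2
      · have : 0 ≤ D2 w t := hp
        simp [ha, hb, ht, hA', hp, abs_of_nonneg this]
      · have : D2 w t < 0 := not_le.1 hp
        simp [ha, hb, ht, hA', hp, abs_of_neg this]
  · simp [ht, haQ, hbQ]
end


noncomputable section
open scoped Topology

theorem Isq_norm {z : ℝ × ℝ} : z ∈ Isq ↔ ‖z‖ ≤ 1 := by
  rw [mem_Isq_iff, Prod.norm_def, max_le_iff, Real.norm_eq_abs, Real.norm_eq_abs, abs_le, abs_le]
  exact ⟨fun h => ⟨⟨h.1.1, h.2.1⟩, h.1.2, h.2.2⟩, fun h => ⟨⟨h.1.1, h.2.1⟩, h.1.2, h.2.2⟩⟩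

theorem lint_scale {r : ℝ} (hr : 0 < r) {F : ℝ × ℝ → ℝ≥0∞} (hF : Measurable F) :
    ∫⁻ z, F (r • z) = ENNReal.ofReal ((r ^ 2)⁻¹) * ∫⁻ z, F z := by
  have h := Measure.map_addHaar_smul (volume : Measure (ℝ × ℝ)) hr.ne'
  have h2 : ∫⁻ z, F z ∂(Measure.map (r • ·) (volume : Measure (ℝ × ℝ))) = ∫⁻ z, F (r • z) :=
    lintegral_map hF (measurable_const_smul r)
  rw [← h2, h, lintegral_smul_measure]
  have : Module.finrank ℝ (ℝ × ℝ) = 2 := by simp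
  rw [this, abs_of_pos (by positivity)]
  rfl

theorem scale_D1 {w : ℝ × ℝ → ℝ} (hw : ContDiff ℝ 1 w) (r : ℝ) (z e : ℝ × ℝ) :
    fderiv ℝ (fun z => w (r • z)) z e = r * fderiv ℝ w (r • z) e := by
  have h1 := (hw.differentiable (by simp) (r • z)).hasFDerivAt
  have h2 : HasFDerivAt (fun z : ℝ × ℝ => r • z) (r • ContinuousLinearMap.id ℝ (ℝ × ℝ)) z :=
    (hasFDerivAt_id z).const_smul r
  have h3 : fderiv ℝ (fun z => w (r • z)) z = _ := (h1.comp z h2).fderiv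
  rw [h3]; simp

theorem scale_energy {w : ℝ × ℝ → ℝ} (hw : ContDiff ℝ 1 w) {r M : ℝ} (hr : 0 < r)
    (hM : ∫ z in {z : ℝ × ℝ | ‖z‖ ≤ r}, max |D1 w z| |D2 w z| ≤ M) :
    ∫⁻ z in Isq, gm (fun z => w (r • z)) z ≤ ENNReal.ofReal (M / r) := by
  set Q : Set (ℝ × ℝ) := {z : ℝ × ℝ | ‖z‖ ≤ r} with hQ
  have hQm : MeasurableSet Q := (isClosed_le continuous_norm continuous_const).measurableSet
  have hQcpt : IsCompact Q := by
    have : Q = Metric.closedBall 0 r := by ext z; simp [hQ]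
    rw [this]; exact isCompact_closedBall _ _
  have h1 : ∫⁻ z in Q, gm w z ≤ ENNReal.ofReal M := by
    refine le_trans (le_of_eq ?_) (ENNReal.ofReal_le_ofReal hM)
    rw [ofReal_integral_eq_lintegral_ofReal]
    · refine lintegral_congr fun z => ?_
      rw [ENNReal.ofReal_max, gm, Real.enorm_eq_ofReal_abs, Real.enorm_eq_ofReal_abs]
    · exact ((D1_cont hw).abs.max (D2_cont hw).abs).continuousOn.integrableOn_compact hQcpt
    · exact ae_of_all _ fun z => le_max_of_le_left (abs_nonneg _)
  have h2 : ∫⁻ z in Isq, gm (fun z => w (r • z)) z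
      = ∫⁻ z, ENNReal.ofReal r * (Q.indicator (gm w) (r • z)) := by
    rw [← lintegral_indicator Isq_meas]
    refine lintegral_congr fun z => ?_
    have : z ∈ Isq ↔ r • z ∈ Q := by
      rw [Isq_norm]
      change _ ↔ ‖r • z‖ ≤ r
      rw [norm_smul, Real.norm_eq_abs, abs_of_pos hr]
      constructor
      · intro h; nlinarith
      · intro h; by_contra h'; push Not at h'; nlinarith
    by_cases hz : z ∈ Isq
    · rw [indicator_of_mem hz, indicator_of_mem (this.1 hz)]
      simp only [gm, D1, D2, scale_D1 hw, enorm_mul, Real.enorm_eq_ofReal_abs r, abs_of_pos hr]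
      rw [mul_max]
    · rw [indicator_of_notMem hz, indicator_of_notMem (fun h => hz (this.2 h)), mul_zero]
  have hm : Measurable (Q.indicator (gm w)) := (gm_cont hw).measurable.indicator hQm
  have hm' : Measurable fun z => Q.indicator (gm w) (r • z) := hm.comp (measurable_const_smul r)
  rw [h2, lintegral_const_mul _ hm', lint_scale hr hm,
    lintegral_indicator hQm, ← mul_assoc, ← ENNReal.ofReal_mul hr.le]
  refine (mul_le_mul_right h1 _).trans ?_
  rw [← ENNReal.ofReal_mul (by positivity)]
  refine ENNReal.ofReal_le_ofReal (le_of_eq ?_)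
  field_simp

theorem approx {R : Set (ℝ × ℝ)} (hR : MeasurableSet R) (hRs : R ⊆ Isq) {M : ℝ}
    (hM : ∀ f : ℝ × ℝ → ℝ × ℝ, ContDiff ℝ (⊤ : ℕ∞) f → HasCompactSupport f → tsupport f ⊆ Osq →
      (∀ x, |(f x).1| + |(f x).2| ≤ 1) → ∫ x in R, div2 f x ≤ M) {η : ℝ} (hη : 0 < η) :
    ∃ v : ℝ × ℝ → ℝ, ContDiff ℝ 1 v ∧ (∀ z, 0 ≤ v z ∧ v z ≤ 1) ∧
      ∫⁻ z in Isq, gm v z ≤ ENNReal.ofReal (M + η) ∧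
      ∫⁻ z in Isq, ‖v z - R.indicator (fun _ => (1:ℝ)) z‖ₑ ≤ ENNReal.ofReal η := by
  have hM0 : 0 ≤ M := by
    have := hM (fun _ => 0) contDiff_const HasCompactSupport.zero (by simp [tsupport]) (by simp)
    simpa [div2] using this
  have hvR : volume R ≠ ⊤ := ((measure_mono hRs).trans_lt (by rw [Isq_vol]; simp)).ne
  have h1 : Integrable (R.indicator fun _ => (1:ℝ)) := (integrable_indicator_iff hR).2
    (integrableOn_const hvR)
  obtain ⟨g, hgc, hgd, hg, hgi⟩ := h1.exists_hasCompactSupport_lintegral_sub_le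
    (ε := ENNReal.ofReal (η / 10)) (by simpa using hη)
  have huc : UniformContinuous g := hgc.uniformContinuous_of_continuous hg
  obtain ⟨δ, hδ, hgu⟩ := Metric.uniformContinuous_iff.1 huc (η / 16) (by positivity)
  set ε : ℝ := min (δ / 4) (min (1 / 4) (η / (4 * (M + η)))) with hεd
  have hε : 0 < ε := by
    have : 0 < η / (4 * (M + η)) := by positivity
    exact lt_min (by positivity) (lt_min (by norm_num) this)
  have e1 : ε ≤ δ / 4 := min_le_left _ _
  have e2 : ε ≤ 1 / 4 := (min_le_right _ _).trans (min_le_left _ _)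
  have e3 : ε ≤ η / (4 * (M + η)) := (min_le_right _ _).trans (min_le_right _ _)
  obtain ⟨ρ, hρ, hc, hρ0, hρ1, he, hs⟩ := exists_moll hε
  set r : ℝ := 1 - 2 * ε with hr
  have hr0 : 1 / 2 ≤ r := by linarith
  have hr1 : r ≤ 1 := by linarith
  set w := cv (R.indicator fun _ => (1:ℝ)) ρ with hw
  have hwc : ContDiff ℝ 1 w := cv_contDiff (n := 1) h1.locallyIntegrable
    (hρ.of_le (by exact_mod_cast le_top)) hc
  have hen := moll_energy hR hRs hM hε hρ hc hρ0 hρ1 he hs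
  have hρi : Integrable ρ := hρ.continuous.integrable_of_hasCompactSupport hc
  have hρl : ∫⁻ y, ENNReal.ofReal (ρ y) = 1 := by
    rw [← ofReal_integral_eq_lintegral_ofReal hρi (ae_of_all _ hρ0), hρ1]; simp
  refine ⟨fun z => w (r • z), hwc.comp (contDiff_const_smul r),
    fun z => cv_mem hR hvR hρ.continuous hc hρ0 hρ1 _,
    (scale_energy hwc (by linarith) hen).trans (ENNReal.ofReal_le_ofReal ?_), ?_⟩
  · rw [div_le_iff₀ (by linarith)]
    have h4 : ε * (4 * (M + η)) ≤ η := by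
      rwa [le_div_iff₀ (by positivity)] at e3
    nlinarith
  set h : ℝ × ℝ → ℝ := fun z => R.indicator (fun _ => (1:ℝ)) z - g z with hh
  have hhm : Measurable h := ((measurable_const.indicator hR).sub hg.measurable)
  have pt : ∀ z ∈ Isq, ‖w (r • z) - R.indicator (fun _ => (1:ℝ)) z‖ₑ
      ≤ (∫⁻ y, ENNReal.ofReal (ρ y) * ‖h (r • z - y)‖ₑ) + (ENNReal.ofReal (η / 16) + ‖h z‖ₑ) := by
    intro z hz
    have q1 : w (r • z) = ∫ y, R.indicator (fun _ => (1:ℝ)) (r • z - y) * ρ y := by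
      rw [hw, cv, ← integral_sub_left_eq_self _ volume (r • z)]
      simp
    have q2 : R.indicator (fun _ => (1:ℝ)) z = ∫ y, R.indicator (fun _ => (1:ℝ)) z * ρ y := by
      rw [integral_const_mul, hρ1, mul_one]
    have i1 : Integrable (fun y => R.indicator (fun _ => (1:ℝ)) (r • z - y) * ρ y) := by
      have := (cv_integrable h1 hρ.continuous hc (r • z)).comp_sub_left (r • z)
      simpa using this
    have q3 : w (r • z) - R.indicator (fun _ => (1:ℝ)) z
        = ∫ y, (R.indicator (fun _ => (1:ℝ)) (r • z - y) - R.indicator (fun _ => (1:ℝ)) z) * ρ y := by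
      have := integral_sub i1 (hρi.const_mul (R.indicator (fun _ => (1:ℝ)) z))
      rw [← q1, ← q2] at this
      rw [← this]
      congr 1; ext y; ring
    rw [q3]
    refine (enorm_integral_le_lintegral_enorm _).trans ?_
    have q4 : ∀ y, ‖(R.indicator (fun _ => (1:ℝ)) (r • z - y) - R.indicator (fun _ => (1:ℝ)) z) * ρ y‖ₑ
        ≤ ENNReal.ofReal (ρ y) * ‖h (r • z - y)‖ₑ
          + ENNReal.ofReal (ρ y) * (ENNReal.ofReal (η / 16) + ‖h z‖ₑ) := by
      intro y
      rw [enorm_mul, mul_comm, Real.enorm_eq_ofReal (hρ0 y), ← mul_add]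
      by_cases hy : ρ y = 0
      · simp [hy]
      gcongr
      have hy' := hs y hy
      have hd : dist (r • z - y) z < δ := by
        rw [dist_eq_norm]
        have : r • z - y - z = -(2 * ε) • z - y := by rw [hr]; module
        rw [this]
        have t1 := norm_sub_le (-(2 * ε) • z) y
        have t2 : ‖-(2 * ε) • z‖ ≤ 2 * ε := by
          rw [norm_smul, norm_neg, Real.norm_eq_abs, abs_of_pos (by linarith)]
          have := Isq_norm.1 hz
          nlinarith
        linarith
      have t3 := hgu hd
      rw [Real.dist_eq] at t3
      have t4 : R.indicator (fun _ => (1:ℝ)) (r • z - y) - R.indicator (fun _ => (1:ℝ)) z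
          = h (r • z - y) + ((g (r • z - y) - g z) - h z) := by simp only [hh]; ring
      rw [t4]
      refine (enorm_add_le _ _).trans ?_
      gcongr
      refine (enorm_sub_le).trans ?_
      gcongr
      rw [Real.enorm_eq_ofReal_abs]
      exact ENNReal.ofReal_le_ofReal t3.le
    refine (lintegral_mono q4).trans ?_
    have mρ : Measurable (fun y => ENNReal.ofReal (ρ y)) := hρ.continuous.measurable.ennreal_ofReal
    rw [lintegral_add_right _ (mρ.mul_const _), lintegral_mul_const _ mρ, hρl, one_mul]
  refine (setLIntegral_mono_ae' Isq_meas (ae_of_all _ pt)).trans ?_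
  have mρ : Measurable (fun y => ENNReal.ofReal (ρ y)) := hρ.continuous.measurable.ennreal_ofReal
  have mm : Measurable fun z => ENNReal.ofReal (η / 16) + ‖h z‖ₑ := measurable_const.add hhm.enorm
  rw [lintegral_add_right _ mm, lintegral_add_right _ hhm.enorm,
    setLIntegral_const, Isq_vol]
  have b1 : ∫⁻ z in Isq, ‖h z‖ₑ ≤ ENNReal.ofReal (η / 10) := (setLIntegral_le_lintegral _ _).trans hgd
  have b2 : ∫⁻ z in Isq, ∫⁻ y, ENNReal.ofReal (ρ y) * ‖h (r • z - y)‖ₑ ≤ ENNReal.ofReal (4 * (η / 10)) := by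
    refine (setLIntegral_le_lintegral _ _).trans ?_
    rw [lintegral_lintegral_swap]
    · have : ∀ y, ∫⁻ z, ENNReal.ofReal (ρ y) * ‖h (r • z - y)‖ₑ
          ≤ ENNReal.ofReal (ρ y) * ENNReal.ofReal (4 * (η / 10)) := by
        intro y
        have m1 : Measurable fun z => ‖h (z - y)‖ₑ := (hhm.comp (measurable_id.sub_const y)).enorm
        have m1' : Measurable fun z => ‖h (r • z - y)‖ₑ := m1.comp (measurable_const_smul r)
        rw [lintegral_const_mul _ m1']
        gcongr
        rw [lint_scale (by linarith) m1, lintegral_sub_right_eq_self (fun z => ‖h z‖ₑ) y,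
          ENNReal.ofReal_mul (by norm_num)]
        gcongr
        rw [inv_le_comm₀ (by positivity) (by norm_num)]
        nlinarith
      refine (lintegral_mono this).trans ?_
      rw [lintegral_mul_const _ mρ, hρl, one_mul]
    · refine Measurable.aemeasurable ?_
      have m2 : Measurable (fun p : (ℝ × ℝ) × (ℝ × ℝ) => r • p.1 - p.2) := by fun_prop
      exact (mρ.comp measurable_snd).mul (hhm.comp m2).enorm
  calc _ ≤ ENNReal.ofReal (4 * (η / 10)) + (ENNReal.ofReal (η / 16) * 4 + ENNReal.ofReal (η / 10)) := by
        gcongr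
    _ ≤ ENNReal.ofReal η := by
        have : (4 : ℝ≥0∞) = ENNReal.ofReal 4 := by simp
        rw [this, ← ENNReal.ofReal_mul (by positivity), ← ENNReal.ofReal_add (by positivity) (by positivity),
          ← ENNReal.ofReal_add (by positivity) (by positivity)]
        exact ENNReal.ofReal_le_ofReal (by linarith)
end


noncomputable section
open scoped Topology

theorem cell_pt1 {v : ℝ × ℝ → ℝ} (hv : ContDiff ℝ 1 v) {a h : ℝ} {x x' : ℝ}
    (hx : x ∈ Ioc a (a + h)) (hx' : x' ∈ Ioc a (a + h)) (y : ℝ) :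
    ‖v (x, y) - v (x', y)‖ₑ ≤ ∫⁻ s in Ioc a (a + h), gm v (s, y) := by
  have key : ∀ p q, p ∈ Ioc a (a + h) → q ∈ Ioc a (a + h) → p ≤ q →
      ‖v (q, y) - v (p, y)‖ₑ ≤ ∫⁻ s in Ioc a (a + h), gm v (s, y) := by
    intro p q hp hq hpq
    refine (horiz_le hv hpq y).trans ?_
    refine (lintegral_mono_set (Ioc_subset_Ioc hp.1.le hq.2)).trans (lintegral_mono fun s => ?_)
    exact le_max_left _ _
  rcases le_total x x' with h' | h'
  · rw [← enorm_neg, neg_sub]; exact key _ _ hx hx' h'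
  · exact key _ _ hx' hx h'

theorem cell_pt2 {v : ℝ × ℝ → ℝ} (hv : ContDiff ℝ 1 v) {b h : ℝ} {y y' : ℝ}
    (hy : y ∈ Ioc b (b + h)) (hy' : y' ∈ Ioc b (b + h)) (x : ℝ) :
    ‖v (x, y) - v (x, y')‖ₑ ≤ ∫⁻ s in Ioc b (b + h), gm v (x, s) := by
  have key : ∀ p q, p ∈ Ioc b (b + h) → q ∈ Ioc b (b + h) → p ≤ q →
      ‖v (x, q) - v (x, p)‖ₑ ≤ ∫⁻ s in Ioc b (b + h), gm v (x, s) := by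
    intro p q hp hq hpq
    refine (vert_le hv hpq x).trans ?_
    refine (lintegral_mono_set (Ioc_subset_Ioc hp.1.le hq.2)).trans (lintegral_mono fun s => ?_)
    exact le_max_right _ _
  rcases le_total y y' with h' | h'
  · rw [← enorm_neg, neg_sub]; exact key _ _ hy hy' h'
  · exact key _ _ hy' hy h'

theorem cell_const {v : ℝ × ℝ → ℝ} (hv : ContDiff ℝ 1 v) (h01 : ∀ z, 0 ≤ v z ∧ v z ≤ 1)
    (a b : ℝ) {h : ℝ} (hh : 0 < h) :
    ∃ c : Icc (0:ℝ) 1, ∫⁻ z in Ioc a (a + h) ×ˢ Ioc b (b + h), ‖v z - c‖ₑ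
      ≤ ENNReal.ofReal (2 * h) * ∫⁻ z in Ioc a (a + h) ×ˢ Ioc b (b + h), gm v z := by
  set I := Ioc a (a + h)
  set J := Ioc b (b + h)
  have vI : volume I = ENNReal.ofReal h := by simp [I]
  have vJ : volume J = ENNReal.ofReal h := by simp [J]
  have vQ : volume (I ×ˢ J) = ENNReal.ofReal h * ENNReal.ofReal h := by
    rw [Measure.volume_eq_prod, Measure.prod_prod, vI, vJ]
  have hQ0 : volume (I ×ˢ J) ≠ 0 := by rw [vQ]; simp [hh]
  have hQt : volume (I ×ˢ J) ≠ ⊤ := by rw [vQ]; exact ENNReal.mul_ne_top (by simp) (by simp)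
  have hgm : Measurable (gm v) := (gm_cont hv).measurable
  have hvm := hv.continuous.measurable
  have hF2 : Measurable (fun p : (ℝ × ℝ) × (ℝ × ℝ) => ‖v p.2 - v p.1‖ₑ) :=
    ((hvm.comp measurable_snd).sub (hvm.comp measurable_fst)).enorm
  have hF : Measurable (fun z' => ∫⁻ z in I ×ˢ J, ‖v z - v z'‖ₑ) := hF2.lintegral_prod_right'
  obtain ⟨z', hz', hle⟩ := exists_le_setLAverage hQ0 hQt hF.aemeasurable
  refine ⟨⟨v z', h01 z'⟩, hle.trans ?_⟩
  rw [setLAverage_eq]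
  refine ENNReal.div_le_of_le_mul ?_
  set A : ℝ → ℝ≥0∞ := fun y => ∫⁻ s in I, gm v (s, y) with hA
  set B : ℝ → ℝ≥0∞ := fun x => ∫⁻ s in J, gm v (x, s) with hB
  have hBm : Measurable B := hgm.lintegral_prod_right'
  have hAm : Measurable A := hgm.lintegral_prod_left'
  have hQm : MeasurableSet (I ×ˢ J) := measurableSet_Ioc.prod measurableSet_Ioc
  set G := ∫⁻ z in I ×ˢ J, gm v z with hG
  have GA : ∫⁻ y in J, A y = G := by
    rw [hG, Measure.volume_eq_prod, setLIntegral_prod_symm _ hgm.aemeasurable]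
  have GB : ∫⁻ x in I, B x = G := by
    rw [hG, Measure.volume_eq_prod, setLIntegral_prod _ hgm.aemeasurable]
  have hA2 : Measurable fun z : ℝ × ℝ => A z.2 := hAm.comp measurable_snd
  have hB1 : Measurable fun z : ℝ × ℝ => B z.1 := hBm.comp measurable_fst
  have iA : ∫⁻ z in I ×ˢ J, A z.2 = ENNReal.ofReal h * G := by
    rw [Measure.volume_eq_prod, setLIntegral_prod _ hA2.aemeasurable]
    simp only [GA]
    rw [setLIntegral_const, vI, mul_comm]
  have iB : ∫⁻ z in I ×ˢ J, B z.1 = ENNReal.ofReal h * G := by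
    rw [Measure.volume_eq_prod, setLIntegral_prod_symm _ hB1.aemeasurable]
    simp only [GB]
    rw [setLIntegral_const, vJ, mul_comm]
  have hb : ∀ z' ∈ I ×ˢ J, ∫⁻ z in I ×ˢ J, ‖v z - v z'‖ₑ
      ≤ ENNReal.ofReal h * G + B z'.1 * volume (I ×ˢ J) := by
    intro z' hz'
    have : ∀ z ∈ I ×ˢ J, ‖v z - v z'‖ₑ ≤ A z.2 + B z'.1 := by
      intro z hz
      have e : v z - v z' = (v (z.1, z.2) - v (z'.1, z.2)) + (v (z'.1, z.2) - v (z'.1, z'.2)) := by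
        simp
      rw [e]
      exact (enorm_add_le _ _).trans (add_le_add (cell_pt1 hv hz.1 hz'.1 _) (cell_pt2 hv hz.2 hz'.2 _))
    refine (setLIntegral_mono_ae' hQm (ae_of_all _ this)).trans ?_
    rw [lintegral_add_right _ measurable_const, iA, setLIntegral_const]
  refine (setLIntegral_mono_ae' hQm (ae_of_all _ hb)).trans (le_of_eq ?_)
  rw [lintegral_add_left measurable_const, setLIntegral_const,
    lintegral_mul_const _ hB1, iB, two_mul, ENNReal.ofReal_add hh.le hh.le]
  ring

/-- cells -/
def cell (k : ℕ) (p : ℤ × ℤ) : Set (ℝ × ℝ) :=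
  Ioc ((p.1:ℝ) * (1 / (k + 1))) (p.1 * (1 / (k + 1)) + 1 / (k + 1)) ×ˢ
  Ioc ((p.2:ℝ) * (1 / (k + 1))) (p.2 * (1 / (k + 1)) + 1 / (k + 1))

def cidx (k : ℕ) : Finset (ℤ × ℤ) :=
  Finset.Ico (-(k + 1 : ℤ)) (k + 1) ×ˢ Finset.Ico (-(k + 1 : ℤ)) (k + 1)

theorem cell_meas (k : ℕ) (p) : MeasurableSet (cell k p) := measurableSet_Ioc.prod measurableSet_Ioc

theorem Ioc_uniq {h x : ℝ} (hh : 0 < h) {i j : ℤ} (hi : x ∈ Ioc ((i:ℝ) * h) (i * h + h))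
    (hj : x ∈ Ioc ((j:ℝ) * h) (j * h + h)) : i = j := by
  have h1 : (i:ℝ) < j + 1 := by have := hi.1.trans_le hj.2; nlinarith
  have h2 : (j:ℝ) < i + 1 := by have := hj.1.trans_le hi.2; nlinarith
  have h1' : i < j + 1 := by exact_mod_cast h1
  have h2' : j < i + 1 := by exact_mod_cast h2
  omega

theorem Ioc_ex (k : ℕ) {x : ℝ} (hx : x ∈ Ioc (-1:ℝ) 1) : ∃ i ∈ Finset.Ico (-(k + 1 : ℤ)) (k + 1),
    x ∈ Ioc ((i:ℝ) * (1 / (k + 1))) (i * (1 / (k + 1)) + 1 / (k + 1)) := by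
  have hk : (0:ℝ) < k + 1 := by positivity
  refine ⟨⌈x * (k + 1)⌉ - 1, ?_, ?_, ?_⟩
  · rw [Finset.mem_Ico]
    constructor
    · have : -(k + 1 : ℤ) < ⌈x * (k + 1)⌉ := by
        rw [Int.lt_ceil]; push_cast; nlinarith [hx.1]
      omega
    · have : ⌈x * (k + 1)⌉ ≤ (k + 1 : ℤ) := by
        rw [Int.ceil_le]; push_cast; nlinarith [hx.2]
      omega
  · have := Int.ceil_lt_add_one (x * (k + 1))
    push_cast
    rw [mul_one_div, div_lt_iff₀ hk]; linarith
  · have := Int.le_ceil (x * (k + 1))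
    push_cast
    rw [mul_one_div, ← add_div, le_div_iff₀ hk]; linarith

theorem cell_disj (k : ℕ) : Set.PairwiseDisjoint (↑(cidx k) : Set (ℤ × ℤ)) (cell k) := by
  intro p _ q _ hpq
  refine Set.disjoint_left.2 fun z hz hz' => hpq ?_
  have hk : (0:ℝ) < 1 / (k + 1) := by positivity
  exact Prod.ext (Ioc_uniq hk hz.1 hz'.1) (Ioc_uniq hk hz.2 hz'.2)

theorem cell_union (k : ℕ) : ⋃ p ∈ cidx k, cell k p = Ioc (-1:ℝ) 1 ×ˢ Ioc (-1:ℝ) 1 := by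
  have hk : (0:ℝ) < k + 1 := by positivity
  have aux : ∀ (i : ℤ) (x : ℝ), i ∈ Finset.Ico (-(k + 1 : ℤ)) (k + 1) →
      x ∈ Ioc ((i:ℝ) * (1 / (k + 1))) (i * (1 / (k + 1)) + 1 / (k + 1)) → x ∈ Ioc (-1:ℝ) 1 := by
    intro i x hi hx
    rw [Finset.mem_Ico] at hi
    have h1 : (-(k + 1) : ℝ) ≤ i := by exact_mod_cast hi.1
    have h2 : (i : ℝ) + 1 ≤ k + 1 := by exact_mod_cast hi.2
    rw [mul_one_div, ← add_div, mem_Ioc, div_lt_iff₀ hk, le_div_iff₀ hk] at hx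
    constructor
    · nlinarith [hx.1]
    · nlinarith [hx.2]
  ext z
  simp only [mem_iUnion, exists_prop]
  constructor
  · rintro ⟨p, hp, hz⟩
    rw [cidx, Finset.mem_product] at hp
    exact ⟨aux _ _ hp.1 hz.1, aux _ _ hp.2 hz.2⟩
  · rintro ⟨h1, h2⟩
    obtain ⟨i, hi, hi'⟩ := Ioc_ex k h1
    obtain ⟨j, hj, hj'⟩ := Ioc_ex k h2
    exact ⟨(i, j), by rw [cidx, Finset.mem_product]; exact ⟨hi, hj⟩, hi', hj'⟩

theorem Isq_ae : (Ioc (-1:ℝ) 1 ×ˢ Ioc (-1:ℝ) 1 : Set (ℝ × ℝ)) =ᵐ[volume] Isq := by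
  rw [Isq_eq_prod, Measure.volume_eq_prod]
  exact Measure.set_prod_ae_eq Ioc_ae_eq_Icc Ioc_ae_eq_Icc

theorem lint_cells (k : ℕ) (F : ℝ × ℝ → ℝ≥0∞) :
    ∫⁻ z in Isq, F z = ∑ p ∈ cidx k, ∫⁻ z in cell k p, F z := by
  rw [← lintegral_biUnion_finset (cell_disj k) (fun p _ => cell_meas k p), cell_union,
    setLIntegral_congr Isq_ae]

/-- compactness -/
theorem bv_compact {v : ℕ → ℝ × ℝ → ℝ} (hv : ∀ n, ContDiff ℝ 1 (v n))
    (h01 : ∀ n z, 0 ≤ v n z ∧ v n z ≤ 1) {C : ℝ≥0∞} (hC : C ≠ ⊤)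
    (hen : ∀ n, ∫⁻ z in Isq, gm (v n) z ≤ C) :
    ∃ φ : ℕ → ℕ, StrictMono φ ∧ ∀ᵐ z ∂(volume.restrict Isq), ∃ l : ℝ,
      Tendsto (fun n => v (φ n) z) atTop (𝓝 l) := by
  have hex : ∀ n k (p : ℤ × ℤ), ∃ c : Icc (0:ℝ) 1, ∫⁻ z in cell k p, ‖v n z - c‖ₑ
      ≤ ENNReal.ofReal (2 * (1 / ((k:ℝ) + 1))) * ∫⁻ z in cell k p, gm (v n) z := fun n k p =>
    cell_const (hv n) (h01 n) _ _ (by positivity)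
  choose c hc using hex
  obtain ⟨c0, ψ, hψ, hlim⟩ := CompactSpace.tendsto_subseq (fun n => fun q : ℕ × (ℤ × ℤ) => c n q.1 q.2)
  have hlim' : ∀ k p, Tendsto (fun n => ((c (ψ n) k p : ℝ))) atTop (𝓝 (c0 (k, p) : ℝ)) := by
    intro k p
    have := (tendsto_pi_nhds.1 hlim) (k, p)
    exact (continuous_subtype_val.tendsto _).comp this
  -- Cauchy
  have hcau : ∀ δ : ℝ≥0∞, 0 < δ → ∃ N, ∀ m ≥ N, ∀ n ≥ N,
      ∫⁻ z in Isq, ‖v (ψ m) z - v (ψ n) z‖ₑ < δ := by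
    intro δ hδ
    -- choose k
    have hk : ∃ k : ℕ, 2 * (ENNReal.ofReal (2 * (1 / ((k:ℝ) + 1))) * C) < δ / 2 := by
      have t1 : Tendsto (fun k : ℕ => ENNReal.ofReal (2 * (1 / ((k:ℝ) + 1)))) atTop (𝓝 0) := by
        have := (tendsto_one_div_add_atTop_nhds_zero_nat (𝕜 := ℝ)).const_mul 2
        simpa using ENNReal.tendsto_ofReal this
      have t2 : Tendsto (fun k : ℕ => 2 * (ENNReal.ofReal (2 * (1 / ((k:ℝ) + 1))) * C)) atTop (𝓝 0) := by
        have := ENNReal.Tendsto.const_mul (a := 2) (ENNReal.Tendsto.mul_const (b := C) t1 (Or.inr hC))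
          (Or.inr (by simp))
        simpa using this
      exact (t2.eventually_lt_const (ENNReal.half_pos hδ.ne')).exists
    obtain ⟨k, hk⟩ := hk
    have t3 : Tendsto (fun q : ℕ × ℕ => ∑ p ∈ cidx k,
        ‖(c (ψ q.1) k p : ℝ) - (c (ψ q.2) k p : ℝ)‖ₑ * volume (cell k p)) (atTop ×ˢ atTop) (𝓝 0) := by
      have : (0 : ℝ≥0∞) = ∑ p ∈ cidx k, 0 := by simp
      rw [this]
      refine tendsto_finsetSum _ fun p hp => ?_
      have f1 := (hlim' k p).comp (tendsto_fst (f := (atTop : Filter ℕ)) (g := (atTop : Filter ℕ)))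
      have f2 := (hlim' k p).comp (tendsto_snd (f := (atTop : Filter ℕ)) (g := (atTop : Filter ℕ)))
      have f3 := (f1.sub f2).enorm
      rw [sub_self, enorm_zero] at f3
      have hvt : volume (cell k p) ≠ ⊤ := by
        have : cell k p ⊆ Isq ∪ cell k p := subset_union_right
        rw [cell, Measure.volume_eq_prod, Measure.prod_prod]
        exact ENNReal.mul_ne_top (by simp) (by simp)
      have f4 := ENNReal.Tendsto.mul_const (b := volume (cell k p)) f3 (Or.inr hvt)
      simpa using f4
    have t4 := t3.eventually_lt_const (ENNReal.half_pos hδ.ne')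
    rw [prod_atTop_atTop_eq, eventually_atTop] at t4
    obtain ⟨⟨N1, N2⟩, hN⟩ := t4
    refine ⟨max N1 N2, fun m hm n hn => ?_⟩
    have hN' := hN (m, n) ⟨(le_max_left _ _).trans hm, (le_max_right _ _).trans hn⟩
    simp only at hN'
    have hvm : ∀ n, Measurable (v n) := fun n => (hv n).continuous.measurable
    have per : ∀ p ∈ cidx k, ∫⁻ z in cell k p, ‖v (ψ m) z - v (ψ n) z‖ₑ
        ≤ (ENNReal.ofReal (2 * (1 / ((k:ℝ) + 1))) * ∫⁻ z in cell k p, gm (v (ψ m)) z)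
          + (ENNReal.ofReal (2 * (1 / ((k:ℝ) + 1))) * ∫⁻ z in cell k p, gm (v (ψ n)) z)
          + ‖(c (ψ m) k p : ℝ) - (c (ψ n) k p : ℝ)‖ₑ * volume (cell k p) := by
      intro p _
      have h1 : ∀ z, ‖v (ψ m) z - v (ψ n) z‖ₑ ≤ (‖v (ψ m) z - c (ψ m) k p‖ₑ + ‖v (ψ n) z - c (ψ n) k p‖ₑ)
          + ‖(c (ψ m) k p : ℝ) - (c (ψ n) k p : ℝ)‖ₑ := by
        intro z
        have e : v (ψ m) z - v (ψ n) z = (v (ψ m) z - c (ψ m) k p) - (v (ψ n) z - c (ψ n) k p)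
          + ((c (ψ m) k p : ℝ) - (c (ψ n) k p : ℝ)) := by ring
        rw [e]
        refine (enorm_add_le _ _).trans ?_
        gcongr
        exact enorm_sub_le
      refine (lintegral_mono h1).trans ?_
      have m1 : Measurable fun z => ‖v (ψ m) z - c (ψ m) k p‖ₑ := ((hvm _).sub_const _).enorm
      rw [lintegral_add_right _ measurable_const, lintegral_add_left m1, setLIntegral_const]
      gcongr
      · exact hc _ _ _
      · exact hc _ _ _
    rw [lint_cells k]
    refine (Finset.sum_le_sum per).trans_lt ?_
    rw [Finset.sum_add_distrib, Finset.sum_add_distrib, ← Finset.mul_sum, ← Finset.mul_sum,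
      ← lint_cells, ← lint_cells]
    calc _ ≤ 2 * (ENNReal.ofReal (2 * (1 / ((k:ℝ) + 1))) * C)
          + ∑ p ∈ cidx k, ‖(c (ψ m) k p : ℝ) - (c (ψ n) k p : ℝ)‖ₑ * volume (cell k p) := by
          rw [two_mul (ENNReal.ofReal (2 * (1 / ((k:ℝ) + 1))) * C)]; gcongr <;> exact hen _
      _ < δ / 2 + δ / 2 := ENNReal.add_lt_add hk hN'
      _ = δ := ENNReal.add_halves δ
  have hpos : ∀ j : ℕ, (0:ℝ≥0∞) < (1 / 2) ^ j := fun j => ENNReal.pow_pos (by simp) j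
  choose N hN using fun j : ℕ => hcau ((1 / 2) ^ j) (hpos j)
  -- increasing choice
  set θ : ℕ → ℕ := fun j => (∑ i ∈ Finset.range (j + 1), N i) + j with hθ
  have hθm : StrictMono θ := by
    refine strictMono_nat_of_lt_succ fun j => ?_
    simp only [hθ]
    rw [Finset.sum_range_succ _ (j + 1)]
    omega
  have hθN : ∀ j, N j ≤ θ j := fun j => by
    have := Finset.single_le_sum (f := N) (fun i _ => Nat.zero_le _) (Finset.self_mem_range_succ j)
    simp only [hθ]; omega
  refine ⟨ψ ∘ θ, hψ.comp hθm, ?_⟩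
  refine Lp.ae_tendsto_of_cauchy_eLpNorm (p := 1) (f := fun n => v ((ψ ∘ θ) n)) (B := fun j => (1 / 2) ^ j)
    (fun n => (hv _).continuous.aestronglyMeasurable) le_rfl ?_ ?_
  · rw [ENNReal.tsum_geometric]; simp
  · intro J n m hn hm
    rw [eLpNorm_one_eq_lintegral_enorm]
    exact hN J _ ((hθN J).trans (hθm.monotone hn)) _ ((hθN J).trans (hθm.monotone hm))
end


noncomputable section
open scoped Topology

theorem extract {v : ℕ → ℝ × ℝ → ℝ} (hv : ∀ n, ContDiff ℝ 1 (v n))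
    (h01 : ∀ n z, 0 ≤ v n z ∧ v n z ≤ 1) {C : ℝ≥0∞} (hC : C ≠ ⊤)
    (hen : ∀ n, ∫⁻ z in Isq, gm (v n) z ≤ C) {R : ℕ → Set (ℝ × ℝ)} (hR : ∀ n, MeasurableSet (R n))
    (hRs : ∀ n, R n ⊆ Isq)
    (hcl : ∀ n, ∫⁻ z in Isq, ‖v n z - (R n).indicator (fun _ => (1:ℝ)) z‖ₑ ≤ (1 / 2) ^ n) :
    ∃ φ : ℕ → ℕ, StrictMono φ ∧ ∃ E, MeasurableSet E ∧ E ⊆ Isq ∧ ConvE (fun n => v (φ n)) E ∧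
      ∀ᵐ z, Tendsto (fun n => (R (φ n)).indicator (fun _ => (1:ℝ)) z) atTop
        (𝓝 (E.indicator (fun _ => (1:ℝ)) z)) := by
  obtain ⟨φ, hφ, hae⟩ := bv_compact hv h01 hC hen
  have hvm : ∀ n, Measurable (v n) := fun n => (hv n).continuous.measurable
  have hsum : ∀ᵐ z ∂(volume.restrict Isq),
      Tendsto (fun n => ‖v n z - (R n).indicator (fun _ => (1:ℝ)) z‖ₑ) atTop (𝓝 0) := by
    have hm : ∀ n, Measurable (fun z => ‖v n z - (R n).indicator (fun _ => (1:ℝ)) z‖ₑ) := fun n =>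
      ((hvm n).sub (measurable_const.indicator (hR n))).enorm
    have h1 : ∫⁻ z in Isq, ∑' n, ‖v n z - (R n).indicator (fun _ => (1:ℝ)) z‖ₑ ≠ ⊤ := by
      rw [lintegral_tsum fun n => (hm n).aemeasurable]
      refine ((ENNReal.tsum_le_tsum hcl).trans_lt ?_).ne
      rw [ENNReal.tsum_geometric]
      simp
    have h2 := ae_lt_top (Measurable.ennreal_tsum hm) h1
    filter_upwards [h2] with z hz
    exact ENNReal.tendsto_atTop_zero_of_tsum_ne_top hz.ne
  set E : Set (ℝ × ℝ) := {z | z ∈ Isq ∧ 1 / 2 ≤ liminf (fun n => v (φ n) z) atTop} with hE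
  have hEm : MeasurableSet E := by
    refine Isq_meas.inter ?_
    exact measurableSet_le measurable_const (Measurable.liminf fun n => hvm (φ n))
  have key : ∀ᵐ z ∂(volume.restrict Isq), z ∈ Isq →
      Tendsto (fun n => v (φ n) z) atTop (𝓝 (E.indicator (fun _ => (1:ℝ)) z)) ∧
      Tendsto (fun n => (R (φ n)).indicator (fun _ => (1:ℝ)) z) atTop
        (𝓝 (E.indicator (fun _ => (1:ℝ)) z)) := by
    filter_upwards [hae, hsum] with z ⟨l, hl⟩ hs hz
    have hs' : Tendsto (fun n => v n z - (R n).indicator (fun _ => (1:ℝ)) z) atTop (𝓝 0) := by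
      rw [tendsto_zero_iff_norm_tendsto_zero]
      have := (ENNReal.tendsto_toReal (by simp : (0:ℝ≥0∞) ≠ ⊤)).comp hs
      simpa [Function.comp_def] using this
    have h3 : Tendsto (fun n => (R (φ n)).indicator (fun _ => (1:ℝ)) z) atTop (𝓝 l) := by
      have := hl.sub (hs'.comp hφ.tendsto_atTop)
      simpa [Function.comp_def] using this
    have hl01 : l ∈ ({0, 1} : Set ℝ) := by
      have hc : IsClosed ({0, 1} : Set ℝ) := (Set.toFinite _).isClosed
      refine hc.mem_of_tendsto h3 (Eventually.of_forall fun n => ?_)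
      by_cases h : z ∈ R (φ n) <;> simp [h]
    have hli : liminf (fun n => v (φ n) z) atTop = l := hl.liminf_eq
    have hEl : E.indicator (fun _ => (1:ℝ)) z = l := by
      rcases hl01 with rfl | h
      · have : z ∉ E := fun h => by
          have := h.2; rw [hli] at this; norm_num at this
        simp [this]
      · have h' : l = 1 := h
        subst h'
        have : z ∈ E := ⟨hz, by rw [hli]; norm_num⟩
        simp [this]
    rw [hEl]; exact ⟨hl, h3⟩
  rw [ae_restrict_iff' Isq_meas] at key
  refine ⟨φ, hφ, E, hEm, fun z hz => hz.1, ?_, ?_⟩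
  · filter_upwards [key] with z hz h using (hz h h).1
  · filter_upwards [key] with z hz
    by_cases h : z ∈ Isq
    · exact (hz h h).2
    · have h1 : z ∉ E := fun h' => h h'.1
      have h2 : ∀ n, z ∉ R (φ n) := fun n h' => h (hRs _ h')
      simp [h1, h2]

/-- passing to the limit in integrals -/
theorem lim_int {R : ℕ → Set (ℝ × ℝ)} (hR : ∀ n, MeasurableSet (R n)) (hRs : ∀ n, R n ⊆ Isq)
    {E : Set (ℝ × ℝ)} (hE : MeasurableSet E)
    (hc : ∀ᵐ z, Tendsto (fun n => (R n).indicator (fun _ => (1:ℝ)) z) atTop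
        (𝓝 (E.indicator (fun _ => (1:ℝ)) z))) {g : ℝ × ℝ → ℝ} (hg : Continuous g) :
    Tendsto (fun n => ∫ z in R n, g z) atTop (𝓝 (∫ z in E, g z)) := by
  have e : ∀ S : Set (ℝ × ℝ), MeasurableSet S → ∫ z in S, g z = ∫ z, S.indicator (fun _ => (1:ℝ)) z * g z := by
    intro S hS
    rw [← integral_indicator hS]
    congr 1; ext z
    by_cases h : z ∈ S <;> simp [h]
  rw [e E hE]
  simp_rw [fun n => e (R n) (hR n)]
  have hi : Integrable (Isq.indicator fun z => |g z|) := by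
    rw [integrable_indicator_iff Isq_meas]
    exact hg.abs.continuousOn.integrableOn_compact Isq_compact
  refine tendsto_integral_of_dominated_convergence _ (fun n => ?_) hi (fun n => ae_of_all _ fun z => ?_) ?_
  · exact ((measurable_const.indicator (hR n)).mul hg.measurable).aestronglyMeasurable
  · by_cases h : z ∈ R n
    · simp [h, hRs n h]
    · simp [h]; exact indicator_nonneg (fun _ _ => abs_nonneg _) _
  · filter_upwards [hc] with z hz using hz.mul_const _

theorem lim_vol {R : ℕ → Set (ℝ × ℝ)} (hR : ∀ n, MeasurableSet (R n)) (hRs : ∀ n, R n ⊆ Isq)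
    {E : Set (ℝ × ℝ)} (hE : MeasurableSet E) (hEs : E ⊆ Isq)
    (hc : ∀ᵐ z, Tendsto (fun n => (R n).indicator (fun _ => (1:ℝ)) z) atTop
        (𝓝 (E.indicator (fun _ => (1:ℝ)) z))) {S : Set (ℝ × ℝ)} (hS : MeasurableSet S) :
    Tendsto (fun n => volume (R n ∩ S)) atTop (𝓝 (volume (E ∩ S))) := by
  have hc' : ∀ᵐ z, Tendsto (fun n => (R n ∩ S).indicator (fun _ => (1:ℝ)) z) atTop
        (𝓝 ((E ∩ S).indicator (fun _ => (1:ℝ)) z)) := by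
    filter_upwards [hc] with z hz
    by_cases h : z ∈ S
    · have : ∀ T : Set (ℝ × ℝ), (T ∩ S).indicator (fun _ => (1:ℝ)) z = T.indicator (fun _ => (1:ℝ)) z := by
        intro T; by_cases h' : z ∈ T <;> simp [h, h']
      simp only [this]; exact hz
    · simp [h]
  have := lim_int (fun n => (hR n).inter hS) (fun n => inter_subset_left.trans (hRs n)) (hE.inter hS)
    hc' (continuous_const (y := (1:ℝ)))
  simp only [integral_const, smul_eq_mul, mul_one, MeasurableSet.univ, measureReal_restrict_apply, univ_inter] at this
  have hf : ∀ T : Set (ℝ × ℝ), T ⊆ Isq → volume T ≠ ⊤ := fun T hT =>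
    ((measure_mono hT).trans_lt (by rw [Isq_vol]; simp)).ne
  have h2 := ENNReal.tendsto_ofReal this
  simp only [measureReal_def] at h2
  rw [ENNReal.ofReal_toReal (hf _ (inter_subset_left.trans hEs))] at h2
  refine h2.congr fun n => ?_
  rw [ENNReal.ofReal_toReal (hf _ (inter_subset_left.trans (hRs n)))]
end


noncomputable section
open scoped Topology

theorem IsNorm2.nonneg {τ : ℝ × ℝ → ℝ} (h : IsNorm2 τ) (x : ℝ × ℝ) : 0 ≤ τ x := by
  have h1 := h.2.2 x ((-1:ℝ) • x)
  rw [h.2.1] at h1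
  have h0 : x + (-1:ℝ) • x = 0 := by simp
  rw [h0, (h.1 0).2 rfl] at h1
  norm_num at h1; linarith

theorem IsNorm2.neg {τ : ℝ × ℝ → ℝ} (h : IsNorm2 τ) (x : ℝ × ℝ) : τ (-x) = τ x := by
  have := h.2.1 (-1) x
  simpa using this

theorem IsNorm2.cont {τ : ℝ × ℝ → ℝ} (h : IsNorm2 τ) : Continuous τ := by
  have hb : ∀ x, τ x ≤ (τ (1,0) + τ (0,1)) * ‖x‖ := fun x => by
    have e : x = x.1 • ((1:ℝ),(0:ℝ)) + x.2 • ((0:ℝ),(1:ℝ)) := by ext <;> simp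
    have h1 := h.2.2 (x.1 • ((1:ℝ),(0:ℝ))) (x.2 • ((0:ℝ),(1:ℝ)))
    rw [← e, h.2.1, h.2.1] at h1
    have h2 : |x.1| ≤ ‖x‖ := norm_fst_le x
    have h3 : |x.2| ≤ ‖x‖ := norm_snd_le x
    nlinarith [h.nonneg (1,0), h.nonneg (0,1)]
  have hd : ∀ x y, τ x - τ y ≤ τ (x - y) := fun x y => by
    have := h.2.2 (x - y) y
    rw [sub_add_cancel] at this; linarith
  have hl : LipschitzWith (Real.toNNReal (τ (1,0) + τ (0,1))) τ := by
    apply LipschitzWith.of_dist_le_mul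
    intro x y
    rw [Real.coe_toNNReal _ (add_nonneg (h.nonneg _) (h.nonneg _)), Real.dist_eq, dist_eq_norm, abs_le]
    have h1 := hb (x - y)
    have h2 := hb (y - x)
    rw [norm_sub_rev] at h2
    constructor <;> linarith [hd x y, hd y x]
  exact hl.continuous

theorem IsNorm2.min {τ : ℝ × ℝ → ℝ} (h : IsNorm2 τ) :
    ∃ c > 0, (∀ v, c * ‖v‖ ≤ τ v) ∧ ∃ a : ℝ × ℝ, ‖a‖ = 1 ∧ τ a = c := by
  have hK : IsCompact (Metric.sphere (0:ℝ × ℝ) 1) := isCompact_sphere _ _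
  have hne : (Metric.sphere (0:ℝ × ℝ) 1).Nonempty := ⟨(1,0), by simp [Prod.norm_def]⟩
  obtain ⟨a, ha, hm⟩ := hK.exists_isMinOn hne h.cont.continuousOn
  have ha1 : ‖a‖ = 1 := by simpa using ha
  refine ⟨τ a, ?_, fun v => ?_, a, ha1, rfl⟩
  · refine lt_of_le_of_ne (h.nonneg a) fun h0 => ?_
    rw [(h.1 a).1 h0.symm] at ha1; simp at ha1
  · by_cases hv : v = 0
    · subst hv; simp [(h.1 0).2 rfl]
    · have hn : 0 < ‖v‖ := norm_pos_iff.2 hv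
      have h1 : τ a ≤ τ (‖v‖⁻¹ • v) := hm (by simp [norm_smul, hn.ne'])
      rw [h.2.1, abs_of_pos (inv_pos.2 hn)] at h1
      rw [inv_mul_eq_div, le_div_iff₀ hn] at h1
      exact h1

theorem dual_le {τ : ℝ × ℝ → ℝ} (h : IsNorm2 τ) {c : ℝ} (hc : 0 < c) (hv : ∀ v, c * ‖v‖ ≤ τ v)
    {w : ℝ × ℝ} (hw : |w.1| + |w.2| ≤ 1) : dualNorm τ (c • w) ≤ 1 := by
  unfold dualNorm
  apply csSup_le
  · exact ⟨0, 0, by simp [(h.1 0).2 rfl]⟩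
  rintro x ⟨v, hv1, rfl⟩
  have h1 := (hv v).trans hv1
  have h2 : |v.1| ≤ ‖v‖ := norm_fst_le v
  have h3 : |v.2| ≤ ‖v‖ := norm_snd_le v
  have h4 : v.1 * w.1 ≤ ‖v‖ * |w.1| := by
    calc v.1 * w.1 ≤ |v.1 * w.1| := le_abs_self _
      _ = |v.1| * |w.1| := abs_mul _ _
      _ ≤ _ := by gcongr
  have h5 : v.2 * w.2 ≤ ‖v‖ * |w.2| := by
    calc v.2 * w.2 ≤ |v.2 * w.2| := le_abs_self _
      _ = |v.2| * |w.2| := abs_mul _ _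
      _ ≤ _ := by gcongr
  have h6 : v.1 * w.1 + v.2 * w.2 ≤ ‖v‖ := by nlinarith [norm_nonneg v]
  simp only [Prod.smul_fst, Prod.smul_snd, smul_eq_mul]
  nlinarith

theorem dual_ge {τ : ℝ × ℝ → ℝ} (h : IsNorm2 τ) {c : ℝ} (hc : 0 < c) (hv : ∀ v, c * ‖v‖ ≤ τ v)
    {w : ℝ × ℝ} (hw : dualNorm τ w ≤ 1) (v : ℝ × ℝ) : v.1 * w.1 + v.2 * w.2 ≤ τ v := by
  by_cases h0 : v = 0
  · subst h0; simp [(h.1 0).2 rfl]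
  have hp : 0 < τ v := lt_of_le_of_ne (h.nonneg v) fun h1 => h0 ((h.1 v).1 h1.symm)
  have hb : BddAbove {x | ∃ v : ℝ × ℝ, τ v ≤ 1 ∧ x = v.1 * w.1 + v.2 * w.2} := by
    refine ⟨c⁻¹ * |w.1| + c⁻¹ * |w.2|, ?_⟩
    rintro x ⟨u, hu, rfl⟩
    have h1 := (hv u).trans hu
    have h1' : ‖u‖ ≤ c⁻¹ := by
      rw [← one_div, le_div_iff₀ hc]; linarith
    have h2 : |u.1| ≤ c⁻¹ := (norm_fst_le u).trans h1'
    have h3 : |u.2| ≤ c⁻¹ := (norm_snd_le u).trans h1'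
    have h4 : u.1 * w.1 ≤ c⁻¹ * |w.1| := by
      calc u.1 * w.1 ≤ |u.1 * w.1| := le_abs_self _
        _ = |u.1| * |w.1| := abs_mul _ _
        _ ≤ _ := by gcongr
    have h5 : u.2 * w.2 ≤ c⁻¹ * |w.2| := by
      calc u.2 * w.2 ≤ |u.2 * w.2| := le_abs_self _
        _ = |u.2| * |w.2| := abs_mul _ _
        _ ≤ _ := by gcongr
    linarith
  have h1 : ((τ v)⁻¹ • v).1 * w.1 + ((τ v)⁻¹ • v).2 * w.2 ≤ 1 :=
    (le_csSup hb ⟨(τ v)⁻¹ • v, by rw [h.2.1, abs_of_pos (inv_pos.2 hp), inv_mul_cancel₀ hp.ne'], rfl⟩).trans hw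
  simp only [Prod.smul_fst, Prod.smul_snd, smul_eq_mul] at h1
  have h2 : (v.1 * w.1 + v.2 * w.2) / τ v ≤ 1 := by
    calc _ = (τ v)⁻¹ * v.1 * w.1 + (τ v)⁻¹ * v.2 * w.2 := by ring
      _ ≤ 1 := h1
  rwa [div_le_one hp] at h2

theorem L1_bound {τ : ℝ × ℝ → ℝ} (h : IsNorm2 τ) {c : ℝ} (hc : 0 < c) (hv : ∀ v, c * ‖v‖ ≤ τ v)
    {R : Set (ℝ × ℝ)} {M : ℝ} (hM0 : 0 ≤ M) (hR : surfE τ R ≤ ENNReal.ofReal (c * M)) :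
    ∀ f : ℝ × ℝ → ℝ × ℝ, ContDiff ℝ (⊤:ℕ∞) f → HasCompactSupport f → tsupport f ⊆ Osq →
      (∀ x, |(f x).1| + |(f x).2| ≤ 1) → ∫ x in R, div2 f x ≤ M := by
  intro f hf hs ht h1
  have hd : ∀ x, div2 (fun z => c • f z) x = c * div2 f x := fun x => by
    have := fderiv_const_smul (f := f) (x := x) ((hf.differentiable (by simp)) x) c
    unfold div2
    rw [show (fun z => c • f z) = c • f from rfl, this]
    simp; ring
  have h2 : ENNReal.ofReal (∫ x in R, div2 (fun z => c • f z) x) ≤ surfE τ R := by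
    unfold surfE
    refine le_iSup₂_of_le (fun z => c • f z) ⟨hf.const_smul c, ?_, ?_, fun x => ?_⟩ le_rfl
    · exact hs.smul_left (f := fun _ => c)
    · exact (tsupport_smul_subset_right (fun _ => c) f).trans ht
    · exact dual_le h hc hv (h1 x)
  have h3 := h2.trans hR
  rw [ENNReal.ofReal_le_ofReal_iff (by positivity)] at h3
  simp_rw [hd] at h3
  rw [integral_const_mul] at h3
  exact le_of_mul_le_mul_left h3 hc

theorem div2_zero {f : ℝ × ℝ → ℝ × ℝ} (h0 : ∀ z, z ∉ Isq → f z = 0) {z : ℝ × ℝ} (hz : z ∉ Isq) :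
    div2 f z = 0 := by
  have h1 : f =ᶠ[𝓝 z] fun _ => 0 := by
    filter_upwards [Isq_compact.isClosed.isOpen_compl.mem_nhds hz] with w hw
    exact h0 w hw
  unfold div2
  rw [h1.fderiv_eq]; simp

theorem div2_cont {f : ℝ × ℝ → ℝ × ℝ} (hf : ContDiff ℝ 1 f) : Continuous (div2 f) := by
  have h1 := hf.continuous_fderiv (by simp)
  unfold div2
  fun_prop

def shr (s : ℝ) : ℝ × ℝ →L[ℝ] ℝ × ℝ :=
  (ContinuousLinearMap.fst ℝ ℝ ℝ - s • ContinuousLinearMap.snd ℝ ℝ ℝ).prod (ContinuousLinearMap.snd ℝ ℝ ℝ)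

theorem shr_apply (s : ℝ) (z : ℝ × ℝ) : shr s z = (z.1 - s * z.2, z.2) := by simp [shr]

theorem shr_mp (s : ℝ) : MeasurePreserving (shr s) volume volume := by
  have h1 : MeasurePreserving (fun p : ℝ × ℝ => (p.1, p.2 - s * p.1)) volume volume := by
    refine MeasurePreserving.skew_product (f := id) (g := fun a b => b - s * a)
      (MeasurePreserving.id volume) (by unfold Function.uncurry; fun_prop) (Eventually.of_forall fun a => ?_)
    exact (measurePreserving_sub_right volume (s * a)).map_eq
  have h2 := (Measure.measurePreserving_swap (μ := (volume : Measure ℝ)) (ν := (volume : Measure ℝ)))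
  have := h2.comp (h1.comp h2)
  have e : (shr s : ℝ × ℝ → ℝ × ℝ) = Prod.swap ∘ (fun p => (p.1, p.2 - s * p.1)) ∘ Prod.swap := by
    ext z <;> simp [shr_apply]
  rw [e]; exact this

theorem G0 {f : ℝ × ℝ → ℝ × ℝ} (hf : ContDiff ℝ 1 f) (h0 : ∀ z, z ∉ Isq → f z = 0) {s K : ℝ}
    (hs : |s| ≤ 1) (hK0 : 0 ≤ K) (hK : ∀ z, (f z).1 + s * (f z).2 ≤ K) :
    ∫ z in gset (fun y => - s * y) 1, div2 f z ≤ 2 * K := by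
  have hs' := abs_le.1 hs
  have hsy : ∀ y ∈ Icc (-1:ℝ) 1, |s * y| ≤ 1 := fun y hy => by
    rw [abs_mul]
    have := abs_le.2 hy
    nlinarith [abs_nonneg s, abs_nonneg y]
  have hinj : Function.Injective (shr s) := fun z w h => by
    rw [shr_apply, shr_apply, Prod.mk.injEq] at h
    ext
    · have := h.1; rw [h.2] at this; linarith
    · exact h.2
  have hemb : MeasurableEmbedding (shr s) := (shr s).continuous.measurableEmbedding hinj
  have hdc := div2_cont hf
  rw [← (shr_mp s).setIntegral_preimage_emb hemb]
  have hsub : shr s ⁻¹' gset (fun y => - s * y) 1 ⊆ Icc ((-3:ℝ),(-3:ℝ)) (0,3) := by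
    intro z hz
    rw [mem_preimage, shr_apply] at hz
    obtain ⟨hz1, hz2⟩ := hz
    rw [mem_Isq_iff] at hz1
    simp only at hz1 hz2
    have := abs_le.1 (hsy z.2 ⟨hz1.1.2, hz1.2.2⟩)
    rw [Set.mem_Icc, Prod.le_def, Prod.le_def]
    simp only
    refine ⟨⟨?_, ?_⟩, ?_, ?_⟩ <;> linarith
  have e1 := setIntegral_eq_of_subset_of_forall_diff_eq_zero (μ := volume) (f := fun z => div2 f (shr s z))
    measurableSet_Icc hsub (by
      rintro z ⟨hz, hn⟩
      refine div2_zero h0 fun hI => hn ⟨hI, ?_⟩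
      rw [shr_apply]
      have := hz.2.1
      simp only at this ⊢
      linarith)
  rw [← e1]
  have hfd : ∀ z, HasFDerivAt f (fderiv ℝ f z) z := fun z => (hf.differentiable (by simp) z).hasFDerivAt
  have hfz : ∀ z, HasFDerivAt (fun p => f (shr s p)) ((fderiv ℝ f (shr s z)).comp (shr s)) z := fun z =>
    (hfd (shr s z)).comp z (shr s).hasFDerivAt
  have hd : ∀ z, div2 f (shr s z) =
      (((ContinuousLinearMap.fst ℝ ℝ ℝ + s • ContinuousLinearMap.snd ℝ ℝ ℝ).comp ((fderiv ℝ f (shr s z)).comp (shr s)) : ℝ × ℝ →L[ℝ] ℝ) (1,0))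
      + (((ContinuousLinearMap.snd ℝ ℝ ℝ).comp ((fderiv ℝ f (shr s z)).comp (shr s)) : ℝ × ℝ →L[ℝ] ℝ) (0,1)) := fun z => by
    have e : shr s (0,1) = (0,1) - s • ((1:ℝ),(0:ℝ)) := by rw [shr_apply]; simp
    have e' : shr s (1,0) = (1,0) := by rw [shr_apply]; simp
    simp only [ContinuousLinearMap.comp_apply, e, e', map_sub, map_smul]
    simp [div2]
  simp_rw [hd]
  rw [integral_divergence_prod_Icc_of_hasFDerivAt_of_le (fun z => (f (shr s z)).1 + s * (f (shr s z)).2) (fun z => (f (shr s z)).2)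
    _ _ ((-3:ℝ),(-3:ℝ)) (0,3) ?_ ?_ ?_ ?_ ?_ ?_]
  · have z1 : ∀ x, f (shr s (x, 3)) = 0 := fun x => h0 _ fun h => by
      rw [shr_apply, mem_Isq_iff] at h; have := h.2.2; norm_num at this
    have z2 : ∀ x, f (shr s (x, -3)) = 0 := fun x => h0 _ fun h => by
      rw [shr_apply, mem_Isq_iff] at h; have := h.1.2; norm_num at this
    have z3 : ∀ y, f (shr s (-3, y)) = 0 := fun x => h0 _ fun h => by
      rw [shr_apply, mem_Isq_iff] at h
      have h1 := h.1.1
      have := abs_le.1 (hsy x ⟨h.1.2, h.2.2⟩)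
      simp only at h1; linarith
    simp only [z1, z2, z3]
    simp only [Prod.fst_zero, Prod.snd_zero, mul_zero, add_zero, intervalIntegral.integral_zero, sub_zero, zero_add]
    have hc : Continuous fun y => (f (shr s (0,y))).1 + s * (f (shr s (0,y))).2 := by
      have := hf.continuous; have := (shr s).continuous; fun_prop
    have hz : ∀ y, y ∉ Icc (-1:ℝ) 1 → (f (shr s (0,y))).1 + s * (f (shr s (0,y))).2 = 0 := fun y hy => by
      rw [h0]
      · simp
      · intro h; rw [shr_apply, mem_Isq_iff] at h; exact hy ⟨h.1.2, h.2.2⟩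
    rw [intervalIntegral.integral_of_le (by norm_num)]
    have e2 := setIntegral_eq_of_subset_of_forall_diff_eq_zero (μ := volume) (s := Icc (-1:ℝ) 1) (t := Ioc (-3:ℝ) 3)
      measurableSet_Ioc (fun y hy => ⟨by linarith [hy.1], by linarith [hy.2]⟩) (fun y hy => hz y hy.2)
    rw [e2]
    have e3 : ∫ y in Icc (-1:ℝ) 1, ((f (shr s (0,y))).1 + s * (f (shr s (0,y))).2) ≤ ∫ y in Icc (-1:ℝ) 1, K := by
      refine setIntegral_mono ?_ ?_ fun y => hK _
      · exact hc.continuousOn.integrableOn_compact isCompact_Icc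
      · exact integrableOn_const (by simp)
    refine e3.trans ?_
    simp; norm_num
  · rw [Prod.le_def]; norm_num
  · have := hf.continuous; have := (shr s).continuous; fun_prop
  · have := hf.continuous; have := (shr s).continuous; fun_prop
  · intro z _
    have := (ContinuousLinearMap.fst ℝ ℝ ℝ + s • ContinuousLinearMap.snd ℝ ℝ ℝ).hasFDerivAt.comp z (hfz z)
    exact this
  · intro z _
    exact (ContinuousLinearMap.snd ℝ ℝ ℝ).hasFDerivAt.comp z (hfz z)
  · simp_rw [← hd]
    exact (hdc.comp (shr s).continuous).continuousOn.integrableOn_compact isCompact_Icc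

end


noncomputable section
open scoped Topology

def swL : ℝ × ℝ →L[ℝ] ℝ × ℝ := (ContinuousLinearMap.snd ℝ ℝ ℝ).prod (ContinuousLinearMap.fst ℝ ℝ ℝ)

theorem swL_apply (z : ℝ × ℝ) : swL z = (z.2, z.1) := by simp [swL]

theorem swap_div {f : ℝ × ℝ → ℝ × ℝ} (hf : ContDiff ℝ 1 f) (w : ℝ × ℝ) :
    div2 (fun z => swL (f (swL z))) w = div2 f (swL w) := by
  have h1 : HasFDerivAt (fun z => swL (f (swL z))) (swL.comp ((fderiv ℝ f (swL w)).comp swL)) w :=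
    swL.hasFDerivAt.comp w
      (((hf.differentiable (by simp) (swL w)).hasFDerivAt).comp w swL.hasFDerivAt)
  unfold div2
  rw [h1.fderiv]
  simp [swL_apply, add_comm]

theorem G0_swap {f : ℝ × ℝ → ℝ × ℝ} (hf : ContDiff ℝ 1 f) (h0 : ∀ z, z ∉ Isq → f z = 0) {s K : ℝ}
    (hs : |s| ≤ 1) (hK0 : 0 ≤ K) (hK : ∀ z, s * (f z).1 + (f z).2 ≤ K) :
    ∫ z in swapS (gset (fun y => - s * y) 1), div2 f z ≤ 2 * K := by
  have hc : ContDiff ℝ 1 (fun z => swL (f (swL z))) :=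
    swL.contDiff.comp (hf.comp swL.contDiff)
  have h1 := G0 (f := fun z => swL (f (swL z))) hc (fun z hz => by
    rw [h0]
    · simp
    · rw [swL_apply]; intro h; apply hz
      have h := mem_Isq_iff.1 h
      exact mem_Isq_iff.2 ⟨⟨h.1.2, h.1.1⟩, h.2.2, h.2.1⟩) hs hK0 (fun z => by
        have := hK (swL z); rw [swL_apply (f _)]; simp only; linarith)
  have hinj : Function.Injective (fun z : ℝ × ℝ => (z.2, z.1)) := fun z w h => by
    rw [Prod.mk.injEq] at h; exact Prod.ext h.2 h.1
  have hemb : MeasurableEmbedding (fun z : ℝ × ℝ => (z.2, z.1)) :=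
    (by fun_prop : Continuous (fun z : ℝ × ℝ => (z.2, z.1))).measurableEmbedding hinj
  rw [← swap_mp.setIntegral_preimage_emb hemb] at h1
  simp_rw [swap_div hf] at h1
  simp only [swL_apply] at h1
  exact h1

theorem gset_vol {s : ℝ} (hs : |s| ≤ 1) : volume (gset (fun y => - s * y) 1) = 2 := by
  have hsy : ∀ y ∈ Icc (-1:ℝ) 1, |s * y| ≤ 1 := fun y hy => by
    rw [abs_mul]
    have := abs_le.2 hy
    nlinarith [abs_nonneg s, abs_nonneg y]
  have hm : MeasurableSet (gset (fun y => - s * y) 1) := (gset_closed (by fun_prop) 1).measurableSet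
  rw [Measure.volume_eq_prod, Measure.prod_apply_symm hm]
  have e : ∀ y : ℝ, volume ((fun x => (x, y)) ⁻¹' gset (fun y => - s * y) 1) =
      (Icc (-1:ℝ) 1).indicator (fun y => ENNReal.ofReal (1 - s * y)) y := fun y => by
    by_cases hy : y ∈ Icc (-1:ℝ) 1
    · have := abs_le.1 (hsy y hy)
      rw [indicator_of_mem hy]
      have e1 : (fun x => (x, y)) ⁻¹' gset (fun y => - s * y) 1 = Icc (-1) (- s * y) := by
        ext x
        simp only [gset, mem_preimage, mem_ofPred_eq, mem_Isq_iff, Set.mem_Icc]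
        constructor
        · rintro ⟨h1, h2⟩; exact ⟨h1.1.1, by linarith⟩
        · rintro ⟨h1, h2⟩; exact ⟨⟨⟨h1, hy.1⟩, by linarith, hy.2⟩, by linarith⟩
      rw [e1, Real.volume_Icc]; congr 1; ring
    · rw [indicator_of_notMem hy]
      have e1 : (fun x => (x, y)) ⁻¹' gset (fun y => - s * y) 1 = ∅ := by
        ext x
        simp only [gset, mem_preimage, mem_ofPred_eq, mem_Isq_iff, mem_empty_iff_false, iff_false]
        rintro ⟨h1, h2⟩; exact hy ⟨h1.1.2, h1.2.2⟩
      rw [e1]; simp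
  simp_rw [e]
  rw [lintegral_indicator measurableSet_Icc, ← ofReal_integral_eq_lintegral_ofReal]
  · rw [integral_Icc_eq_integral_Ioc, ← intervalIntegral.integral_of_le (by norm_num)]
    have : ∫ y in (-1:ℝ)..1, (1 - s * y) = 2 := by
      rw [intervalIntegral.integral_sub (by simp) (Continuous.intervalIntegrable (by fun_prop) _ _)]
      rw [intervalIntegral.integral_const_mul]; simp; norm_num
    rw [this]; simp
  · exact (by fun_prop : Continuous fun y => 1 - s * y).continuousOn.integrableOn_compact isCompact_Icc
  · rw [EventuallyLE, ae_restrict_iff' measurableSet_Icc]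
    refine Eventually.of_forall fun y hy => ?_
    have := abs_le.1 (hsy y hy)
    simp only [Pi.zero_apply]; linarith

theorem Nice.memR {R : Set (ℝ × ℝ)} (h : Nice R) : MemR R := by
  refine ⟨h.comp, h.sub, h.int, {frontier R}, ?_, ?_, ?_⟩
  · intro C hC; rw [Finset.mem_singleton] at hC; rw [hC]; exact h.jor
  · simp
  · intro C hC C' hC' hne
    rw [Finset.mem_singleton] at hC hC'; exact absurd (hC.trans hC'.symm) hne

theorem exists_H {τ : ℝ × ℝ → ℝ} (h : IsNorm2 τ) {c : ℝ} (hc : 0 < c) (hv : ∀ v, c * ‖v‖ ≤ τ v)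
    (ha : ∃ a : ℝ × ℝ, ‖a‖ = 1 ∧ τ a = c) :
    ∃ H, Nice H ∧ volume H = 2 ∧ surfE τ H ≤ ENNReal.ofReal (2 * c) := by
  have ha' : ∃ a : ℝ × ℝ, ((a.1 = 1 ∧ |a.2| ≤ 1) ∨ (a.2 = 1 ∧ |a.1| ≤ 1)) ∧ τ a = c := by
    obtain ⟨a, h1, h2⟩ := ha
    have h3 : |a.1| ≤ 1 := h1 ▸ norm_fst_le a
    have h4 : |a.2| ≤ 1 := h1 ▸ norm_snd_le a
    rw [Prod.norm_def, Real.norm_eq_abs, Real.norm_eq_abs] at h1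
    rcases max_choice |a.1| |a.2| with h5 | h5
    · rw [h5] at h1
      rcases (abs_eq zero_le_one).1 h1 with h6 | h6
      · exact ⟨a, Or.inl ⟨h6, h4⟩, h2⟩
      · exact ⟨-a, Or.inl ⟨by simp [h6], by simpa using h4⟩, by rw [h.neg, h2]⟩
    · rw [h5] at h1
      rcases (abs_eq zero_le_one).1 h1 with h6 | h6
      · exact ⟨a, Or.inr ⟨h6, h3⟩, h2⟩
      · exact ⟨-a, Or.inr ⟨by simp [h6], by simpa using h3⟩, by rw [h.neg, h2]⟩
  have hnice : ∀ s : ℝ, |s| ≤ 1 → Nice (gset (fun y => - s * y) 1) := fun s hs => by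
    refine gset_nice ?_ ?_ ?_ (Or.inl rfl)
    · apply LipschitzWith.of_dist_le_mul
      intro x y
      rw [Real.dist_eq, Real.dist_eq, ← mul_sub, abs_mul, abs_neg, NNReal.coe_one]
      gcongr
    · intro y hy
      rw [Set.mem_Icc, ← abs_le, abs_mul, abs_neg]
      have := abs_le.2 hy
      nlinarith [abs_nonneg s, abs_nonneg y]
    · intro y hy
      rw [Set.mem_Ioo, ← abs_lt, abs_mul, abs_neg]
      have := abs_lt.2 hy
      nlinarith [abs_nonneg s, abs_nonneg y]
  have hz : ∀ f : ℝ × ℝ → ℝ × ℝ, tsupport f ⊆ Osq → ∀ z, z ∉ Isq → f z = 0 := fun f hf z hz =>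
    image_eq_zero_of_notMem_tsupport fun h => hz (Osq_subset_Isq (hf h))
  obtain ⟨a, h1 | h1, h2⟩ := ha'
  · refine ⟨gset (fun y => - a.2 * y) 1, hnice _ h1.2, gset_vol h1.2, ?_⟩
    unfold surfE
    refine iSup₂_le fun f hf => ENNReal.ofReal_le_ofReal ?_
    obtain ⟨hf1, hf2, hf3, hf4⟩ := hf
    refine G0 (hf1.of_le (by simp)) (hz f hf3) h1.2 hc.le fun z => ?_
    have := dual_ge h hc hv (hf4 z) a
    rw [h2, h1.1] at this; linarith
  · refine ⟨swapS (gset (fun y => - a.1 * y) 1), (hnice _ h1.2).swap, ?_, ?_⟩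
    · rw [swapS_vol (hnice _ h1.2).comp.measurableSet, gset_vol h1.2]
    unfold surfE
    refine iSup₂_le fun f hf => ENNReal.ofReal_le_ofReal ?_
    obtain ⟨hf1, hf2, hf3, hf4⟩ := hf
    refine G0_swap (hf1.of_le (by simp)) (hz f hf3) h1.2 hc.le fun z => ?_
    have := dual_ge h hc hv (hf4 z) a
    rw [h2, h1.1] at this; linarith

theorem phi_le {τ : ℝ × ℝ → ℝ} (h : IsNorm2 τ) {c : ℝ} (hc : 0 < c) (hv : ∀ v, c * ‖v‖ ≤ τ v)
    (ha : ∃ a : ℝ × ℝ, ‖a‖ = 1 ∧ τ a = c) : phiR τ 2 ≤ ENNReal.ofReal c := by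
  obtain ⟨H, h1, h2, h3⟩ := exists_H h hc hv ha
  unfold phiR
  refine iInf₂_le_of_le H ⟨h1.memR, by rw [h2]; simp⟩ ?_
  unfold conduct
  rw [if_neg (by rw [h2]; simp), h2]
  refine ENNReal.div_le_of_le_mul (h3.trans_eq ?_)
  rw [mul_comm 2 c, ENNReal.ofReal_mul hc.le]; simp

theorem phiR_anti {τ : ℝ × ℝ → ℝ} {a b : ℝ} (h : a ≤ b) : phiR τ b ≤ phiR τ a := by
  unfold phiR
  refine le_iInf₂ fun R hR => ?_
  exact iInf₂_le R ⟨hR.1, hR.2.trans (ENNReal.ofReal_le_ofReal h)⟩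

theorem surfE_congr {τ : ℝ × ℝ → ℝ} {E E' : Set (ℝ × ℝ)} (h : E =ᵐ[volume] E') : surfE τ E = surfE τ E' := by
  unfold surfE
  congr 1; ext f
  congr 1; ext hf
  rw [setIntegral_congr_set h]

theorem conduct_congr {τ : ℝ × ℝ → ℝ} {E E' : Set (ℝ × ℝ)} (h : E =ᵐ[volume] E') :
    conduct τ E = conduct τ E' := by
  unfold conduct
  rw [surfE_congr h, measure_congr h]

/-- Lower semicontinuity of the surface energy. -/
theorem surfE_lsc {τ : ℝ × ℝ → ℝ} {R : ℕ → Set (ℝ × ℝ)} {E : Set (ℝ × ℝ)}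
    (hR : ∀ n, MeasurableSet (R n)) (hRs : ∀ n, R n ⊆ Isq) (hE : MeasurableSet E)
    (hc : ∀ᵐ z, Tendsto (fun n => (R n).indicator (fun _ => (1:ℝ)) z) atTop
        (𝓝 (E.indicator (fun _ => (1:ℝ)) z)))
    {b : ℕ → ℝ≥0∞} {B : ℝ≥0∞} (hb : ∀ n, surfE τ (R n) ≤ b n) (hB : Tendsto b atTop (𝓝 B)) :
    surfE τ E ≤ B := by
  unfold surfE
  refine iSup₂_le fun f hf => ?_
  have h1 := lim_int hR hRs hE hc (div2_cont (hf.1.of_le (by simp)))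
  refine le_of_tendsto_of_tendsto (ENNReal.tendsto_ofReal h1) hB (Eventually.of_forall fun n => ?_)
  refine le_trans ?_ (hb n)
  unfold surfE
  exact le_iSup₂_of_le f hf le_rfl

end


noncomputable section
open scoped Topology

theorem limit_set {τ : ℝ × ℝ → ℝ} (hτ : IsNorm2 τ) {α : ℕ → ℝ} {R : ℕ → Set (ℝ × ℝ)}
    (hα : ∀ n, 0 < α n ∧ α n ≤ 1 / ((n:ℝ) + 1)) (hR : ∀ n, R n ∈ Ropt τ (2 + α n))
    (hvol : ∀ n, 2 < volume (R n)) :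
    ∃ φ : ℕ → ℕ, StrictMono φ ∧ ∃ E, Nice E ∧ volume E = 2 ∧ conduct τ E = phiR τ 2 ∧
      ∀ᵐ z, Tendsto (fun n => (R (φ n)).indicator (fun _ => (1:ℝ)) z) atTop
        (𝓝 (E.indicator (fun _ => (1:ℝ)) z)) := by
  obtain ⟨c, hc, hcv, ha⟩ := hτ.min
  have hp := phi_le hτ hc hcv ha
  have hRm : ∀ n, MeasurableSet (R n) := fun n => (hR n).1.1.measurableSet
  have hRs : ∀ n, R n ⊆ Isq := fun n => (hR n).1.2.1
  have hα0 : Tendsto α atTop (𝓝 0) :=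
    tendsto_of_tendsto_of_tendsto_of_le_of_le tendsto_const_nhds tendsto_one_div_add_atTop_nhds_zero_nat
      (fun n => (hα n).1.le) (fun n => (hα n).2)
  have hα1 : ∀ n, α n ≤ 1 := fun n => (hα n).2.trans (by
    rw [div_le_one (by positivity)]; have : (0:ℝ) ≤ n := Nat.cast_nonneg n; linarith)
  have hsurf : ∀ n, surfE τ (R n) ≤ phiR τ 2 * ENNReal.ofReal (2 + α n) := fun n => by
    have h0 : volume (R n) ≠ 0 := fun h => by have := hvol n; rw [h] at this; simp at this
    have ht : volume (R n) ≠ ⊤ := ((hR n).2.1.trans_lt ENNReal.ofReal_lt_top).ne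
    have h1 : conduct τ (R n) ≤ phiR τ 2 := by
      rw [(hR n).2.2]; exact phiR_anti (by linarith [(hα n).1])
    unfold conduct at h1
    rw [if_neg h0, ENNReal.div_le_iff h0 ht] at h1
    exact h1.trans (by gcongr; exact (hR n).2.1)
  have hM : ∀ n, surfE τ (R n) ≤ ENNReal.ofReal (c * (2 + α n)) := fun n => by
    rw [ENNReal.ofReal_mul hc.le]
    exact (hsurf n).trans (by gcongr)
  have hap := fun n => approx (hRm n) (hRs n)
    (L1_bound hτ hc hcv (by linarith [(hα n).1]) (hM n)) (η := (1/2:ℝ)^n) (by positivity)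
  choose v hv h01 hen hcl using hap
  have hpow : ∀ n : ℕ, ENNReal.ofReal ((1/2:ℝ)^n) = (1/2)^n := fun n => by
    rw [ENNReal.ofReal_pow (by norm_num)]
    congr 1
    rw [ENNReal.ofReal_div_of_pos (by norm_num)]; simp
  have hpow1 : ∀ n : ℕ, (1/2:ℝ)^n ≤ 1 := fun n => pow_le_one₀ (by norm_num) (by norm_num)
  obtain ⟨φ, hφ, E, hE, hEs, hconv, hae⟩ := extract hv h01 (C := ENNReal.ofReal 4) ENNReal.ofReal_ne_top
    (fun n => (hen n).trans (ENNReal.ofReal_le_ofReal (by linarith [hα1 n, hpow1 n]))) hRm hRs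
    (fun n => (hcl n).trans_eq (hpow n))
  have hαφ := hα0.comp hφ.tendsto_atTop
  have hlim2 : Tendsto (fun n => ENNReal.ofReal (2 + α (φ n))) atTop (𝓝 2) := by
    have : Tendsto (fun n => 2 + α (φ n)) atTop (𝓝 (2 + 0)) := tendsto_const_nhds.add hαφ
    have := ENNReal.tendsto_ofReal this
    simpa using this
  have hE2 : volume E = 2 := by
    have h1 := lim_vol (fun n => hRm (φ n)) (fun n => hRs (φ n)) hE hEs hae MeasurableSet.univ
    simp only [inter_univ] at h1
    have h2 : Tendsto (fun n => volume (R (φ n))) atTop (𝓝 2) :=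
      tendsto_of_tendsto_of_tendsto_of_le_of_le tendsto_const_nhds hlim2
        (fun n => (hvol (φ n)).le) (fun n => (hR (φ n)).2.1)
    exact tendsto_nhds_unique h1 h2
  have hlim : liminf (fun n => ∫⁻ z in Isq, gm (v (φ n)) z) atTop ≤ 2 := by
    have h1 : Tendsto (fun n => ENNReal.ofReal (2 + α (φ n) + (1/2:ℝ)^(φ n))) atTop (𝓝 2) := by
      have h0 : Tendsto (fun n => (1/2:ℝ)^(φ n)) atTop (𝓝 0) :=
        (_root_.tendsto_pow_atTop_nhds_zero_of_lt_one (by norm_num) (by norm_num)).comp hφ.tendsto_atTop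
      have : Tendsto (fun n => 2 + α (φ n) + (1/2:ℝ)^(φ n)) atTop (𝓝 (2 + 0 + 0)) :=
        (tendsto_const_nhds.add hαφ).add h0
      have := ENNReal.tendsto_ofReal this
      simpa using this
    rw [← h1.liminf_eq]
    exact liminf_le_liminf (Eventually.of_forall fun n => hen (φ n))
  have hsE : surfE τ E ≤ phiR τ 2 * 2 := by
    refine surfE_lsc (fun n => hRm (φ n)) (fun n => hRs (φ n)) hE hae (fun n => hsurf (φ n)) ?_
    exact ENNReal.Tendsto.const_mul hlim2 (Or.inl (by simp))
  have fin : ∀ E₀, Nice E₀ → (∀ᵐ z, z ∈ E ↔ z ∈ E₀) →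
      ∃ E, Nice E ∧ volume E = 2 ∧ conduct τ E = phiR τ 2 ∧
      ∀ᵐ z, Tendsto (fun n => (R (φ n)).indicator (fun _ => (1:ℝ)) z) atTop
        (𝓝 (E.indicator (fun _ => (1:ℝ)) z)) := by
    intro E₀ hn hq
    have hq' : E =ᵐ[volume] E₀ := by
      filter_upwards [hq] with z hz using propext hz
    have hv0 : volume E₀ = 2 := by rw [← measure_congr hq', hE2]
    refine ⟨E₀, hn, hv0, le_antisymm ?_ ?_, ?_⟩
    · unfold conduct
      rw [hv0, if_neg (by simp), ← surfE_congr hq']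
      exact ENNReal.div_le_of_le_mul hsE
    · unfold phiR
      exact iInf₂_le E₀ ⟨hn.memR, by rw [hv0]; simp⟩
    · filter_upwards [hae, hq] with z hz hzq
      have : E.indicator (fun _ => (1:ℝ)) z = E₀.indicator (fun _ => (1:ℝ)) z := by
        by_cases h : z ∈ E
        · simp [h, hzq.1 h]
        · have h' : z ∉ E₀ := fun h' => h (hzq.2 h')
          simp [h, h']
      rwa [← this]
  obtain ⟨G, hG, hI, hO, t, ht, hq | hq⟩ := limit_graph (fun n => hv (φ n)) hE hEs hE2 hconv hlim
  · exact ⟨φ, hφ, fin _ (gset_nice hG hI hO ht) hq⟩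
  · exact ⟨φ, hφ, fin _ (gset_nice hG hI hO ht).swap hq⟩

end


noncomputable section
open scoped Topology

theorem near_of_conv {R : ℕ → Set (ℝ × ℝ)} {E : Set (ℝ × ℝ)} (hN : Nice E)
    (hR : ∀ n, MeasurableSet (R n)) (hRs : ∀ n, R n ⊆ Isq)
    (hc : ∀ᵐ z, Tendsto (fun n => (R n).indicator (fun _ => (1:ℝ)) z) atTop
        (𝓝 (E.indicator (fun _ => (1:ℝ)) z))) {δ : ℝ} (hδ : 0 < δ) :
    ∀ᶠ n in atTop, ∀ x ∈ E, ∃ y ∈ R n, dist x y ≤ δ := by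
  obtain ⟨t, hts, htf, hcov⟩ := hN.comp.finite_cover_balls (half_pos hδ)
  have h1 : ∀ x ∈ t, ∀ᶠ n in atTop, (R n ∩ Metric.ball x (δ / 2)).Nonempty := fun x hx => by
    have h2 := lim_vol hR hRs hN.comp.measurableSet hN.sub hc
      (Metric.isOpen_ball (x := x) (ε := δ / 2)).measurableSet
    have h3 : volume (E ∩ Metric.ball x (δ / 2)) ≠ 0 := by
      have h4 : (interior E ∩ Metric.ball x (δ / 2)).Nonempty := by
        have := mem_closure_iff.1 (hN.reg (hts hx)) _ Metric.isOpen_ball (Metric.mem_ball_self (half_pos hδ))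
        rwa [inter_comm] at this
      have h5 := (isOpen_interior.inter Metric.isOpen_ball).measure_pos volume h4
      exact (h5.trans_le (measure_mono (inter_subset_inter_left _ interior_subset))).ne'
    filter_upwards [h2.eventually_ne h3] with n hn
    exact nonempty_of_measure_ne_zero hn
  have h2 := (eventually_all_finite htf).2 h1
  filter_upwards [h2] with n hn x hx
  obtain ⟨p, hp⟩ := mem_iUnion.1 (hcov hx)
  obtain ⟨hpt, hxp⟩ := mem_iUnion.1 hp
  obtain ⟨y, hy, hyp⟩ := hn p hpt
  refine ⟨y, hy, ?_⟩
  have h3 : dist x p < δ / 2 := hxp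
  have h4 : dist y p < δ / 2 := hyp
  have := dist_triangle_right x y p
  linarith

def Qh : Set (ℝ × ℝ) := gset (fun _ => 0) 1

theorem Qh_nice : Nice Qh := by
  unfold Qh
  refine gset_nice (LipschitzWith.const _ |>.weaken (by simp)) ?_ ?_ (Or.inl rfl)
  · intro y _; norm_num
  · intro y _; norm_num

theorem Isq_convex : Convex ℝ Isq := convex_Icc _ _

theorem Qh_convex : Convex ℝ Qh := by
  have : Qh = Isq ∩ {z : ℝ × ℝ | (ContinuousLinearMap.fst ℝ ℝ ℝ) z ≤ 0} := by
    ext z; simp [Qh, gset]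
  rw [this]
  exact Isq_convex.inter (convex_halfSpace_le (ContinuousLinearMap.fst ℝ ℝ ℝ).toLinearMap.isLinear 0)

def tiny (r : ℝ) (z : ℝ × ℝ) : Set (ℝ × ℝ) := AffineMap.homothety z r '' frontier Qh

theorem tiny_jor {r : ℝ} (hr : 0 < r) (z : ℝ × ℝ) : IsRectJordanCurve (tiny r z) := by
  refine Qh_nice.jor.image (K := r) ?_ ?_ hr.le ?_
  · exact AffineMap.homothety_continuous z r
  · intro u w h
    simp only [AffineMap.homothety_apply, vsub_eq_sub, vadd_eq_add] at h
    have h2 := smul_right_injective (ℝ × ℝ) hr.ne' (add_right_cancel h)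
    exact sub_left_injective h2
  · intro u w
    have : AffineMap.homothety z r u - AffineMap.homothety z r w = r • (u - w) := by
      simp only [AffineMap.homothety_apply, vsub_eq_sub, vadd_eq_add, add_sub_add_right_eq_sub, ← smul_sub,
        sub_sub_sub_cancel_right]
    rw [this]
    unfold eNorm2
    apply le_of_eq
    simp only [Prod.smul_fst, Prod.smul_snd, smul_eq_mul]
    rw [mul_pow, mul_pow, ← mul_add, Real.sqrt_mul (by positivity), Real.sqrt_sq hr.le]

theorem tiny_comp (r : ℝ) (z : ℝ × ℝ) : IsCompact (tiny r z) :=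
  (Qh_nice.comp.of_isClosed_subset isClosed_frontier Qh_nice.comp.isClosed.frontier_subset).image
    (AffineMap.homothety_continuous z r)

theorem tiny_null (r : ℝ) (z : ℝ × ℝ) : volume (tiny r z) = 0 := by
  unfold tiny
  rw [Measure.addHaar_image_homothety, Qh_convex.addHaar_frontier volume, mul_zero]

theorem tiny_near {r : ℝ} (hr : 0 < r) (hr1 : r ≤ 1) {z : ℝ × ℝ} (hz : z ∈ Isq) {y : ℝ × ℝ} (hy : y ∈ tiny r z) :
    y ∈ Isq ∧ dist z y ≤ 2 * r := by
  obtain ⟨u, hu, rfl⟩ := hy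
  have hu1 : u ∈ Isq := Qh_nice.sub (Qh_nice.comp.isClosed.frontier_subset hu)
  constructor
  · have := Isq_convex hz hu1 (by linarith : (0:ℝ) ≤ 1 - r) hr.le (by ring)
    convert this using 1
    simp only [AffineMap.homothety_apply, vsub_eq_sub, vadd_eq_add]
    module
  · rw [dist_center_homothety, Real.norm_eq_abs, abs_of_pos hr]
    have h1 : ‖z - u‖ ≤ ‖z‖ + ‖u‖ := norm_sub_le z u
    have h2 := Isq_norm.1 hz
    have h3 := Isq_norm.1 hu1
    rw [dist_eq_norm]
    nlinarith

theorem tiny_ne (r : ℝ) (z : ℝ × ℝ) : (tiny r z).Nonempty := by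
  obtain ⟨γ, h1, h2, h3, h4, h5⟩ := Qh_nice.jor
  refine Set.Nonempty.image _ ?_
  rw [h4]
  exact ⟨γ 0, 0, by simp, rfl⟩

theorem dirt {E R : Set (ℝ × ℝ)} (hN : Nice E) (hR : IsCompact R) (hRs : R ⊆ Isq) {ε : ℝ} (hε : 0 < ε) :
    ∃ E', MemR E' ∧ E' =ᵐ[volume] E ∧ E ⊆ E' ∧ (∀ x ∈ R, ∃ y ∈ E', dist x y ≤ ε) ∧
      ∀ y ∈ E', y ∈ E ∨ ∃ x ∈ R, dist x y ≤ ε := by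
  classical
  have hEne : E.Nonempty := hN.int.mono interior_subset
  set A : Set (ℝ × ℝ) := R ∩ {z | ε / 2 ≤ Metric.infDist z E} with hA
  have hAc : IsCompact A := hR.inter_right (isClosed_le continuous_const (Metric.continuous_infDist_pt E))
  obtain ⟨P, hPA, hPf, hcov⟩ := hAc.finite_cover_balls (half_pos hε)
  have hev : ∀ᶠ r : ℝ in 𝓝[>] 0, ∀ z ∈ P, ∀ w ∈ P, z ≠ w → 4 * r < dist z w := by
    refine (eventually_all_finite hPf).2 fun z _ => (eventually_all_finite hPf).2 fun w _ => ?_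
    by_cases h : z = w
    · exact Eventually.of_forall fun r hr => absurd h hr
    have hd := dist_pos.2 h
    have : ∀ᶠ r : ℝ in 𝓝[>] 0, r < dist z w / 4 :=
      (eventually_lt_nhds (by positivity)).filter_mono nhdsWithin_le_nhds
    filter_upwards [this] with r hr _
    linarith
  have hev2 : ∀ᶠ r : ℝ in 𝓝[>] 0, r < min 1 (ε / 4) :=
    (eventually_lt_nhds (by positivity)).filter_mono nhdsWithin_le_nhds
  obtain ⟨r, ⟨hr1, hr2⟩, hr0⟩ := (((hev.and hev2).and self_mem_nhdsWithin).exists)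
  have hr0 : 0 < r := hr0
  have hr3 : r < 1 := hr2.trans_le (min_le_left _ _)
  have hr4 : r < ε / 4 := hr2.trans_le (min_le_right _ _)
  have hPR : ∀ z ∈ P, z ∈ R := fun z hz => (hPA hz).1
  have hnear : ∀ z ∈ P, ∀ y ∈ tiny r z, y ∈ Isq ∧ dist z y ≤ 2 * r := fun z hz y hy =>
    tiny_near hr0 hr3.le (hRs (hPR z hz)) hy
  set K : Set (ℝ × ℝ) := ⋃ z ∈ P, tiny r z with hK
  have hKmem : ∀ y, y ∈ K ↔ ∃ z ∈ P, y ∈ tiny r z := fun y => by simp [hK]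
  have hKc : IsCompact K := hPf.isCompact_biUnion fun z _ => tiny_comp r z
  have hK0 : volume K = 0 := (measure_biUnion_null_iff hPf.countable).2 fun z _ => tiny_null r z
  have hKi : interior K = ∅ := by
    by_contra h
    have := isOpen_interior.measure_pos volume (nonempty_iff_ne_empty.2 h)
    exact (this.trans_le (measure_mono interior_subset)).ne' hK0
  have htE : ∀ z ∈ P, ∀ y ∈ tiny r z, y ∉ E := fun z hz y hy hyE => by
    have h1 := (hPA hz).2
    have h2 := Metric.infDist_le_dist_of_mem (x := z) hyE
    have h3 := (hnear z hz y hy).2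
    have h1 : ε / 2 ≤ Metric.infDist z E := h1
    linarith
  have hKE : ∀ y ∈ K, y ∉ E := fun y hy => by
    obtain ⟨z, hz, hyz⟩ := (hKmem y).1 hy
    exact htE z hz y hyz
  have hinr : interior (E ∪ K) = interior E :=
    interior_union_isClosed_of_interior_empty hN.comp.isClosed hKi
  have hfr : frontier (E ∪ K) = frontier E ∪ K := by
    rw [(hN.comp.union hKc).isClosed.frontier_eq, hinr, hN.comp.isClosed.frontier_eq]
    ext y
    simp only [Set.mem_sdiff, mem_union]
    have h1 := hKE y
    have h2 : y ∈ interior E → y ∈ E := fun h => interior_subset h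
    constructor
    · rintro ⟨h3 | h3, h4⟩
      · exact Or.inl ⟨h3, h4⟩
      · exact Or.inr h3
    · rintro (⟨h3, h4⟩ | h3)
      · exact ⟨Or.inl h3, h4⟩
      · exact ⟨Or.inr h3, fun h => h1 h3 (h2 h)⟩
  refine ⟨E ∪ K, ⟨hN.comp.union hKc, ?_, ?_, insert (frontier E) (hPf.toFinset.image (tiny r)), ?_, ?_, ?_⟩, ?_, subset_union_left, ?_, ?_⟩
  · refine union_subset hN.sub fun y hy => ?_
    obtain ⟨z, hz, hyz⟩ := (hKmem y).1 hy
    exact (hnear z hz y hyz).1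
  · rw [hinr]; exact hN.int
  · intro C hC
    rw [Finset.mem_insert, Finset.mem_image] at hC
    rcases hC with rfl | ⟨z, _, rfl⟩
    · exact hN.jor
    · exact tiny_jor hr0 z
  · rw [hfr]
    ext y
    simp [hK]
  · have hd1 : ∀ z ∈ P, frontier E ∩ tiny r z = ∅ := fun z hz => by
      rw [← disjoint_iff_inter_eq_empty, Set.disjoint_left]
      exact fun y hy hyt => htE z hz y hyt (hN.comp.isClosed.frontier_subset hy)
    have hd2 : ∀ z ∈ P, ∀ w ∈ P, z ≠ w → tiny r z ∩ tiny r w = ∅ := fun z hz w hw hne => by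
      rw [← disjoint_iff_inter_eq_empty, Set.disjoint_left]
      intro y hy hyt
      have h1 := (hnear z hz y hy).2
      have h2 := (hnear w hw y hyt).2
      have h3 := hr1 z hz w hw hne
      have := dist_triangle_right z w y
      linarith
    intro C hC C' hC' hne
    rw [Finset.mem_insert, Finset.mem_image] at hC hC'
    rcases hC with rfl | ⟨z, hz, rfl⟩ <;> rcases hC' with rfl | ⟨w, hw, rfl⟩
    · exact absurd rfl hne
    · rw [hd1 w (hPf.mem_toFinset.1 hw)]; simp
    · rw [inter_comm, hd1 z (hPf.mem_toFinset.1 hz)]; simp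
    · rw [hd2 z (hPf.mem_toFinset.1 hz) w (hPf.mem_toFinset.1 hw) (fun h => hne (by rw [h]))]; simp
  · exact union_ae_eq_left_of_ae_eq_empty (ae_eq_empty.2 hK0)
  · intro x hx
    by_cases h : ε / 2 ≤ Metric.infDist x E
    · obtain ⟨p, hp⟩ := mem_iUnion.1 (hcov ⟨hx, h⟩)
      obtain ⟨hpP, hxp⟩ := mem_iUnion.1 hp
      obtain ⟨y, hy⟩ := tiny_ne r p
      refine ⟨y, Or.inr ((hKmem y).2 ⟨p, hpP, hy⟩), ?_⟩
      have h1 : dist x p < ε / 2 := hxp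
      have h2 := (hnear p hpP y hy).2
      have := dist_triangle x p y
      linarith
    · push Not at h
      obtain ⟨y, hy, hxy⟩ := (Metric.infDist_lt_iff hEne).1 h
      exact ⟨y, Or.inl hy, by linarith⟩
  · rintro y (hy | hy)
    · exact Or.inl hy
    · obtain ⟨z, hz, hyz⟩ := (hKmem y).1 hy
      exact Or.inr ⟨z, hPR z hz, by linarith [(hnear z hz y hyz).2]⟩

theorem main_aux {τ : ℝ × ℝ → ℝ} (hτ : IsNorm2 τ) {ε : ℝ} (hε : 0 < ε) :
    ∃ α₀ ∈ Set.Ioc (0:ℝ) 1, ∀ α ∈ Set.Ioc 0 α₀, ∀ R ∈ Ropt τ (2 + α), ∃ E ∈ Ropt τ 2,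
      Metric.hausdorffDist R E ≤ ε := by
  by_contra hcon
  push Not at hcon
  have h1 : ∀ n : ℕ, ∃ α : ℝ, (0 < α ∧ α ≤ 1 / ((n:ℝ) + 1)) ∧ ∃ R ∈ Ropt τ (2 + α), ∀ E ∈ Ropt τ 2,
      ε < Metric.hausdorffDist R E := fun n => by
    have hn : (0:ℝ) ≤ n := Nat.cast_nonneg n
    obtain ⟨α, hα, h⟩ := hcon (1 / ((n:ℝ) + 1)) ⟨by positivity, by rw [div_le_one (by positivity)]; linarith⟩
    exact ⟨α, hα, h⟩
  choose α hα R hR hfar using h1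
  have hvol : ∀ n, 2 < volume (R n) := fun n => by
    by_contra h
    push Not at h
    have h2 : R n ∈ Ropt τ 2 := by
      refine ⟨(hR n).1, by simpa using h, le_antisymm ?_ ?_⟩
      · rw [(hR n).2.2]; exact phiR_anti (by linarith [(hα n).1])
      · exact iInf₂_le (R n) ⟨(hR n).1, by simpa using h⟩
    have := hfar n _ h2
    rw [Metric.hausdorffDist_self_zero] at this
    linarith
  obtain ⟨φ, hφ, E, hN, hE2, hEc, hae⟩ := limit_set hτ hα hR hvol
  obtain ⟨n, hn⟩ := (near_of_conv hN (fun n => (hR (φ n)).1.1.measurableSet)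
    (fun n => (hR (φ n)).1.2.1) hae hε).exists
  obtain ⟨E', hM, hq, hsub, ha, hb⟩ := dirt hN (hR (φ n)).1.1 (hR (φ n)).1.2.1 hε
  have hE' : E' ∈ Ropt τ 2 := by
    refine ⟨hM, ?_, ?_⟩
    · rw [measure_congr hq, hE2]; simp
    · rw [conduct_congr hq, hEc]
  have h2 := hfar (φ n) E' hE'
  have h3 : Metric.hausdorffDist (R (φ n)) E' ≤ ε := by
    refine Metric.hausdorffDist_le_of_mem_dist hε.le ha fun y hy => ?_
    rcases hb y hy with h | ⟨x, hx, hxy⟩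
    · exact hn y h
    · exact ⟨x, hx, by rw [dist_comm]; exact hxy⟩
  linarith

end

/-- The optimizer sets `ℛ_τ^(2+α)` converge to `ℛ_τ^(2)` in Hausdorff distance as
`α → 0⁺`. -/
theorem optimizers_hausdorff_convergence (τ : ℝ × ℝ → ℝ) (hτ : IsNorm2 τ)
    (ε : ℝ) (hε : 0 < ε) :
    ∃ α₀ ∈ Set.Ioc (0 : ℝ) 1, ∀ α ∈ Set.Ioc (0 : ℝ) α₀, ∀ R ∈ Ropt τ (2 + α),
      ∃ E ∈ Ropt τ 2, Metric.hausdorffDist R E ≤ ε := by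
  exact main_aux hτ hε
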